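/- Consider the 2π-periodic analytic vector field X on ℝ^6 (coordinates u, Θ̂, v, α̂, Â, θ̂) given by: u' = −(1/4)(u+v)³u + (u+v)⁶O₀; Θ̂' = −(1/4)(u+v)²(u−v)Θ̂ − (1/2)(u+v)³Θ̂² + (u+v)⁵O₀; v' = (1/4)(u+v)³v + (u+v)⁶O₀; α̂' = (1/4)(u+v)²(u−v)α̂ + (u+v)⁵O₀; Â' = (1/4)(u+v)²(u−v)Â + (u+v)⁵O₀; θ̂' = (1/4)(u+v)²(u−v)θ̂ + (1/2)(u+v)³θ̂Θ̂, where each O₀ denotes a function of all six variables and of t, analytic near the origin and 2π-periodic and analytic in t (this is the system obtained from the spatial elliptic restricted three body problem with potential W = Û + V, V = r^{−3}V̂(r,α,θ,t) analytic in 1/r and in its other arguments and leaving the plane θ = Θ = 0 invariant, after McGehee-type coordinates near parabolic infinity). Then the origin is a parabolic fixed point and, setting x = (u, Θ̂) and y = (v, α̂, Â, θ̂), it has an analytic stable invariant two-dimensional manifold over the region {u > 0, Θ̂ > 0}, admitting a parametrization K(x,t) = (x,0) + K̃(x,t) with K̃(x,t) = O(‖x‖²), 2π-periodic in t, such that X(K(x,t),t)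 = DK(x,t) Y(x) + ∂_t K(x,t), where Y(x) = p(x,0) + O(‖x‖⁵) is a polynomial of degree 7 and p(x,y) = (−(1/4)(u+v)³u, −(1/4)(u+v)²(u−v)Θ̂). Moreover, for every ℓ ≥ 7, K̃(x,t) = Σ_{j=2}^{ℓ} K̆^j(x,t) + O(‖x‖^{ℓ+1}), where each K̆^j is a homogeneous polynomial of degree j in x (with coefficients 2π-periodic in t); that is, the stable invariant manifold admits polynomial approximation at the origin up to any order. -/

import Mathlib

open Metric Set Filter Asymptotics Topology

noncomputable section

section Defs

variable {E F G : Type*} [NormedAddCommGroup E] [NormedSpace ℝ E]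
  [NormedAddCommGroup F] [NormedSpace ℝ F] [NormedAddCommGroup G] [NormedSpace ℝ G]

/-- `p` is (the diagonal of) a continuous homogeneous polynomial map of degree `N`. -/
def IsHomogPoly (N : ℕ) (p : E → G) : Prop :=
  ∃ P : ContinuousMultilinearMap ℝ (fun _ : Fin N => E) G, ∀ x, p x = P fun _ => x

/-- positively homogeneous function of degree `j`. -/
def IsHomogFun (j : ℕ) (f : E → G) : Prop :=
  ∀ t : ℝ, 0 < t → ∀ x : E, f (t • x) = t ^ j • f x

/-- `V` is star-shaped with respect to the origin: `0 ∈ ∂V` and `t • x ∈ V` for `x ∈ V`,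
`t ∈ (0,1)`. -/
def StarShaped0 (V : Set E) : Prop :=
  0 ∈ frontier V ∧ ∀ x ∈ V, ∀ t : ℝ, t ∈ Set.Ioo (0 : ℝ) 1 → t • x ∈ V

/-- `V_ρ = V ∩ B_ρ`. -/
def Vrho (V : Set E) (ρ : ℝ) : Set E := V ∩ ball 0 ρ

/-- `h(x) = O(‖x‖^k)` on the set `S` (real exponent, global constant). -/
def BigOOn (h : E → G) (S : Set E) (k : ℝ) : Prop :=
  ∃ C : ℝ, ∀ x ∈ S, ‖h x‖ ≤ C * ‖x‖ ^ k

/-- The constant `a_p`. -/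
def apC (p : E × F → E) (V : Set E) (ρ : ℝ) (N : ℕ) : ℝ :=
  -sSup ((fun x : E => (‖x + p (x, 0)‖ - ‖x‖) / ‖x‖ ^ N) '' Vrho V ρ)

/-- The constant `b_p`. -/
def bpC (p : E × F → E) (V : Set E) (ρ : ℝ) (N : ℕ) : ℝ :=
  sSup ((fun x : E => ‖p (x, 0)‖ / ‖x‖ ^ N) '' Vrho V ρ)

/-- The constant `A_p`. -/
def ApC (p : E × F → E) (V : Set E) (ρ : ℝ) (N : ℕ) : ℝ :=
  -sSup ((fun x : E =>
      (‖ContinuousLinearMap.id ℝ E + fderiv ℝ (fun z : E => p (z, 0)) x‖ - 1) / ‖x‖ ^ (N - 1))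
    '' Vrho V ρ)

/-- The constant `B_p`. -/
def BpC (p : E × F → E) (V : Set E) (ρ : ℝ) (N : ℕ) : ℝ :=
  sSup ((fun x : E =>
      (‖ContinuousLinearMap.id ℝ E - fderiv ℝ (fun z : E => p (z, 0)) x‖ - 1) / ‖x‖ ^ (N - 1))
    '' Vrho V ρ)

/-- The constant `B_q`. -/
def BqC (q : E × F → F) (V : Set E) (ρ : ℝ) (M : ℕ) : ℝ :=
  -sSup ((fun x : E =>
      (‖ContinuousLinearMap.id ℝ F - fderiv ℝ (fun y : F => q (x, y)) 0‖ - 1) / ‖x‖ ^ (M - 1))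
    '' Vrho V ρ)

/-- The constant `c_p`. -/
def cpC (p : E × F → E) (q : E × F → F) (V : Set E) (ρ : ℝ) (N M : ℕ) : ℝ :=
  if BqC q V ρ M ≤ 0 then apC p V ρ N else bpC p V ρ N

/-- The constant `d_p`. -/
def dpC (p : E × F → E) (V : Set E) (ρ : ℝ) (N : ℕ) : ℝ :=
  if ApC p V ρ N ≤ 0 then apC p V ρ N else bpC p V ρ N

/-- `η = 1 + N - L`, `L = min{N,M}`. -/
def etaC (N M : ℕ) : ℝ := 1 + (N : ℝ) - (min N M : ℝ)

/-- `ℓ₀ = N - 1 + B_p/a_p + max{η - A_p/d_p, 0}`. -/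
def ell0C (p : E × F → E) (V : Set E) (ρ : ℝ) (N M : ℕ) : ℝ :=
  (N : ℝ) - 1 + BpC p V ρ N / apC p V ρ N + max (etaC N M - ApC p V ρ N / dpC p V ρ N) 0

/-- `ℓ̃ = N - 1 + B_p/a_p + (η - 1)`. -/
def elltC (p : E × F → E) (V : Set E) (ρ : ℝ) (N M : ℕ) : ℝ :=
  (N : ℝ) - 1 + BpC p V ρ N / apC p V ρ N + (etaC N M - 1)

/-- The optimal constant in hypothesis H3. -/
def CIC (p : E × F → E) (V : Set E) (ρ : ℝ) (N : ℕ) : ℝ :=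
  sInf ((fun x : E => infDist (x + p (x, 0)) (Vrho V ρ)ᶜ / ‖x‖ ^ N) '' Vrho V ρ)

/-- Hypothesis H1. -/
def HypH1 (p : E × F → E) (V : Set E) (ρ : ℝ) (N : ℕ) : Prop := 0 < apC p V ρ N

/-- Hypothesis H2. -/
def HypH2 (p : E × F → E) (q : E × F → F) (V : Set E) (ρ : ℝ) (N M : ℕ) : Prop :=
  (∀ x ∈ Vrho V ρ, q (x, 0) = 0) ∧
  (M < N → 0 < BqC q V ρ M) ∧ (M = N → -(N : ℝ) * apC p V ρ N < BqC q V ρ M)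

/-- Hypothesis H3. -/
def HypH3 (p : E × F → E) (V : Set E) (ρ : ℝ) (N : ℕ) : Prop :=
  ∃ C > (0 : ℝ), ∀ x ∈ Vrho V ρ, C * ‖x‖ ^ N ≤ infDist (x + p (x, 0)) (Vrho V ρ)ᶜ

/-- Hypothesis H1'. -/
def HypH1' (p : E × F → E) (V : Set E) (ρ : ℝ) (N M : ℕ) : Prop :=
  0 < apC p V ρ N ∧ (N < M → -1 < ApC p V ρ N / dpC p V ρ N)

/-- Hypothesis H2'. -/
def HypH2' (p : E × F → E) (q : E × F → F) (V : Set E) (ρ : ℝ) (N M : ℕ) : Prop :=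
  (∀ x ∈ Vrho V ρ, q (x, 0) = 0) ∧
  (M < N → 0 < BqC q V ρ M) ∧
  (M = N → max (1 - ApC p V ρ N / dpC p V ρ N) 0 < 2 + BqC q V ρ M / cpC p q V ρ N M)

/-- `F` is in parabolic form of degrees `(N, M)` on `U`. -/
def ParabolicForm (U : Set (E × F)) (Fm : E × F → E × F) (p : E × F → E) (q : E × F → F)
    (N M : ℕ) : Prop :=
  2 ≤ N ∧ 2 ≤ M ∧ IsHomogPoly N p ∧ IsHomogPoly M q ∧
    (fun z : E × F => (Fm z).1 - z.1 - p z) =O[𝓝[U] 0] (fun z : E × F => ‖z‖ ^ (N + 1)) ∧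
    (fun z : E × F => (Fm z).2 - z.2 - q z) =O[𝓝[U] 0] (fun z : E × F => ‖z‖ ^ (M + 1))

/-- The local stable set `W^s_{V,ρ}` of the origin. -/
def stableSetLoc (Fm : E × F → E × F) (U : Set (E × F)) (V : Set E) (ρ : ℝ) : Set (E × F) :=
  {z ∈ U | (∀ k : ℕ, (Fm^[k] z).1 ∈ Vrho V ρ) ∧ Tendsto (fun k => Fm^[k] z) atTop (𝓝 0)}

/-- `f` is `C¹` at the origin in the sense of the paper (Definition 2.3). -/
def C1AtOrigin (f : E → G) (S : Set E) : Prop :=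
  (∃ ε > (0 : ℝ), ContDiffOn ℝ 1 f ((S ∩ ball 0 ε) \ {0})) ∧
  ∃ L : E →L[ℝ] G, Tendsto (fun x => fderivWithin ℝ f S x) (𝓝[S \ {0}] 0) (𝓝 L)

/-- `c < r` where `r` is an extended natural smoothness exponent. -/
def ltSmooth (c : ℝ) (r : ℕ∞) : Prop := ∃ k : ℕ, c < (k : ℝ) ∧ (k : ℕ∞) ≤ r

/-- The regularity degree `r_d`. -/
def rdC (p : E × F → E) (V : Set E) (ρ : ℝ) (N M : ℕ) (r : ℕ) : ℕ :=
  sSup {k : ℕ |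
    (etaC N M - ApC p V ρ N / dpC p V ρ N) * k < (r : ℝ) - BpC p V ρ N / apC p V ρ N - N + 1}

/-- The regularity degree `r_f` of the formal approximation. -/
def rfC (p : E × F → E) (q : E × F → F) (V : Set E) (ρ : ℝ) (N M : ℕ) : ℕ :=
  if M = N then
    sSup {k : ℕ | (1 - ApC p V ρ N / dpC p V ρ N) * k < 2 + BqC q V ρ M / cpC p q V ρ N M}
  else sSup {k : ℕ | (1 - ApC p V ρ N / dpC p V ρ N) * k < 2}

end Defs

section PartPA
/-- The Osgood property for a complex normed space. -/
def Osg (E : Type) [NormedAddCommGroup E] [NormedSpace ℂ E] : Prop :=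
  ∀ (F : Type) [NormedAddCommGroup F] [NormedSpace ℂ F] [CompleteSpace F] (U : Set E) (f : E → F),
    IsOpen U → ContinuousOn f U →
    (∀ w ∈ U, ∀ v : E, DifferentiableAt ℂ (fun ζ : ℂ => f (w + ζ • v)) 0) → AnalyticOnNhd ℂ f U

lemma osg_C : Osg ℂ := by
  intro F _ _ _ U f hU _ hf
  apply DifferentiableOn.analyticOnNhd _ hU
  intro w hw
  have h := hf w hw 1
  have h2 : DifferentiableAt ℂ (fun z => f (w + (z - w) • (1:ℂ))) w := by
    apply DifferentiableAt.comp (f := fun z => z - w) (g := fun ζ : ℂ => f (w + ζ • (1:ℂ)))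
    · simpa using h
    · fun_prop
  have : (fun z => f (w + (z - w) • (1:ℂ))) = f := by ext z; simp
  rw [this] at h2
  exact h2.differentiableWithinAt

section osgstep
variable {F : Type} [NormedAddCommGroup F] [NormedSpace ℂ F] [CompleteSpace F]

/-- Circle pairing. -/
def circPair (z0 : ℂ) (r : ℝ) (hr : 0 ≤ r) (c : C(sphere z0 r, ℂ)) (g : C(sphere z0 r, F)) : F :=
  ∫ θ in (0:ℝ)..2 * Real.pi, (deriv (circleMap z0 r) θ) •
    ((c ⟨circleMap z0 r θ, circleMap_mem_sphere z0 hr θ⟩) •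
      (g ⟨circleMap z0 r θ, circleMap_mem_sphere z0 hr θ⟩))

lemma circPair_cont (z0 : ℂ) (r : ℝ) (hr : 0 ≤ r) (c : C(sphere z0 r, ℂ)) (g : C(sphere z0 r, F)) :
    Continuous (fun θ => (deriv (circleMap z0 r) θ) •
    ((c ⟨circleMap z0 r θ, circleMap_mem_sphere z0 hr θ⟩) •
      (g ⟨circleMap z0 r θ, circleMap_mem_sphere z0 hr θ⟩))) := by
  have : Continuous (fun θ => (⟨circleMap z0 r θ, circleMap_mem_sphere z0 hr θ⟩ : sphere z0 r)) :=
    (continuous_circleMap z0 r).subtype_mk _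
  simp only [deriv_circleMap]
  have h2 := continuous_circleMap 0 r
  fun_prop

def circPairL (z0 : ℂ) (r : ℝ) (hr : 0 ≤ r) :
    C(sphere z0 r, ℂ) →L[ℂ] C(sphere z0 r, F) →L[ℂ] F :=
  LinearMap.mkContinuous₂ (LinearMap.mk₂ ℂ (circPair z0 r hr)
    (by
      intro c c' g
      simp only [circPair]
      rw [← intervalIntegral.integral_add]
      · congr 1; ext θ; simp [add_smul]
      · exact (circPair_cont z0 r hr c g).intervalIntegrable _ _
      · exact (circPair_cont z0 r hr c' g).intervalIntegrable _ _)
    (by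
      intro a c g
      simp only [circPair]
      rw [← intervalIntegral.integral_smul]
      congr 1; ext θ; simp only [ContinuousMap.smul_apply, smul_eq_mul, smul_smul]; congr 1; ring)
    (by
      intro c g g'
      simp only [circPair]
      rw [← intervalIntegral.integral_add]
      · congr 1; ext θ; simp [smul_add]
      · exact (circPair_cont z0 r hr c g).intervalIntegrable _ _
      · exact (circPair_cont z0 r hr c g').intervalIntegrable _ _)
    (by
      intro a c g
      simp only [circPair]
      rw [← intervalIntegral.integral_smul]
      congr 1; ext θ; simp only [ContinuousMap.smul_apply, smul_smul]; congr 1; ring))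
    (r * |2 * Real.pi - 0|)
    (by
      intro c g
      simp only [LinearMap.mk₂_apply, circPair]
      refine (intervalIntegral.norm_integral_le_of_norm_le_const (C := r * ‖c‖ * ‖g‖) ?_).trans
        (le_of_eq (by ring))
      intro θ _
      rw [norm_smul, norm_smul, ← mul_assoc]
      gcongr
      · simp [abs_of_nonneg hr]
      · exact c.norm_coe_le_norm _
      · exact g.norm_coe_le_norm _)

lemma circPairL_apply (z0 : ℂ) (r : ℝ) (hr : 0 ≤ r) (c : C(sphere z0 r, ℂ)) (g : C(sphere z0 r, F)) :
    circPairL z0 r hr c g = circPair z0 r hr c g := rfl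

end osgstep

lemma osg_step {E : Type} [NormedAddCommGroup E] [NormedSpace ℂ E] (hE : Osg E) : Osg (E × ℂ) := by
  intro F _ _ _ U f hU hc hd
  rintro ⟨e0, z0⟩ h0
  obtain ⟨R, hR, hRU⟩ := Metric.isOpen_iff.1 hU _ h0
  obtain ⟨r, hr, hrR⟩ := exists_between hR
  have hmem : ∀ e ∈ ball e0 r, ∀ z ∈ closedBall z0 r, (e, z) ∈ U := by
    intro e he z hz
    apply hRU
    rw [mem_ball, Prod.dist_eq, max_lt_iff]
    exact ⟨(mem_ball.1 he).trans hrR, (mem_closedBall.1 hz).trans_lt hrR⟩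
  -- 
  classical
  have hcontz : ∀ e ∈ ball e0 r, Continuous (fun z : sphere z0 r => f (e, z)) := by
    intro e he
    have : ContinuousOn (fun z => f (e, z)) (sphere z0 r) :=
      hc.comp (by fun_prop) (fun z hz => hmem e he z (sphere_subset_closedBall hz))
    exact continuousOn_iff_continuous_domRestrict.1 this
  let G : E → C(sphere z0 r, F) := fun e =>
    if he : e ∈ ball e0 r then ⟨fun z => f (e, z), hcontz e he⟩ else 0
  have hG : ∀ e ∈ ball e0 r, ∀ z : sphere z0 r, G e z = f (e, z) := by
    intro e he z
    simp only [G, dif_pos he, ContinuousMap.coe_mk]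
  have hGc : ContinuousOn G (ball e0 r) := by
    apply ContinuousMap.continuousOn_of_continuousOn_uncurry
    have : ContinuousOn (fun p : E × sphere z0 r => f (p.1, p.2)) (ball e0 r ×ˢ univ) :=
      hc.comp (by fun_prop) (fun p hp => hmem _ hp.1 _ (sphere_subset_closedBall p.2.2))
    refine this.congr ?_
    rintro ⟨e, z⟩ ⟨he, -⟩
    exact hG e he z
  have hdE : ∀ e z, (e, z) ∈ U → ∀ v : E, DifferentiableAt ℂ (fun ζ : ℂ => f (e + ζ • v, z)) 0 := by
    intro e z hz v
    simpa using hd (e, z) hz (v, 0)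
  have hdE' : ∀ e z v (ζ : ℂ), (e + ζ • v, z) ∈ U →
      DifferentiableAt ℂ (fun ζ : ℂ => f (e + ζ • v, z)) ζ := by
    intro e z v ζ hz
    have h := hdE _ z hz v
    have h2 : DifferentiableAt ℂ (fun ζ' => (fun ζ'' : ℂ => f (e + ζ • v + ζ'' • v, z)) (ζ' - ζ)) ζ := by
      apply DifferentiableAt.comp (g := fun ζ'' : ℂ => f (e + ζ • v + ζ'' • v, z)) (f := fun ζ' : ℂ => ζ' - ζ)
      · simpa using h
      · fun_prop
    convert h2 using 2 with ζ'
    simp [sub_smul]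
  have hGd : ∀ e ∈ ball e0 r, ∀ v : E, DifferentiableAt ℂ (fun ζ : ℂ => G (e + ζ • v)) 0 := by
    intro e he v
    have hopen : IsOpen ((fun ζ : ℂ => e + ζ • v) ⁻¹' ball e0 r) :=
      isOpen_ball.preimage (by fun_prop)
    obtain ⟨s', hs', hs'U⟩ := Metric.isOpen_iff.1 hopen 0 (by simpa using he)
    obtain ⟨s, hs, hss⟩ := exists_between hs'
    have hsub : ∀ ζ ∈ closedBall (0:ℂ) s, e + ζ • v ∈ ball e0 r := fun ζ hζ =>
      hs'U (closedBall_subset_ball hss hζ)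
    lift s to NNReal using hs.le
    have hs0 : 0 < s := by exact_mod_cast hs
    have hgc : ContinuousOn (fun ζ : ℂ => G (e + ζ • v)) (closedBall 0 s) :=
      hGc.comp (by fun_prop) hsub
    have hci : CircleIntegrable (fun ζ : ℂ => G (e + ζ • v)) 0 s :=
      (hgc.mono sphere_subset_closedBall).circleIntegrable hs.le
    have hps := hasFPowerSeriesOn_cauchy_integral hci hs0
    refine (hps.analyticAt.differentiableAt).congr_of_eventuallyEq ?_
    filter_upwards [ball_mem_nhds (0:ℂ) hs] with w hw
    ext z
    have hz : (z:ℂ) ∈ closedBall z0 r := sphere_subset_closedBall z.2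
    have h1 : DiffContOnCl ℂ (fun ζ : ℂ => f (e + ζ • v, z)) (ball 0 s) := by
      apply DifferentiableOn.diffContOnCl
      intro ζ hζ
      rw [closure_ball _ hs.ne'] at hζ
      exact (hdE' e z v ζ (hmem _ (hsub ζ hζ) _ hz)).differentiableWithinAt
    have h2 := h1.two_pi_i_inv_smul_circleIntegral_sub_inv_smul hw
    rw [hG _ (hsub w (ball_subset_closedBall hw)), ← h2, ContinuousMap.smul_apply]
    congr 1
    simp only [circleIntegral]
    rw [← ContinuousMap.evalCLM_apply (R := ℂ), intervalIntegral.integral_of_le (by positivity),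
      intervalIntegral.integral_of_le (by positivity),
      ← ContinuousLinearMap.integral_comp_comm]
    · congr 1
      ext θ
      simp only [map_smul, ContinuousMap.evalCLM_apply]
      rw [hG _ (hsub _ (sphere_subset_closedBall (circleMap_mem_sphere 0 hs.le θ)))]
    · have : CircleIntegrable (fun ζ : ℂ => (ζ - w)⁻¹ • G (e + ζ • v)) 0 s := by
        apply ContinuousOn.circleIntegrable hs.le
        apply ContinuousOn.fun_smul _ (hgc.mono sphere_subset_closedBall)
        apply ContinuousOn.inv₀ (by fun_prop)
        intro ζ hζ h
        rw [sub_eq_zero] at h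
        subst h
        simp at hζ hw
        exact hw.ne hζ
      have := this.out
      rwa [intervalIntegrable_iff_integrableOn_Ioc_of_le (by positivity)] at this
  have hGa := hE _ (ball e0 r) G isOpen_ball hGc hGd
  -- inverse
  let idS : C(sphere z0 r, ℂ) := ⟨fun z => (z:ℂ), continuous_subtype_val⟩
  let cc : ℂ → C(sphere z0 r, ℂ) := fun z => Ring.inverse (idS - algebraMap ℂ _ z)
  have hcc : ∀ z ∈ ball z0 r, IsUnit (idS - algebraMap ℂ C(sphere z0 r, ℂ) z) := by
    intro z hz
    rw [ContinuousMap.isUnit_iff_forall_ne_zero]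
    intro y h
    simp [idS, sub_eq_zero] at h
    have := y.2
    rw [h] at this
    rw [mem_sphere] at this
    exact (mem_ball.1 hz).ne this
  have hcca : ∀ z ∈ ball z0 r, AnalyticAt ℂ cc z := by
    intro z hz
    have h1 : AnalyticAt ℂ (Ring.inverse : C(sphere z0 r, ℂ) → _) (idS - algebraMap ℂ _ z) :=
      analyticOnNhd_inverse _ (hcc z hz)
    have h2 : AnalyticAt ℂ (fun z : ℂ => idS - algebraMap ℂ C(sphere z0 r, ℂ) z) z := by
      apply AnalyticAt.sub analyticAt_const
      exact (Algebra.linearMap ℂ C(sphere z0 r, ℂ)).toContinuousLinearMap.analyticAt z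
    exact AnalyticAt.comp (g := (Ring.inverse : C(sphere z0 r, ℂ) → _)) h1 h2
  have hccv : ∀ z ∈ ball z0 r, ∀ y : sphere z0 r, cc z y = ((y:ℂ) - z)⁻¹ := by
    intro z hz y
    have h1 := Ring.mul_inverse_cancel _ (hcc z hz)
    have h2 := congrArg (fun g : C(sphere z0 r, ℂ) => g y) h1
    simp [idS] at h2
    exact eq_inv_of_mul_eq_one_right h2
  have hdz : ∀ e z, (e, z) ∈ U → DifferentiableAt ℂ (fun z => f (e, z)) z := by
    intro e z hz
    have h := hd (e, z) hz (0, 1)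
    have h2 : DifferentiableAt ℂ (fun z' => (fun ζ : ℂ => f ((e, z) + ζ • ((0:E), (1:ℂ)))) (z' - z)) z := by
      apply DifferentiableAt.comp (g := fun ζ : ℂ => f ((e, z) + ζ • ((0:E), (1:ℂ)))) (f := fun z' : ℂ => z' - z)
      · simpa using h
      · fun_prop
    convert h2 using 2 with z'
    simp
  have hfin : ∀ᶠ p in 𝓝 (e0, z0), f p =
      (2 * Real.pi * Complex.I : ℂ)⁻¹ • circPairL z0 r hr.le (cc p.2) (G p.1) := by
    have : ball e0 r ×ˢ ball z0 r ∈ 𝓝 (e0, z0) := prod_mem_nhds (ball_mem_nhds _ hr) (ball_mem_nhds _ hr)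
    filter_upwards [this]
    rintro ⟨e, z⟩ ⟨he, hz⟩
    simp only at he hz ⊢
    have h1 : DiffContOnCl ℂ (fun z => f (e, z)) (ball z0 r) := by
      apply DifferentiableOn.diffContOnCl
      intro ζ hζ
      rw [closure_ball _ hr.ne'] at hζ
      exact (hdz e ζ (hmem _ he _ hζ)).differentiableWithinAt
    rw [← h1.two_pi_i_inv_smul_circleIntegral_sub_inv_smul hz]
    congr 1
    rw [circPairL_apply, circPair, circleIntegral]
    congr 1
    ext θ
    rw [hccv z hz, hG e he]
  have hpr1 : AnalyticAt ℂ (Prod.fst : E × ℂ → E) (e0, z0) := analyticAt_fst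
  have hpr2 : AnalyticAt ℂ (Prod.snd : E × ℂ → ℂ) (e0, z0) := analyticAt_snd
  have hA : AnalyticAt ℂ (fun p : E × ℂ => G p.1) (e0, z0) :=
    AnalyticAt.comp (g := G) (f := Prod.fst) (hGa e0 (mem_ball_self hr)) hpr1
  have hB : AnalyticAt ℂ (fun p : E × ℂ => cc p.2) (e0, z0) :=
    AnalyticAt.comp (g := cc) (f := Prod.snd) (hcca z0 (mem_ball_self hr)) hpr2
  refine AnalyticAt.congr ?_ (hfin.mono fun _ h => h.symm)
  apply AnalyticAt.fun_const_smul
  have hbil := (circPairL (F := F) z0 r hr.le).analyticAt_bilinear (cc z0, G e0)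
  exact AnalyticAt.comp (f := fun p : E × ℂ => (cc p.2, G p.1)) hbil (hB.prod hA)

lemma osg_C2 : Osg (ℂ × ℂ) := osg_step osg_C
lemma osg_C3 : Osg ((ℂ × ℂ) × ℂ) := osg_step osg_C2

end PartPA

section PartPA2
open MeasureTheory
section
variable {E F : Type} [NormedAddCommGroup E] [NormedSpace ℂ E]
  [NormedAddCommGroup F] [NormedSpace ℂ F] [CompleteSpace F]

/-- directional differentiability along complex lines -/
lemma analytic_line {U : Set E} {f : E → F} (hf : AnalyticOnNhd ℂ f U) {w v : E} {ζ : ℂ}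
    (h : w + ζ • v ∈ U) : AnalyticAt ℂ (fun ζ : ℂ => f (w + ζ • v)) ζ := by
  have h1 : AnalyticAt ℂ (fun ζ : ℂ => w + ζ • v) ζ := by fun_prop
  exact AnalyticAt.comp (g := f) (f := fun ζ : ℂ => w + ζ • v) (hf _ h) h1

lemma int_analytic (hE : Osg E) {α : Type*} [MeasurableSpace α] (ν : Measure α) {U : Set E}
    (hU : IsOpen U) (f : α → E → F)
    (hm : ∀ w ∈ U, AEStronglyMeasurable (fun s => f s w) ν)
    (ha : ∀ᵐ s ∂ν, AnalyticOnNhd ℂ (f s) U)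
    (hb : ∀ w₀ ∈ U, ∃ bound : α → ℝ, Integrable bound ν ∧ ∃ ε > 0, ∀ᵐ s ∂ν, ∀ w ∈ ball w₀ ε,
      w ∈ U → ‖f s w‖ ≤ bound s) :
    AnalyticOnNhd ℂ (fun w => ∫ s, f s w ∂ν) U := by
  apply hE F U _ hU
  · intro w hw
    apply ContinuousAt.continuousWithinAt
    obtain ⟨bound, hbi, ε, hε, hbd⟩ := hb w hw
    refine continuousAt_of_dominated (bound := bound) ?_ ?_ hbi ?_
    · filter_upwards [hU.mem_nhds hw] with x hx using hm x hx
    · filter_upwards [hU.mem_nhds hw, ball_mem_nhds w hε] with x hx hx2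
      filter_upwards [hbd] with s hs using hs x hx2 hx
    · filter_upwards [ha] with s hs using (hs w hw).continuousAt
  · intro w hw v
    obtain ⟨bound, hbi, ε, hε, hbd⟩ := hb w hw
    have hopen : IsOpen ((fun ζ : ℂ => w + ζ • v) ⁻¹' (ball w ε ∩ U)) :=
      (isOpen_ball.inter hU).preimage (by fun_prop)
    obtain ⟨s', hs', hsub⟩ := Metric.isOpen_iff.1 hopen 0 (by simp [hw, hε])
    have hsub1 : ∀ ζ ∈ ball (0:ℂ) s', w + ζ • v ∈ U := fun ζ hζ => (hsub hζ).2
    have hsub2 : ∀ ζ ∈ ball (0:ℂ) s', w + ζ • v ∈ ball w ε := fun ζ hζ => (hsub hζ).1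
    have h4 : ∀ ζ ∈ ball (0:ℂ) (s'/4), closedBall ζ (s'/4) ⊆ ball 0 s' := by
      intro ζ hζ
      apply closedBall_subset_ball'
      have := mem_ball.1 hζ
      linarith
    have hlim : ∀ᵐ s ∂ν, Tendsto (fun n : ℕ => ((((s'/4/(n+1) : ℝ) : ℂ))⁻¹) •
        (f s (w + ((s'/4/(n+1) : ℝ) : ℂ) • v) - f s (w + (0:ℂ) • v))) atTop
        (𝓝 (deriv (fun ζ : ℂ => f s (w + ζ • v)) 0)) := by
      filter_upwards [ha] with s hs
      have h1 : HasDerivAt (fun ζ : ℂ => f s (w + ζ • v)) (deriv (fun ζ : ℂ => f s (w + ζ • v)) 0) 0 :=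
        (analytic_line hs (by simpa using hw)).differentiableAt.hasDerivAt
      rw [hasDerivAt_iff_tendsto_slope_zero] at h1
      simp only [zero_add] at h1
      have h2 : Tendsto (fun n : ℕ => ((s'/4/(n+1) : ℝ) : ℂ)) atTop (𝓝[≠] 0) := by
        rw [tendsto_nhdsWithin_iff]
        constructor
        · have h3 : Tendsto (fun n : ℕ => (s'/4) / ((n:ℝ)+1)) atTop (𝓝 0) :=
            tendsto_const_nhds.div_atTop (tendsto_atTop_add_const_right _ _ tendsto_natCast_atTop_atTop)
          exact (Complex.continuous_ofReal.tendsto 0).comp h3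
        · refine Eventually.of_forall fun n => ?_
          simp only [mem_compl_iff, mem_singleton_iff, Complex.ofReal_eq_zero]
          have : (0:ℝ) < n + 1 := by positivity
          positivity
      exact h1.comp h2
    have key := hasDerivAt_integral_of_dominated_loc_of_deriv_le (𝕜 := ℂ) (μ := ν)
      (F := fun ζ s => f s (w + ζ • v)) (F' := fun ζ s => deriv (fun ζ : ℂ => f s (w + ζ • v)) ζ)
      (x₀ := 0) (s := ball 0 (s'/4)) (bound := fun s => bound s / (s'/4))
      (ball_mem_nhds _ (by positivity)) ?_ ?_ ?_ ?_ ?_ ?_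
    · exact key.2.differentiableAt
    · filter_upwards [ball_mem_nhds (0:ℂ) hs'] with ζ hζ
      exact hm _ (hsub1 ζ hζ)
    · refine Integrable.mono' hbi (by simpa using hm w hw) ?_
      filter_upwards [hbd] with s hs
      simpa using hs w (mem_ball_self hε) hw
    · refine aestronglyMeasurable_of_tendsto_ae atTop (fun n : ℕ => ?_) hlim
      have h0 : ((s'/4/((n:ℝ)+1) : ℝ) : ℂ) ∈ ball (0:ℂ) s' := by
        rw [mem_ball_zero_iff, Complex.norm_real, Real.norm_of_nonneg (by positivity)]
        have : (s'/4) / ((n:ℝ)+1) ≤ s'/4 := div_le_self (by positivity) (by linarith [Nat.cast_nonneg (α := ℝ) n])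
        linarith
      exact ((hm _ (hsub1 _ h0)).sub (by simpa using hm w hw)).const_smul _
    · filter_upwards [ha, hbd] with s hs hsb ζ hζ
      apply Complex.norm_deriv_le_of_forall_mem_sphere_norm_le (by positivity)
      · apply DifferentiableOn.diffContOnCl
        intro z hz
        rw [closure_ball _ (by positivity)] at hz
        exact (analytic_line hs (hsub1 z (h4 ζ hζ hz))).differentiableAt.differentiableWithinAt
      · intro z hz
        have := h4 ζ hζ (sphere_subset_closedBall hz)
        exact hsb _ (hsub2 z this) (hsub1 z this)
    · exact hbi.div_const _
    · filter_upwards [ha] with s hs ζ hζ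
      have : ζ ∈ ball (0:ℂ) s' := ball_subset_ball (by linarith) hζ
      exact (analytic_line hs (hsub1 _ this)).differentiableAt.hasDerivAt

/-- locally uniform limits of analytic functions. -/
lemma lim_analytic (hE : Osg E) {U : Set E} (hU : IsOpen U) (f : ℕ → E → F) (g : E → F)
    (hf : ∀ n, AnalyticOnNhd ℂ (f n) U) (hl : TendstoLocallyUniformlyOn f g atTop U) :
    AnalyticOnNhd ℂ g U := by
  apply hE F U _ hU
  · exact hl.continuousOn (Frequently.of_forall fun n => (hf n).continuousOn)
  · intro w hw v
    have hopen : IsOpen ((fun ζ : ℂ => w + ζ • v) ⁻¹' U) := hU.preimage (by fun_prop)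
    have h1 : TendstoLocallyUniformlyOn (fun n (ζ : ℂ) => f n (w + ζ • v))
        (fun ζ => g (w + ζ • v)) atTop ((fun ζ : ℂ => w + ζ • v) ⁻¹' U) :=
      hl.comp (fun ζ : ℂ => w + ζ • v) (mapsTo_preimage _ _) (by fun_prop)
    have h2 := h1.differentiableOn (Eventually.of_forall fun n ζ hζ =>
      (analytic_line (hf n) hζ).differentiableAt.differentiableWithinAt) hopen
    exact h2.differentiableAt (hopen.mem_nhds (by simpa using hw))

/-- contraction principle for analytic functions -/
lemma contr_analytic (hE : Osg E) {U : Set E} (hU : IsOpen U) (w : E → ℝ) (hw : ∀ e ∈ U, 0 ≤ w e)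
    (hwb : ∀ e₀ ∈ U, ∃ B, ∀ᶠ e in 𝓝 e₀, w e ≤ B) (M q : ℝ) (hM : 0 ≤ M) (hq0 : 0 ≤ q) (hq : q < 1)
    (Q : (E → F) → Prop) (hQ0 : Q 0)
    (hQlim : ∀ (sq : ℕ → E → F) (η : E → F), (∀ n, Q (sq n)) →
      (∀ e ∈ U, Tendsto (fun n => sq n e) atTop (𝓝 (η e))) → Q η)
    (T : (E → F) → (E → F))
    (hT : ∀ η, (AnalyticOnNhd ℂ η U ∧ (∀ e ∈ U, ‖η e‖ ≤ M * w e) ∧ Q η) →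
      (AnalyticOnNhd ℂ (T η) U ∧ (∀ e ∈ U, ‖T η e‖ ≤ M * w e) ∧ Q (T η)))
    (hTc : ∀ η η' c, 0 ≤ c → (AnalyticOnNhd ℂ η U ∧ (∀ e ∈ U, ‖η e‖ ≤ M * w e) ∧ Q η) →
      (AnalyticOnNhd ℂ η' U ∧ (∀ e ∈ U, ‖η' e‖ ≤ M * w e) ∧ Q η') →
      (∀ e ∈ U, ‖η e - η' e‖ ≤ c * w e) → ∀ e ∈ U, ‖T η e - T η' e‖ ≤ q * c * w e) :
    ∃ η, (AnalyticOnNhd ℂ η U ∧ (∀ e ∈ U, ‖η e‖ ≤ M * w e) ∧ Q η) ∧ ∀ e ∈ U, T η e = η e := by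
  set Adm : (E → F) → Prop := fun η => (AnalyticOnNhd ℂ η U ∧ (∀ e ∈ U, ‖η e‖ ≤ M * w e) ∧ Q η)
    with hAdm
  let sq : ℕ → E → F := fun n => T^[n] 0
  have hA : ∀ n, Adm (sq n) := by
    intro n
    induction n with
    | zero =>
      refine ⟨?_, ?_, hQ0⟩
      · exact analyticOnNhd_const
      · intro e he; simp only [sq, Function.iterate_zero, id, Pi.zero_apply, norm_zero]
        exact mul_nonneg hM (hw e he)
    | succ n ih =>
      simp only [sq, Function.iterate_succ', Function.comp_apply]
      exact hT _ ih
  have hst : ∀ n, ∀ e ∈ U, ‖sq n e - sq (n+1) e‖ ≤ (M * q ^ n) * w e := by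
    intro n
    induction n with
    | zero =>
      intro e he
      have := (hA 1).2.1 e he
      simpa [sq] using this
    | succ n ih =>
      intro e he
      have := hTc _ _ _ (by positivity) (hA n) (hA (n+1)) ih e he
      simp only [sq, Function.iterate_succ', Function.comp_apply] at this ⊢
      refine this.trans (le_of_eq (by ring))
  have hst' : ∀ e ∈ U, ∀ n, dist (sq n e) (sq (n+1) e) ≤ (M * w e) * q ^ n := by
    intro e he n
    rw [dist_eq_norm]
    exact (hst n e he).trans (le_of_eq (by ring))
  have hex : ∀ e, ∃ y, e ∈ U → Tendsto (fun n => sq n e) atTop (𝓝 y) := by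
    intro e
    by_cases he : e ∈ U
    · obtain ⟨y, hy⟩ := cauchySeq_tendsto_of_complete (cauchySeq_of_le_geometric q _ hq (hst' e he))
      exact ⟨y, fun _ => hy⟩
    · exact ⟨0, fun h => absurd h he⟩
  choose η hη using hex
  have hd : ∀ e ∈ U, ∀ n, ‖sq n e - η e‖ ≤ (M / (1 - q) * q ^ n) * w e := by
    intro e he n
    have := dist_le_of_le_geometric_of_tendsto q _ hq (hst' e he) (hη e he) n
    rw [dist_eq_norm] at this
    refine this.trans (le_of_eq (by ring))
  have h1q : 0 < 1 - q := by linarith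
  have hqn : Tendsto (fun n : ℕ => q ^ n) atTop (𝓝 0) := tendsto_pow_atTop_nhds_zero_of_lt_one hq0 hq
  have hloc : TendstoLocallyUniformlyOn sq η atTop U := by
    rw [Metric.tendstoLocallyUniformlyOn_iff]
    intro ε hε e he
    obtain ⟨B, hB⟩ := hwb e he
    refine ⟨{e' | w e' ≤ B} ∩ U, inter_mem (mem_nhdsWithin_of_mem_nhds hB) self_mem_nhdsWithin, ?_⟩
    have h0 : Tendsto (fun n : ℕ => M / (1-q) * q ^ n * (|B|)) atTop (𝓝 0) := by
      simpa using (hqn.const_mul (M / (1-q))).mul_const (|B|)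
    filter_upwards [h0.eventually (gt_mem_nhds hε)] with n hn y hy
    rw [dist_comm, dist_eq_norm]
    refine (hd y hy.2 n).trans_lt (lt_of_le_of_lt ?_ hn)
    have : w y ≤ |B| := le_trans hy.1 (le_abs_self B)
    gcongr
  have hAη : Adm η := by
    refine ⟨lim_analytic hE hU sq η (fun n => (hA n).1) hloc, ?_, hQlim sq η (fun n => (hA n).2.2) hη⟩
    intro e he
    exact le_of_tendsto (hη e he).norm (Eventually.of_forall fun n => (hA n).2.1 e he)
  refine ⟨η, hAη, fun e he => ?_⟩
  have h1 : Tendsto (fun n => sq (n+1) e) atTop (𝓝 (T η e)) := by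
    rw [tendsto_iff_norm_sub_tendsto_zero]
    have h2 : ∀ n, ‖sq (n+1) e - T η e‖ ≤ q * (M / (1-q) * q^n) * w e := by
      intro n
      have := hTc _ _ (M / (1-q) * q^n) (by positivity) (hA n) hAη (fun e he => hd e he n) e he
      simpa only [sq, Function.iterate_succ', Function.comp_apply] using this
    refine squeeze_zero (fun _ => norm_nonneg _) h2 ?_
    simpa using (((hqn.const_mul (M / (1-q))).const_mul q).mul_const (w e))
  exact tendsto_nhds_unique h1 ((hη e he).comp (tendsto_add_atTop_nat 1))
end

end PartPA2

section PartPB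
open MeasureTheory
/-- coordinatewise embedding of real vectors -/
def toC {ι : Type} (v : ι → ℝ) : ι → ℂ := fun i => (v i : ℂ)
def reV {ι : Type} (z : ι → ℂ) : ι → ℝ := fun i => (z i).re
def imV {ι : Type} (z : ι → ℂ) : ι → ℝ := fun i => (z i).im

section
variable {ι : Type} [Fintype ι] [DecidableEq ι]

lemma norm_toC (v : ι → ℝ) : ‖toC v‖ = ‖v‖ := by
  simp [toC, Pi.norm_def, nnnorm]

def cML {k : ℕ} (p : ContinuousMultilinearMap ℝ (fun _ : Fin k => (ι → ℝ)) ℝ) :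
    ContinuousMultilinearMap ℂ (fun _ : Fin k => (ι → ℂ)) ℂ :=
  ∑ s : Fin k → ι, ((p fun j => Pi.single (s j) 1 : ℝ) : ℂ) •
    (ContinuousMultilinearMap.mkPiAlgebra ℂ (Fin k) ℂ).compContinuousLinearMap
      (fun j => ContinuousLinearMap.proj (s j))

lemma norm_cML {k : ℕ} (p : ContinuousMultilinearMap ℝ (fun _ : Fin k => (ι → ℝ)) ℝ) :
    ‖cML p‖ ≤ (Fintype.card ι : ℝ) ^ k * ‖p‖ := by
  unfold cML
  refine (norm_sum_le_of_le _ (f := _) (n := fun _ => ‖p‖) ?_).trans (le_of_eq (by simp))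
  intro s _
  rw [norm_smul]
  have h1 : ‖(((p fun j => Pi.single (s j) 1 : ℝ) : ℂ))‖ ≤ ‖p‖ := by
    rw [Complex.norm_real]
    refine (p.le_opNorm _).trans (le_of_eq ?_)
    have : ∀ j : Fin k, ‖(Pi.single (s j) 1 : ι → ℝ)‖ = 1 := fun j => by
      rw [Pi.norm_single]; simp
    rw [Finset.prod_eq_one (fun j _ => this j), mul_one]
  have h2 : ‖(ContinuousMultilinearMap.mkPiAlgebra ℂ (Fin k) ℂ).compContinuousLinearMap
      (fun j => (ContinuousLinearMap.proj (s j) : (ι → ℂ) →L[ℂ] ℂ))‖ ≤ 1 := by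
    refine ContinuousMultilinearMap.opNorm_le_bound zero_le_one fun m => ?_
    simp only [ContinuousMultilinearMap.compContinuousLinearMap_apply,
      ContinuousMultilinearMap.mkPiAlgebra_apply, ContinuousLinearMap.proj_apply, norm_prod, one_mul]
    exact Finset.prod_le_prod (fun _ _ => norm_nonneg _) (fun j _ => norm_le_pi_norm _ _)
  calc _ ≤ ‖p‖ * 1 := by gcongr
    _ = ‖p‖ := mul_one _

lemma cML_real {k : ℕ} (p : ContinuousMultilinearMap ℝ (fun _ : Fin k => (ι → ℝ)) ℝ) (v : ι → ℝ) :
    cML p (fun _ => toC v) = ((p fun _ => v : ℝ) : ℂ) := by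
  have hv : v = ∑ i, v i • (Pi.single i (1:ℝ) : ι → ℝ) := by
    ext j; simp [Finset.sum_apply, Pi.single_apply]
  have h1 : (p fun _ => v) = ∑ s : Fin k → ι, (∏ j, v (s j)) * p (fun j => Pi.single (s j) 1) := by
    conv_lhs => rw [hv]
    rw [ContinuousMultilinearMap.map_sum p (fun (_ : Fin k) i => v i • (Pi.single i (1:ℝ) : ι → ℝ))]
    apply Finset.sum_congr rfl
    intro s _
    rw [ContinuousMultilinearMap.map_smul_univ]
    rfl
  rw [h1]
  simp only [cML, toC, _root_.sum_apply, _root_.smul_apply,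
    ContinuousMultilinearMap.compContinuousLinearMap_apply, ContinuousMultilinearMap.mkPiAlgebra_apply,
    ContinuousLinearMap.proj_apply, smul_eq_mul]
  push_cast
  apply Finset.sum_congr rfl
  intro s _
  ring

lemma cext_local (f : (ι → ℝ) → ℝ) (v₀ : ι → ℝ) (hf : AnalyticAt ℝ f v₀) :
    ∃ r > 0, ∃ g : (ι → ℂ) → ℂ, AnalyticOnNhd ℂ g (ball (toC v₀) r) ∧
      ∀ v ∈ ball v₀ r, g (toC v) = f v := by
  obtain ⟨p, hp⟩ := hf
  obtain ⟨R, hR⟩ := hp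
  obtain ⟨ρ, hρ0, hρR⟩ := ENNReal.lt_iff_exists_nnreal_btwn.1 hR.r_pos
  have hρ0' : 0 < ρ := by exact_mod_cast hρ0
  obtain ⟨C, hC, hCb⟩ := p.norm_mul_pow_le_of_lt_radius (hρR.trans_le hR.r_le)
  let q : FormalMultilinearSeries ℂ (ι → ℂ) ℂ := fun k => cML (p k)
  set n : NNReal := Fintype.card ι + 1 with hn
  have hn0 : 0 < n := by positivity
  have hq : ((ρ / n : NNReal) : ENNReal) ≤ q.radius := by
    refine q.le_radius_of_bound C fun k => ?_
    have := norm_cML (p k)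
    have h3 : (Fintype.card ι : ℝ) ≤ n := by rw [hn]; push_cast; linarith
    calc ‖q k‖ * ((ρ / n : NNReal) : ℝ) ^ k
        ≤ ((Fintype.card ι : ℝ) ^ k * ‖p k‖) * ((ρ / n : NNReal) : ℝ) ^ k := by gcongr
      _ ≤ ((n : ℝ) ^ k * ‖p k‖) * ((ρ / n : NNReal) : ℝ) ^ k := by gcongr
      _ = ‖p k‖ * ρ ^ k := by
          push_cast
          rw [div_pow]
          have : (n:ℝ) ^ k ≠ 0 := by positivity
          field_simp
      _ ≤ C := hCb k
  have hpos : 0 < ρ / n := by positivity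
  have hq0 : 0 < q.radius := lt_of_lt_of_le (by exact_mod_cast hpos) hq
  have hball := q.hasFPowerSeriesOnBall hq0
  refine ⟨min (ρ / n) ρ, by positivity, fun z => q.sum (z - toC v₀), ?_, ?_⟩
  · intro z hz
    have h1 : AnalyticAt ℂ (fun z : ι → ℂ => z - toC v₀) z := by fun_prop
    refine AnalyticAt.comp (g := q.sum) (f := fun z : ι → ℂ => z - toC v₀) ?_ h1
    apply hball.analyticAt_of_mem
    rw [mem_ball, dist_eq_norm] at hz
    rw [mem_eball, edist_eq_enorm_sub, sub_zero]
    refine lt_of_lt_of_le ?_ hq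
    have : ‖z - toC v₀‖₊ < ρ / n := by
      have := hz.trans_le (min_le_left _ _)
      exact_mod_cast this
    exact_mod_cast this
  · intro v hv
    rw [mem_ball, dist_eq_norm] at hv
    have hv1 : ‖v - v₀‖₊ < ρ / n := by
      have := hv.trans_le (min_le_left _ _)
      exact_mod_cast this
    have hv2 : ‖v - v₀‖₊ < ρ := by
      have := hv.trans_le (min_le_right _ _)
      exact_mod_cast this
    have hsub : toC v - toC v₀ = toC (v - v₀) := by ext i; simp [toC]
    have s1 := hR.hasSum (y := v - v₀) (by
      rw [mem_eball, edist_eq_enorm_sub, sub_zero]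
      refine lt_trans ?_ hρR
      exact_mod_cast hv2)
    have s2 := hball.hasSum (y := toC (v - v₀)) (by
      rw [mem_eball, edist_eq_enorm_sub, sub_zero]
      refine lt_of_lt_of_le ?_ hq
      have : ‖toC (v - v₀)‖₊ = ‖v - v₀‖₊ := by ext; simp [norm_toC]
      have h : ‖toC (v - v₀)‖ₑ = ((‖toC (v - v₀)‖₊ : NNReal) : ENNReal) := rfl
      rw [h, this]
      exact_mod_cast hv1)
    have s3 := (Complex.hasSum_ofReal.2 s1)
    simp only [add_sub_cancel] at s3
    simp only [q, cML_real, zero_add] at s2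
    show q.sum (toC v - toC v₀) = _
    rw [hsub]
    exact s2.unique s3

lemma ident_real {B : Set (ι → ℂ)} (hB : IsOpen B) (hconv : Convex ℝ B) (g h : (ι → ℂ) → ℂ)
    (hg : AnalyticOnNhd ℂ g B) (hh : AnalyticOnNhd ℂ h B)
    (hgh : ∀ v : ι → ℝ, toC v ∈ B → g (toC v) = h (toC v)) (z : ι → ℂ) (hz : z ∈ B)
    (hre : toC (reV z) ∈ B) : g z = h z := by
  let l : ℂ → (ι → ℂ) := fun ζ => toC (reV z) + ζ • toC (imV z)
  have hS : IsOpen (l ⁻¹' B) := hB.preimage (by fun_prop)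
  have hSc : Convex ℝ (l ⁻¹' B) := by
    intro x hx y hy a b ha hb hab
    have : l (a • x + b • y) = a • l x + b • l y := by
      ext i
      simp only [l, Pi.add_apply, Pi.smul_apply, smul_eq_mul, Complex.real_smul]
      have : (a:ℂ) + b = 1 := by exact_mod_cast hab
      linear_combination (-(toC (reV z) i)) * this
    show l _ ∈ B
    rw [this]
    exact hconv hx hy ha hb hab
  have h0 : (0:ℂ) ∈ l ⁻¹' B := by simpa [l] using hre
  have hlI : l Complex.I = z := by
    ext i
    simp only [l, toC, reV, imV, Pi.add_apply, Pi.smul_apply, smul_eq_mul]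
    rw [mul_comm]
    exact Complex.re_add_im (z i)
  have hI : Complex.I ∈ l ⁻¹' B := by
    show l Complex.I ∈ B
    rw [hlI]; exact hz
  have ag : AnalyticOnNhd ℂ (fun ζ => g (l ζ)) (l ⁻¹' B) := fun ζ hζ => analytic_line hg hζ
  have ah : AnalyticOnNhd ℂ (fun ζ => h (l ζ)) (l ⁻¹' B) := fun ζ hζ => analytic_line hh hζ
  have hfr : ∃ᶠ ζ in 𝓝[≠] (0:ℂ), g (l ζ) = h (l ζ) := by
    have ht : Tendsto (fun n : ℕ => (((1:ℝ)/((n:ℝ)+1) : ℝ) : ℂ)) atTop (𝓝[≠] 0) := by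
      rw [tendsto_nhdsWithin_iff]
      constructor
      · have := (Complex.continuous_ofReal.tendsto 0).comp (tendsto_one_div_add_atTop_nhds_zero_nat (𝕜 := ℝ))
        exact this
      · refine Eventually.of_forall fun n => ?_
        simp only [mem_compl_iff, mem_singleton_iff, Complex.ofReal_eq_zero]
        have : (0:ℝ) < n + 1 := by positivity
        positivity
    refine ht.frequently (Eventually.frequently ?_)
    have ht' := tendsto_nhds_of_tendsto_nhdsWithin ht
    filter_upwards [ht'.eventually (hS.mem_nhds h0)] with n hn
    have hl : ∀ s : ℝ, l (s : ℂ) = toC (reV z + s • imV z) := by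
      intro s; ext i; simp [l, toC]
    rw [hl]
    apply hgh
    rw [← hl]; exact hn
  have := ag.eqOn_of_preconnected_of_frequently_eq ah hSc.isPreconnected h0 hfr hI
  simpa [hlI] using this
end

end PartPB

section PartPB2
open MeasureTheory
/-- complex neighborhood of `{0} × ℝ` -/
def cDom (r : ℝ) : Set (Fin 7 → ℂ) := {z | (∀ i, i ≠ 6 → ‖z i‖ < r) ∧ |(z 6).im| < r}

lemma cDom_open (r : ℝ) : IsOpen (cDom r) := by
  have : cDom r = (⋂ i : Fin 7, {z | i ≠ 6 → ‖z i‖ < r}) ∩ {z | |(z 6).im| < r} := by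
    ext z; simp [cDom]
  rw [this]
  refine IsOpen.inter (isOpen_iInter_of_finite fun i => ?_) ?_
  · by_cases h : i = 6
    · simp [h]
    · simp only [ne_eq, h, not_false_eq_true, forall_const]
      exact isOpen_lt (by fun_prop) (by fun_prop)
  · exact isOpen_lt (by fun_prop) (by fun_prop)

lemma cDom_convex (r : ℝ) : Convex ℝ (cDom r) := by
  intro x hx y hy a b ha hb hab
  refine ⟨fun i hi => ?_, ?_⟩
  · have := (convex_ball (0:ℂ) r) (mem_ball_zero_iff.2 (hx.1 i hi)) (mem_ball_zero_iff.2 (hy.1 i hi)) ha hb hab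
    simpa using this
  · have h2 := (convex_ball (0:ℝ) r) (x := (x 6).im) (by simpa using hx.2) (y := (y 6).im)
      (by simpa using hy.2) ha hb hab
    simpa using h2

lemma cDom_re (r : ℝ) {z : Fin 7 → ℂ} (hz : z ∈ cDom r) : toC (reV z) ∈ cDom r := by
  refine ⟨fun i hi => ?_, ?_⟩
  · simp only [toC, reV, Complex.norm_real]
    exact (Complex.abs_re_le_norm _).trans_lt (hz.1 i hi)
  · simp only [toC, Complex.ofReal_im, abs_zero]
    exact (abs_nonneg _).trans_lt hz.2

/-- center points -/
def ctr (t : ℝ) : Fin 7 → ℝ := Pi.single 6 t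

lemma mem_ball_ctr {r : ℝ} (hr : 0 < r) (t : ℝ) (z : Fin 7 → ℂ) :
    z ∈ ball (toC (ctr t)) r ↔ (∀ i, i ≠ 6 → ‖z i‖ < r) ∧ ‖z 6 - t‖ < r := by
  rw [mem_ball, dist_eq_norm, pi_norm_lt_iff hr]
  constructor
  · intro h
    refine ⟨fun i hi => ?_, ?_⟩
    · have := h i
      simpa [toC, ctr, Pi.single_apply, hi] using this
    · have := h 6
      simpa [toC, ctr] using this
  · rintro ⟨h1, h2⟩ i
    by_cases hi : i = 6
    · subst hi; simpa [toC, ctr] using h2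
    · simpa [toC, ctr, Pi.single_apply, hi] using h1 i hi

lemma reV_toC {ι : Type} (v : ι → ℝ) : reV (toC v) = v := by ext i; simp [reV, toC]

lemma mem_ball_toC (v c : Fin 7 → ℝ) (r : ℝ) : toC v ∈ ball (toC c) r ↔ v ∈ ball c r := by
  have : toC v - toC c = toC (v - c) := by ext i; simp [toC]
  rw [mem_ball, mem_ball, dist_eq_norm, dist_eq_norm, this, norm_toC]

lemma complexify (f : (Fin 7 → ℝ) → ℝ) (ε : ℝ) (hε : 0 < ε)
    (hf : AnalyticOnNhd ℝ f {v | ∀ i, i ≠ 6 → |v i| < ε})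
    (hper : Function.Periodic f (Pi.single 6 (2 * Real.pi))) :
    ∃ r > 0, ∃ g : (Fin 7 → ℂ) → ℂ, AnalyticOnNhd ℂ g (cDom r) ∧
      (∀ v : Fin 7 → ℝ, (∀ i, i ≠ 6 → |v i| < r) → g (toC v) = f v) ∧
      (∀ z ∈ cDom r, g (z + Pi.single 6 ((2 * Real.pi : ℝ) : ℂ)) = g z) ∧
      ∃ C, ∀ z ∈ cDom r, ‖g z‖ ≤ C := by
  -- local extensions
  have hloc : ∀ t : ℝ, ∃ r > 0, ∃ g : (Fin 7 → ℂ) → ℂ, AnalyticOnNhd ℂ g (ball (toC (ctr t)) r) ∧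
      ∀ v ∈ ball (ctr t) r, g (toC v) = f v := by
    intro t
    apply cext_local
    apply hf
    intro i hi
    simp [ctr, Pi.single_apply, hi, hε]
  -- uniform radius on [0,2π]
  have huni0 : ∃ r > 0, ∀ t ∈ Icc 0 (2 * Real.pi), ∃ g : (Fin 7 → ℂ) → ℂ,
      AnalyticOnNhd ℂ g (ball (toC (ctr t)) r) ∧ ∀ v ∈ ball (ctr t) r, g (toC v) = f v := by
    choose r hr g hg hgf using hloc
    obtain ⟨T, hTs, hT⟩ := (isCompact_Icc (a := (0:ℝ)) (b := 2 * Real.pi)).elim_nhds_subcover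
      (fun t => ball t (r t / 2)) (fun t _ => ball_mem_nhds t (by have := hr t; positivity))
    have hTne : T.Nonempty := by
      by_contra h
      rw [Finset.not_nonempty_iff_eq_empty] at h
      subst h
      have : (0:ℝ) ∈ Icc 0 (2 * Real.pi) := ⟨le_rfl, by positivity⟩
      simpa using hT this
    refine ⟨T.inf' hTne (fun t => r t / 2), ?_, ?_⟩
    · rw [gt_iff_lt, Finset.lt_inf'_iff]
      intro t _
      have := hr t; positivity
    · intro t ht
      obtain ⟨t₀, ht₀, htt⟩ := mem_iUnion₂.1 (hT ht)
      have hle : T.inf' hTne (fun t => r t / 2) ≤ r t₀ / 2 := Finset.inf'_le _ ht₀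
      have hd : dist (ctr t) (ctr t₀) = dist t t₀ := by
        have : ctr t - ctr t₀ = ctr (t - t₀) := by
          ext i; by_cases hi : i = 6
          · subst hi; simp [ctr]
          · simp [ctr, Pi.single_apply, hi]
        rw [dist_eq_norm, this, ctr, Pi.norm_single, dist_eq_norm]
      have hd' : dist (toC (ctr t)) (toC (ctr t₀)) = dist t t₀ := by
        rw [← hd, dist_eq_norm, dist_eq_norm, ← norm_toC]
        congr 1; ext i; simp [toC]
      refine ⟨g t₀, (hg t₀).mono ?_, fun v hv => hgf t₀ v ?_⟩
      · apply ball_subset_ball'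
        rw [hd']; have := mem_ball.1 htt; linarith
      · refine ball_subset_ball' ?_ hv
        rw [hd]; have := mem_ball.1 htt; linarith
  have huni : ∃ r > 0, ∀ t : ℝ, ∃ g : (Fin 7 → ℂ) → ℂ,
      AnalyticOnNhd ℂ g (ball (toC (ctr t)) r) ∧ ∀ v ∈ ball (ctr t) r, g (toC v) = f v := by
    obtain ⟨r, hr, h⟩ := huni0
    refine ⟨r, hr, fun t => ?_⟩
    have hpi : (0:ℝ) < 2 * Real.pi := by positivity
    obtain ⟨n, ⟨hn1, hn2⟩, -⟩ := existsUnique_sub_zsmul_mem_Ico hpi t 0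
    obtain ⟨g, hg, hgf⟩ := h (t - n • (2 * Real.pi)) ⟨hn1, by simpa using hn2.le⟩
    set c : ℝ := n • (2 * Real.pi) with hc
    have key : ∀ z : Fin 7 → ℂ, z ∈ ball (toC (ctr t)) r → z - toC (ctr c) ∈ ball (toC (ctr (t - c))) r := by
      intro z hz
      rw [mem_ball_ctr hr] at hz ⊢
      refine ⟨fun i hi => ?_, ?_⟩
      · simpa [toC, ctr, Pi.single_apply, hi] using hz.1 i hi
      · have : z 6 - ↑c - (↑t - ↑c) = z 6 - (t:ℂ) := by ring
        simpa [toC, ctr, this] using hz.2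
    refine ⟨fun z => g (z - toC (ctr c)), fun z hz => ?_, fun v hv => ?_⟩
    · have h1 : AnalyticAt ℂ (fun z : Fin 7 → ℂ => z - toC (ctr c)) z := by fun_prop
      exact AnalyticAt.comp (g := g) (f := fun z : Fin 7 → ℂ => z - toC (ctr c)) (hg _ (key z hz)) h1
    · have hv' : toC v ∈ ball (toC (ctr t)) r := by
        exact (mem_ball_toC _ _ _).2 hv
      have h2 := key _ hv'
      have hsub : toC v - toC (ctr c) = toC (v - ctr c) := by ext i; simp [toC]
      have h3 : v - ctr c ∈ ball (ctr (t - c)) r := by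
        rw [hsub] at h2
        exact (mem_ball_toC _ _ _).1 h2
      show g (toC v - toC (ctr c)) = _
      rw [hsub, hgf _ h3]
      have : ctr c = n • (Pi.single 6 (2 * Real.pi) : Fin 7 → ℝ) := by
        ext i; by_cases hi : i = 6
        · subst hi; simp [ctr, hc]
        · simp [ctr, Pi.single_apply, hi]
      rw [this, (hper.zsmul n).sub_eq]
  obtain ⟨r, hr, h⟩ := huni
  choose g hg hgf using h
  have hballre : ∀ t (z : Fin 7 → ℂ), z ∈ ball (toC (ctr t)) r → toC (reV z) ∈ ball (toC (ctr t)) r := by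
    intro t z hz
    rw [mem_ball_ctr hr] at hz ⊢
    refine ⟨fun i hi => ?_, ?_⟩
    · simp only [toC, reV, Complex.norm_real]
      exact (Complex.abs_re_le_norm _).trans_lt (hz.1 i hi)
    · have : (toC (reV z) 6 - (t:ℂ)) = (((z 6 - t).re : ℝ) : ℂ) := by simp [toC, reV]
      rw [this, Complex.norm_real]
      exact (Complex.abs_re_le_norm _).trans_lt hz.2
  have hgf' : ∀ t v, toC v ∈ ball (toC (ctr t)) r → g t (toC v) = f v := by
    intro t v hv
    apply hgf
    exact (mem_ball_toC _ _ _).1 hv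
  have hagree : ∀ t t' z, z ∈ ball (toC (ctr t)) r → z ∈ ball (toC (ctr t')) r → g t z = g t' z := by
    intro t t' z hz hz'
    refine ident_real (isOpen_ball.inter isOpen_ball) ((convex_ball _ _).inter (convex_ball _ _))
      (g t) (g t') ((hg t).mono inter_subset_left) ((hg t').mono inter_subset_right) ?_ z ⟨hz, hz'⟩
      ⟨hballre t z hz, hballre t' z hz'⟩
    intro v hv
    rw [hgf' t v hv.1, hgf' t' v hv.2]
  have hmem : ∀ z ∈ cDom r, z ∈ ball (toC (ctr (z 6).re)) r := by
    intro z hz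
    rw [mem_ball_ctr hr]
    refine ⟨hz.1, ?_⟩
    have : z 6 - ((z 6).re : ℂ) = ((z 6).im : ℂ) * Complex.I := by
      rw [sub_eq_iff_eq_add, add_comm]; exact (Complex.re_add_im _).symm
    rw [this]; simpa using hz.2
  set G : (Fin 7 → ℂ) → ℂ := fun z => g (z 6).re z with hG
  have hGa : AnalyticOnNhd ℂ G (cDom r) := by
    intro z hz
    refine (hg _ z (hmem z hz)).congr ?_
    filter_upwards [(cDom_open r).mem_nhds hz, isOpen_ball.mem_nhds (hmem z hz)] with w hw hw2
    exact hagree _ _ w hw2 (hmem w hw)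
  have hGf : ∀ v : Fin 7 → ℝ, (∀ i, i ≠ 6 → |v i| < r) → G (toC v) = f v := by
    intro v hv
    apply hgf'
    rw [mem_ball_ctr hr]
    refine ⟨fun i hi => by simpa [toC] using hv i hi, by simpa [toC] using hr⟩
  have hshift : ∀ z ∈ cDom r, z + Pi.single 6 ((2 * Real.pi : ℝ) : ℂ) ∈ cDom r := by
    intro z hz
    refine ⟨fun i hi => by simpa [Pi.single_apply, hi] using hz.1 i hi, ?_⟩
    have := hz.2
    simpa using this
  have hGp : ∀ z ∈ cDom r, G (z + Pi.single 6 ((2 * Real.pi : ℝ) : ℂ)) = G z := by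
    intro z hz
    refine ident_real (cDom_open r) (cDom_convex r)
      (fun z => G (z + Pi.single 6 ((2 * Real.pi : ℝ) : ℂ))) G ?_ hGa ?_ z hz (cDom_re r hz)
    · intro w hw
      have h1 : AnalyticAt ℂ (fun z : Fin 7 → ℂ => z + Pi.single 6 ((2 * Real.pi : ℝ) : ℂ)) w := by fun_prop
      exact AnalyticAt.comp (g := G) (hGa _ (hshift w hw)) h1
    · intro v hv
      have hv' : ∀ i, i ≠ 6 → |v i| < r := fun i hi => by simpa [toC] using hv.1 i hi
      have : toC v + Pi.single 6 ((2 * Real.pi : ℝ) : ℂ) = toC (v + Pi.single 6 (2 * Real.pi)) := by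
        ext i; by_cases hi : i = 6
        · subst hi; simp [toC]
        · simp [toC, Pi.single_apply, hi]
      show G (toC v + _) = _
      rw [this, hGf v hv', hGf, hper]
      intro i hi
      simpa [Pi.single_apply, hi] using hv' i hi
  have hsub : cDom (r/2) ⊆ cDom r := fun z hz =>
    ⟨fun i hi => (hz.1 i hi).trans (by linarith), hz.2.trans (by linarith)⟩
  refine ⟨r/2, by positivity, G, hGa.mono hsub, fun v hv => hGf v fun i hi => (hv i hi).trans (by linarith),
    fun z hz => hGp z (hsub hz), ?_⟩
  -- boundedness
  have hcomp : IsCompact ({z : Fin 7 → ℂ | (∀ i, i ≠ 6 → ‖z i‖ ≤ r/2) ∧ |(z 6).im| ≤ r/2 ∧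
      (z 6).re ∈ Icc 0 (2 * Real.pi)}) := by
    apply Metric.isCompact_of_isClosed_isBounded
    · have : {z : Fin 7 → ℂ | (∀ i, i ≠ 6 → ‖z i‖ ≤ r/2) ∧ |(z 6).im| ≤ r/2 ∧
        (z 6).re ∈ Icc 0 (2 * Real.pi)} = (⋂ i : Fin 7, {z | i ≠ 6 → ‖z i‖ ≤ r/2}) ∩
        ({z | |(z 6).im| ≤ r/2} ∩ {z | (z 6).re ∈ Icc 0 (2 * Real.pi)}) := by ext z; simp
      rw [this]
      refine IsClosed.inter (isClosed_iInter fun i => ?_) (IsClosed.inter ?_ ?_)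
      · by_cases h : i = 6
        · simp [h]
        · simp only [ne_eq, h, not_false_eq_true, forall_const]
          exact isClosed_le (by fun_prop) (by fun_prop)
      · exact isClosed_le (by fun_prop) (by fun_prop)
      · exact isClosed_Icc.preimage (by fun_prop)
    · rw [isBounded_iff_forall_norm_le]
      refine ⟨r/2 + 2 * Real.pi, fun z hz => ?_⟩
      rw [pi_norm_le_iff_of_nonneg (by positivity)]
      intro i
      have hpi := Real.pi_pos
      by_cases hi : i = 6
      · subst hi
        refine (Complex.norm_le_abs_re_add_abs_im _).trans ?_
        rw [abs_of_nonneg hz.2.2.1]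
        linarith [hz.2.1, hz.2.2.2]
      · linarith [hz.1 i hi]
  obtain ⟨C, hC⟩ := hcomp.exists_bound_of_continuousOn (f := G) (hGa.continuousOn.mono (fun z hz =>
    ⟨fun i hi => (hz.1 i hi).trans_lt (by linarith), hz.2.1.trans_lt (by linarith)⟩))
  refine ⟨C, fun z hz => ?_⟩
  have hpi : (0:ℝ) < 2 * Real.pi := by positivity
  obtain ⟨n, ⟨hn1, hn2⟩, -⟩ := existsUnique_sub_zsmul_mem_Ico hpi (z 6).re 0
  have hns : ∀ n : ℕ, ∀ z ∈ cDom r, z + n • Pi.single 6 ((2 * Real.pi : ℝ) : ℂ) ∈ cDom r ∧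
      G (z + n • Pi.single 6 ((2 * Real.pi : ℝ) : ℂ)) = G z := by
    intro n
    induction n with
    | zero => intro z hz; simpa using hz
    | succ n ih =>
      intro z hz
      have h1 := ih z hz
      rw [succ_nsmul, ← add_assoc]
      exact ⟨hshift _ h1.1, (hGp _ h1.1).trans h1.2⟩
  set P : Fin 7 → ℂ := Pi.single 6 ((2 * Real.pi : ℝ) : ℂ) with hP
  have hmemn : z - n • P ∈ cDom (r/2) := by
    refine ⟨fun i hi => ?_, ?_⟩
    · simpa [P, Pi.single_apply, hi] using hz.1 i hi
    · have : ((z - n • P) 6).im = (z 6).im := by simp [P]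
      rw [this]; exact hz.2
  have hval : G (z - n • P) = G z := by
    rcases Int.eq_nat_or_neg n with ⟨m, rfl | rfl⟩
    · have := (hns m _ (hsub hmemn)).2
      simpa using this.symm
    · have := (hns m _ (hsub hz)).2
      simpa using this
  rw [← hval]
  apply hC
  refine ⟨fun i hi => (hmemn.1 i hi).le, hmemn.2.le, ?_⟩
  have : ((z - n • P) 6).re = (z 6).re - n • (2 * Real.pi) := by simp [P]
  rw [this]
  exact ⟨hn1, by simpa using hn2.le⟩

end PartPB2

section PartPC
open MeasureTheory
def Zdom : Set (ℂ × ℂ) := {p | ‖p.1‖ / 4 < p.1.re + 1/2 ∧ ‖p.2‖ < 1/10}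

lemma an_fst {E F : Type*} [NormedAddCommGroup E] [NormedSpace ℂ E] [NormedAddCommGroup F]
    [NormedSpace ℂ F] (p : E × F) : AnalyticAt ℂ (fun p : E × F => p.1) p := analyticAt_fst
lemma an_snd {E F : Type*} [NormedAddCommGroup E] [NormedSpace ℂ E] [NormedAddCommGroup F]
    [NormedSpace ℂ F] (p : E × F) : AnalyticAt ℂ (fun p : E × F => p.2) p := analyticAt_snd
attribute [fun_prop] an_fst an_snd

lemma Zdom_open : IsOpen Zdom :=
  (isOpen_lt (f := fun p : ℂ × ℂ => ‖p.1‖ / 4) (g := fun p => p.1.re + 1/2) (by fun_prop) (by fun_prop)).inter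
    (isOpen_lt (f := fun p : ℂ × ℂ => ‖p.2‖) (g := fun p => 1/10) (by fun_prop) (by fun_prop))

lemma log_lip {z w : ℂ} (hz : 1/2 ≤ z.re) (hw : 1/2 ≤ w.re) :
    ‖Complex.log z - Complex.log w‖ ≤ 2 * ‖z - w‖ := by
  have hconv : Convex ℝ {z : ℂ | 1/2 ≤ z.re} := by
    exact convex_halfSpace_re_ge (1/2)
  refine Convex.norm_image_sub_le_of_norm_hasDerivWithin_le (f := Complex.log) (f' := fun z => z⁻¹)
    (s := {z : ℂ | 1/2 ≤ z.re}) (fun x hx => ?_) (fun x hx => ?_) hconv hw hz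
  · apply HasDerivAt.hasDerivWithinAt
    apply Complex.hasDerivAt_log
    left
    have : (1:ℝ)/2 ≤ x.re := hx
    linarith
  · have h1 : (1:ℝ)/2 ≤ ‖x‖ := le_trans hx (Complex.re_le_norm x)
    rw [norm_inv]
    rw [inv_le_comm₀ (by linarith) (by norm_num)]
    linarith

lemma Zre {p : ℂ × ℂ} (hp : p ∈ Zdom) {e : ℂ} (he : ‖e‖ ≤ 1/4 * ‖p.1‖) : 1/2 ≤ (1 + p.1 + e).re := by
  have h1 := hp.1
  have h2 : |e.re| ≤ ‖e‖ := Complex.abs_re_le_norm e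
  have h3 := (abs_le.1 h2).1
  simp only [Complex.add_re, Complex.one_re]
  linarith

lemma Zex : ∃ η : ℂ × ℂ → ℂ, AnalyticOnNhd ℂ η Zdom ∧ (∀ p ∈ Zdom, ‖η p‖ ≤ 1/4 * ‖p.1‖) ∧
    (∀ p ∈ Zdom, p.1.im = 0 → p.2.im = 0 → (η p).im = 0) ∧
    ∀ p ∈ Zdom, p.2 * Complex.log (1 + p.1 + η p) = η p := by
  have := contr_analytic (F := ℂ) osg_C2 Zdom_open (fun p => ‖p.1‖) (fun _ _ => norm_nonneg _)
    (fun p hp => ⟨‖p.1‖ + 1, by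
      have : ContinuousAt (fun p : ℂ × ℂ => ‖p.1‖) p := by fun_prop
      exact (this.eventually (gt_mem_nhds (lt_add_one _))).mono fun _ h => h.le⟩)
    (1/4) (1/5) (by norm_num) (by norm_num) (by norm_num)
    (fun η => ∀ p ∈ Zdom, p.1.im = 0 → p.2.im = 0 → (η p).im = 0) (by intro p _ _ _; simp)
    (by
      intro sq η hsq hl p hp h1 h2
      have h3 : Tendsto (fun n => (sq n p).im) atTop (𝓝 (η p).im) :=
        (Complex.continuous_im.tendsto _).comp (hl p hp)
      have h4 : (fun n => (sq n p).im) = fun _ => 0 := by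
        ext n; exact hsq n p hp h1 h2
      rw [h4] at h3
      exact (tendsto_nhds_unique h3 tendsto_const_nhds))
    (fun η p => p.2 * Complex.log (1 + p.1 + η p))
    (by
      rintro η ⟨ha, hb, hr⟩
      refine ⟨?_, ?_, ?_⟩
      · intro p hp
        have h1 : AnalyticAt ℂ (fun p : ℂ × ℂ => 1 + p.1 + η p) p :=
          (analyticAt_const.add analyticAt_fst).add (ha p hp)
        refine analyticAt_snd.mul (h1.clog ?_)
        left
        have := Zre hp (hb p hp)
        linarith
      · intro p hp
        have h1 := Zre hp (hb p hp)
        have h2 := log_lip h1 (w := 1) (by norm_num)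
        simp only [Complex.log_one, sub_zero] at h2
        have h3 : ‖1 + p.1 + η p - 1‖ ≤ 5/4 * ‖p.1‖ := by
          have : 1 + p.1 + η p - 1 = p.1 + η p := by ring
          rw [this]
          refine (norm_add_le _ _).trans ?_
          have := hb p hp
          linarith
        rw [norm_mul]
        calc ‖p.2‖ * ‖Complex.log (1 + p.1 + η p)‖ ≤ 1/10 * (2 * (5/4 * ‖p.1‖)) := by
              gcongr
              · exact hp.2.le
              · exact h2.trans (by linarith)
          _ = 1/4 * ‖p.1‖ := by ring
      · intro p hp h1 h2
        have h3 := hr p hp h1 h2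
        have h4 := Zre hp (hb p hp)
        have h5 : (1 + p.1 + η p) = (((1 + p.1 + η p).re : ℝ) : ℂ) := by
          apply Complex.ext <;> simp [h1, h3]
        have h6 : p.2 = ((p.2.re : ℝ) : ℂ) := by apply Complex.ext <;> simp [h2]
        show (p.2 * Complex.log (1 + p.1 + η p)).im = 0
        rw [h5, h6, ← Complex.ofReal_log (by linarith), ← Complex.ofReal_mul, Complex.ofReal_im])
    (by
      rintro η η' c hc ⟨ha, hb, hr⟩ ⟨ha', hb', hr'⟩ hd p hp
      have h1 := Zre hp (hb p hp)
      have h1' := Zre hp (hb' p hp)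
      have h2 := log_lip h1 h1'
      have h3 : 1 + p.1 + η p - (1 + p.1 + η' p) = η p - η' p := by ring
      rw [h3] at h2
      rw [← mul_sub, norm_mul]
      calc ‖p.2‖ * _ ≤ 1/10 * (2 * (c * ‖p.1‖)) := by
            gcongr
            · exact hp.2.le
            · exact h2.trans (by linarith [hd p hp])
        _ = 1/5 * c * ‖p.1‖ := by ring)
  obtain ⟨η, ⟨h1, h2, h3⟩, h4⟩ := this
  exact ⟨η, h1, h2, h3, h4⟩

def Ydom : Set (ℂ × ℂ) := {p | |p.1.im| < p.1.re + 1/10 ∧ ‖p.2‖ < 1/100}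

lemma Ydom_open : IsOpen Ydom :=
  (isOpen_lt (f := fun p : ℂ × ℂ => |p.1.im|) (g := fun p => p.1.re + 1/10) (by fun_prop) (by fun_prop)).inter
    (isOpen_lt (f := fun p : ℂ × ℂ => ‖p.2‖) (g := fun p => 1/100) (by fun_prop) (by fun_prop))

lemma g4_ne {γ : ℂ} (h : ‖γ‖ < 1/100) : (24:ℝ)/25 ≤ ‖1 + 4 * γ‖ ∧ 1 + 4 * γ ≠ 0 := by
  have : (24:ℝ)/25 ≤ ‖1 + 4 * γ‖ := by
    have h1 : ‖(1:ℂ)‖ ≤ ‖1 + 4 * γ‖ + ‖4 * γ‖ := by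
      have := norm_sub_le (1 + 4 * γ) (4 * γ)
      simpa using this
    rw [norm_mul] at h1
    norm_num at h1
    linarith
  refine ⟨this, fun h0 => ?_⟩
  rw [h0] at this
  norm_num at this

lemma Ydom_Z {p : ℂ × ℂ} (hp : p ∈ Ydom) :
    ((3/4) * p.1 / (1 + 4 * p.2), 4 * p.2 / (1 + 4 * p.2)) ∈ Zdom := by
  obtain ⟨h1, h2⟩ := hp
  obtain ⟨hn, hne⟩ := g4_ne h2
  have hσ : ‖p.1‖ ≤ |p.1.re| + |p.1.im| := Complex.norm_le_abs_re_add_abs_im _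
  have hinv : ‖(1 + 4 * p.2)⁻¹‖ ≤ 25/24 := by
    rw [norm_inv, inv_le_comm₀ (by linarith) (by norm_num)]
    linarith
  constructor
  · simp only
    have e1 : (3/4) * p.1 / (1 + 4 * p.2) = (3/4) * p.1 - (3/4) * (p.1 * (4 * p.2) * (1 + 4 * p.2)⁻¹) := by
      field_simp
      ring
    have hs : ‖p.1 * (4 * p.2) * (1 + 4 * p.2)⁻¹‖ ≤ ‖p.1‖ * (1/24) := by
      rw [norm_mul, norm_mul, norm_mul]
      have : ‖(4:ℂ)‖ = 4 := by norm_num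
      rw [this, mul_assoc]
      gcongr
      calc 4 * ‖p.2‖ * ‖(1 + 4 * p.2)⁻¹‖ ≤ 4 * (1/100) * (25/24) := by gcongr
        _ = 1/24 := by norm_num
    have hre := (abs_le.1 ((Complex.abs_re_le_norm (p.1 * (4 * p.2) * (1 + 4 * p.2)⁻¹)).trans hs)).2
    have hq1 : ((3/4) * p.1 / (1 + 4 * p.2)).re ≥ 3/4 * p.1.re - 3/4 * (‖p.1‖ * (1/24)) := by
      rw [e1, Complex.sub_re]
      have a1 : ∀ z : ℂ, ((3/4 : ℂ) * z).re = 3/4 * z.re := by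
        intro z
        have : (3/4 : ℂ) = ((3/4 : ℝ) : ℂ) := by push_cast; rfl
        rw [this, Complex.re_ofReal_mul]
      rw [a1, a1]
      linarith
    have hq2 : ‖(3/4) * p.1 / (1 + 4 * p.2)‖ ≤ 3/4 * ‖p.1‖ * (25/24) := by
      rw [div_eq_mul_inv, norm_mul, norm_mul]
      have : ‖(3/4:ℂ)‖ = 3/4 := by norm_num
      rw [this]
      gcongr
    rcases abs_cases p.1.re with h | h <;> linarith [abs_nonneg p.1.im]
  · simp only
    rw [div_eq_mul_inv, norm_mul, norm_mul]
    have : ‖(4:ℂ)‖ = 4 := by norm_num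
    rw [this]
    calc 4 * ‖p.2‖ * ‖(1 + 4 * p.2)⁻¹‖ ≤ 4 * (1/100) * (25/24) := by gcongr
      _ < 1/10 := by norm_num

lemma exists_y : ∃ y : ℂ × ℂ → ℂ, AnalyticOnNhd ℂ y Ydom ∧
    (∀ p ∈ Ydom, ‖y p - 1 - (3/4) * p.1‖ ≤ 3/16 * ‖p.1‖) ∧
    (∀ p ∈ Ydom, p.1.im = 0 → p.2.im = 0 → (y p).im = 0) ∧
    (∀ p ∈ Ydom, 1/2 ≤ (y p).re) ∧
    (∀ p ∈ Ydom, HasDerivAt (fun σ => y (σ, p.2)) ((3/4) * (1 + 4 * p.2 / y p)) p.1) ∧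
    (∀ σ₁ σ₂ γ y₁ : ℝ, 0 ≤ σ₁ → 0 ≤ σ₂ → |γ| < 1/100 → y (σ₁, γ) = y₁ →
      y ((σ₁ + σ₂ : ℝ), γ) = y₁ * y ((σ₂ / y₁ : ℝ), (γ / y₁ : ℝ))) := by
  obtain ⟨η, ha, hb, hr, he⟩ := Zex
  let qg : ℂ × ℂ → ℂ × ℂ := fun p => ((3/4) * p.1 / (1 + 4 * p.2), 4 * p.2 / (1 + 4 * p.2))
  let y : ℂ × ℂ → ℂ := fun p => 1 + (3/4) * p.1 + (1 + 4 * p.2) * η (qg p)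
  have hq : ∀ p ∈ Ydom, qg p ∈ Zdom := fun p hp => Ydom_Z hp
  have hqa : ∀ p ∈ Ydom, AnalyticAt ℂ qg p := by
    intro p hp
    have h1 : AnalyticAt ℂ (fun p : ℂ × ℂ => 1 + 4 * p.2) p := by fun_prop
    have hne := (g4_ne hp.2).2
    exact ((by fun_prop : AnalyticAt ℂ (fun p : ℂ × ℂ => (3/4) * p.1) p).div h1 hne).prod
      ((by fun_prop : AnalyticAt ℂ (fun p : ℂ × ℂ => 4 * p.2) p).div h1 hne)
  have hya : AnalyticOnNhd ℂ y Ydom := by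
    intro p hp
    have h1 : AnalyticAt ℂ (fun p : ℂ × ℂ => 1 + 4 * p.2) p := by fun_prop
    have h2 : AnalyticAt ℂ (fun p : ℂ × ℂ => 1 + (3/4) * p.1) p := by fun_prop
    have h3 : AnalyticAt ℂ (fun p => η (qg p)) p :=
      AnalyticAt.comp (g := η) (ha _ (hq p hp)) (hqa p hp)
    exact h2.add (h1.mul h3)
  have hyb : ∀ p ∈ Ydom, ‖y p - 1 - (3/4) * p.1‖ ≤ 3/16 * ‖p.1‖ := by
    intro p hp
    have e1 : y p - 1 - (3/4) * p.1 = (1 + 4 * p.2) * η (qg p) := by simp only [y]; ring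
    rw [e1, norm_mul]
    have h1 := hb _ (hq p hp)
    obtain ⟨hn, hne⟩ := g4_ne hp.2
    have h2 : ‖(qg p).1‖ = 3/4 * ‖p.1‖ / ‖1 + 4 * p.2‖ := by
      simp only [qg]
      rw [norm_div, norm_mul, show ‖(3/4:ℂ)‖ = 3/4 by norm_num]
    rw [h2] at h1
    calc _ ≤ ‖1 + 4 * p.2‖ * (1/4 * (3/4 * ‖p.1‖ / ‖1 + 4 * p.2‖)) := by gcongr
      _ = 3/16 * ‖p.1‖ := by
        have : ‖1 + 4 * p.2‖ ≠ 0 := by positivity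
        field_simp; ring
  have hyr : ∀ p ∈ Ydom, p.1.im = 0 → p.2.im = 0 → (y p).im = 0 := by
    intro p hp h1 h2
    have e1 : p.1 = ((p.1.re : ℝ) : ℂ) := by apply Complex.ext <;> simp [h1]
    have e2 : p.2 = ((p.2.re : ℝ) : ℂ) := by apply Complex.ext <;> simp [h2]
    have a1 : (qg p).1.im = 0 := by
      simp only [qg]; rw [e1, e2]
      have : (3/4) * ((p.1.re : ℝ) : ℂ) / (1 + 4 * ((p.2.re : ℝ) : ℂ)) =
        (((3/4) * p.1.re / (1 + 4 * p.2.re) : ℝ) : ℂ) := by push_cast; rfl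
      rw [this, Complex.ofReal_im]
    have a2 : (qg p).2.im = 0 := by
      simp only [qg]; rw [e2]
      have : 4 * ((p.2.re : ℝ) : ℂ) / (1 + 4 * ((p.2.re : ℝ) : ℂ)) =
        ((4 * p.2.re / (1 + 4 * p.2.re) : ℝ) : ℂ) := by push_cast; rfl
      rw [this, Complex.ofReal_im]
    have a3 := hr _ (hq p hp) a1 a2
    have e3 : η (qg p) = (((η (qg p)).re : ℝ) : ℂ) := by apply Complex.ext <;> simp [a3]
    simp only [y]
    rw [e3, e1, e2]
    have : 1 + 3/4 * ((p.1.re : ℝ) : ℂ) + (1 + 4 * ((p.2.re : ℝ) : ℂ)) * (((η (qg p)).re : ℝ) : ℂ) =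
      ((1 + 3/4 * p.1.re + (1 + 4 * p.2.re) * (η (qg p)).re : ℝ) : ℂ) := by push_cast; rfl
    rw [this, Complex.ofReal_im]
  have hyre : ∀ p ∈ Ydom, 1/2 ≤ (y p).re := by
    intro p hp
    have h1 := (abs_le.1 ((Complex.abs_re_le_norm _).trans (hyb p hp))).1
    have hσ : ‖p.1‖ ≤ |p.1.re| + |p.1.im| := Complex.norm_le_abs_re_add_abs_im _
    have a1 : ((3/4 : ℂ) * p.1).re = 3/4 * p.1.re := by
      have : (3/4 : ℂ) = ((3/4 : ℝ) : ℂ) := by push_cast; rfl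
      rw [this, Complex.re_ofReal_mul]
    simp only [Complex.sub_re, Complex.one_re, a1] at h1
    have h2 := hp.1
    rcases abs_cases p.1.re with h | h <;> linarith [abs_nonneg p.1.im]
  have hZ : ∀ p ∈ Ydom, y p + 4 * p.2 = (1 + 4 * p.2) * (1 + (qg p).1 + η (qg p)) := by
    intro p hp
    have hne := (g4_ne hp.2).2
    simp only [y, qg]
    field_simp
    ring
  have heq : ∀ p ∈ Ydom, y p = 1 + (3/4) * p.1 + 4 * p.2 * Complex.log ((y p + 4 * p.2) / (1 + 4 * p.2)) := by
    intro p hp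
    have hne := (g4_ne hp.2).2
    rw [hZ p hp, mul_div_cancel_left₀ _ hne]
    have h1 := he _ (hq p hp)
    have : 4 * p.2 * Complex.log (1 + (qg p).1 + η (qg p)) = (1 + 4 * p.2) *
      ((qg p).2 * Complex.log (1 + (qg p).1 + η (qg p))) := by
      simp only [qg]; field_simp
    rw [this, h1]
  have hZre : ∀ p ∈ Ydom, 1/2 ≤ ((y p + 4 * p.2) / (1 + 4 * p.2)).re := by
    intro p hp
    have hne := (g4_ne hp.2).2
    rw [hZ p hp, mul_div_cancel_left₀ _ hne]
    exact Zre (hq p hp) (hb _ (hq p hp))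
  have hyd : ∀ p ∈ Ydom, HasDerivAt (fun σ => y (σ, p.2)) ((3/4) * (1 + 4 * p.2 / y p)) p.1 := by
    rintro ⟨σ, γ⟩ hp
    simp only
    have hne := (g4_ne hp.2).2
    have hy0 : y (σ, γ) ≠ 0 := by
      intro h; have := hyre _ hp; rw [h] at this; norm_num at this
    have hya' : AnalyticAt ℂ (fun σ => y (σ, γ)) σ :=
      AnalyticAt.comp (g := y) (f := fun σ => (σ, γ)) (hya _ hp) (analyticAt_id.prod analyticAt_const)
    obtain ⟨d, hd⟩ : ∃ d, HasDerivAt (fun σ => y (σ, γ)) d σ := ⟨_, hya'.differentiableAt.hasDerivAt⟩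
    have hlog : (y (σ, γ) + 4 * γ) / (1 + 4 * γ) ∈ Complex.slitPlane := by
      left; have := hZre _ hp; simp only at this; linarith
    have hnum : y (σ, γ) + 4 * γ ≠ 0 := by
      intro h; have := hZre _ hp; simp only [h] at this; norm_num at this
    have hd2 : HasDerivAt (fun σ => 1 + (3/4) * σ + 4 * γ * Complex.log ((y (σ, γ) + 4 * γ) / (1 + 4 * γ)))
        (3/4 + 4 * γ * ((d / (1 + 4 * γ)) / ((y (σ, γ) + 4 * γ) / (1 + 4 * γ)))) σ := by
      have h1 := ((hd.add_const (4 * γ)).div_const (1 + 4 * γ)).clog hlog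
      have h2 : HasDerivAt (fun σ : ℂ => 1 + (3/4) * σ) (3/4) σ := by
        simpa using ((hasDerivAt_id σ).const_mul (3/4 : ℂ)).const_add 1
      exact h2.add (h1.const_mul (4 * γ))
    have hd3 : HasDerivAt (fun σ => y (σ, γ)) 
        (3/4 + 4 * γ * ((d / (1 + 4 * γ)) / ((y (σ, γ) + 4 * γ) / (1 + 4 * γ)))) σ := by
      refine hd2.congr_of_eventuallyEq ?_
      have : ∀ᶠ σ' in 𝓝 σ, (σ', γ) ∈ Ydom :=
        (by fun_prop : ContinuousAt (fun σ' : ℂ => (σ', γ)) σ).eventually (Ydom_open.mem_nhds hp)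
      filter_upwards [this] with σ' h'
      exact heq _ h'
    have hu := hd.unique hd3
    have : d = (3/4) * (1 + 4 * γ / y (σ, γ)) := by
      have h5 : (d / (1 + 4 * γ)) / ((y (σ, γ) + 4 * γ) / (1 + 4 * γ)) = d / (y (σ, γ) + 4 * γ) := by
        field_simp
      rw [h5] at hu
      field_simp at hu ⊢
      linear_combination hu
    rw [← this]; exact hd
  refine ⟨y, hya, hyb, hyr, hyre, hyd, ?_⟩
  -- semigroup
  have hreal : ∀ σ γ : ℝ, 0 ≤ σ → |γ| < 1/100 → ((σ : ℂ), (γ : ℂ)) ∈ Ydom ∧ ∃ v : ℝ, y (σ, γ) = v ∧ 1 ≤ v ∧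
      v = 1 + 3/4 * σ + 4 * γ * (Real.log (v + 4 * γ) - Real.log (1 + 4 * γ)) := by
    intro σ γ hσ hγ
    have hp : ((σ : ℂ), (γ : ℂ)) ∈ Ydom := by
      refine ⟨by simp; linarith, by simpa using hγ⟩
    refine ⟨hp, (y (σ, γ)).re, ?_, ?_, ?_⟩
    · have := hyr _ hp (by simp) (by simp)
      apply Complex.ext <;> simp [this]
    · have h1 := (abs_le.1 ((Complex.abs_re_le_norm _).trans (hyb _ hp))).1
      have a1 : ((3/4 : ℂ) * (σ:ℂ)).re = 3/4 * σ := by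
        have : (3/4 : ℂ) * (σ:ℂ) = ((3/4 * σ : ℝ) : ℂ) := by push_cast; rfl
        rw [this, Complex.ofReal_re]
      simp only [Complex.sub_re, Complex.one_re, a1, Complex.norm_real, Real.norm_of_nonneg hσ] at h1
      linarith
    · have hv : y (σ, γ) = (((y (σ, γ)).re : ℝ) : ℂ) := by
        have := hyr _ hp (by simp) (by simp)
        apply Complex.ext <;> simp [this]
      have h2 := heq _ hp
      have h3 := hZre _ hp
      simp only at h2 h3
      set v := (y (σ, γ)).re
      rw [hv] at h2 h3
      have e4 : ((v:ℂ) + 4 * γ) / (1 + 4 * γ) = (((v + 4 * γ) / (1 + 4 * γ) : ℝ) : ℂ) := by push_cast; rfl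
      rw [e4] at h2 h3
      rw [Complex.ofReal_re] at h3
      rw [← Complex.ofReal_log (by linarith)] at h2
      have hγ' := abs_lt.1 hγ
      have h1g : 0 < 1 + 4 * γ := by linarith
      have hvg : v + 4 * γ ≠ 0 := by
        intro h; rw [h] at h3; norm_num at h3
      rw [Real.log_div hvg h1g.ne'] at h2
      apply Complex.ofReal_injective
      push_cast at h2 ⊢
      exact h2
  have huniq : ∀ γ v v' A : ℝ, |γ| < 1/100 → 1 ≤ v → 1 ≤ v' → v = A + 4 * γ * Real.log (v + 4 * γ) →
      v' = A + 4 * γ * Real.log (v' + 4 * γ) → v = v' := by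
    intro γ v v' A hγ hv hv' h h'
    have hγ' := abs_lt.1 hγ
    have h1 : |Real.log (v + 4 * γ) - Real.log (v' + 4 * γ)| ≤ 2 * |v - v'| := by
      have := log_lip (z := ((v + 4 * γ : ℝ) : ℂ)) (w := ((v' + 4 * γ : ℝ) : ℂ))
        (by rw [Complex.ofReal_re]; linarith) (by rw [Complex.ofReal_re]; linarith)
      rw [← Complex.ofReal_log (by linarith), ← Complex.ofReal_log (by linarith), ← Complex.ofReal_sub,
        ← Complex.ofReal_sub, Complex.norm_real, Complex.norm_real] at this
      simpa using this
    have h2 : v - v' = 4 * γ * (Real.log (v + 4 * γ) - Real.log (v' + 4 * γ)) := by linear_combination h - h'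
    have h3 : |v - v'| ≤ 4 * (1/100) * (2 * |v - v'|) := by
      conv_lhs => rw [h2, abs_mul, abs_mul]
      have : |(4:ℝ)| = 4 := by norm_num
      rw [this]
      gcongr
    have h4 : |v - v'| ≤ 0 := by linarith
    exact sub_eq_zero.1 (abs_nonpos_iff.1 h4)
  intro σ₁ σ₂ γ y₁ h1 h2 hγ hy1
  obtain ⟨-, v1, hv1, hv1', hv1e⟩ := hreal σ₁ γ h1 hγ
  have : v1 = y₁ := by rw [hy1] at hv1; exact_mod_cast hv1.symm
  subst this
  have hv0 : 0 < v1 := by linarith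
  have hγ2 : |γ / v1| < 1/100 := by
    rw [abs_div, abs_of_pos hv0]
    exact (div_le_self (abs_nonneg _) hv1').trans_lt hγ
  obtain ⟨-, v2, hv2, hv2', hv2e⟩ := hreal (σ₂ / v1) (γ / v1) (by positivity) hγ2
  obtain ⟨-, v3, hv3, hv3', hv3e⟩ := hreal (σ₁ + σ₂) γ (by positivity) hγ
  rw [hv2, hv3]
  have : v3 = v1 * v2 := by
    have hγ' := abs_lt.1 hγ
    refine huniq γ v3 (v1 * v2) (1 + 3/4 * (σ₁ + σ₂) - 4 * γ * Real.log (1 + 4 * γ)) hγ hv3'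
      (by nlinarith) (by linear_combination hv3e) ?_
    have hp1 : 0 < v1 + 4 * γ := by linarith
    have hp2 : 0 < v1 * v2 + 4 * γ := by nlinarith
    have l1 : Real.log (v2 + 4 * (γ / v1)) = Real.log (v1 * v2 + 4 * γ) - Real.log v1 := by
      rw [← Real.log_div hp2.ne' hv0.ne']; congr 1; field_simp
    have l2 : Real.log (1 + 4 * (γ / v1)) = Real.log (v1 + 4 * γ) - Real.log v1 := by
      rw [← Real.log_div hp1.ne' hv0.ne']; congr 1; field_simp
    rw [l1, l2] at hv2e
    have h5 : v1 * v2 = v1 + 3/4 * σ₂ + 4 * γ * (Real.log (v1 * v2 + 4 * γ) - Real.log (v1 + 4 * γ)) := by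
      have : v1 * v2 = v1 * (1 + 3 / 4 * (σ₂ / v1) + 4 * (γ / v1) * (Real.log (v1 * v2 + 4 * γ) - Real.log v1 - (Real.log (v1 + 4 * γ) - Real.log v1))) := by
        rw [← hv2e]
      refine this.trans ?_
      generalize Real.log (v1 * v2 + 4 * γ) = L
      field_simp; ring
    linear_combination h5 + hv1e
  rw [this]; push_cast; rfl

end PartPC

section PartPD1
open MeasureTheory
abbrev W3 := (ℂ × ℂ) × ℂ
abbrev V5 := Fin 5 → ℂ

def Wd (ρ : ℝ) : Set W3 := {w | ‖w.1‖ < ρ ∧ |w.2.im| < ρ}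

lemma Wd_open (ρ : ℝ) : IsOpen (Wd ρ) :=
  (isOpen_lt (f := fun w : W3 => ‖w.1‖) (g := fun _ => ρ) (by fun_prop) (by fun_prop)).inter
    (isOpen_lt (f := fun w : W3 => |w.2.im|) (g := fun _ => ρ) (by fun_prop) (by fun_prop))

lemma Wd_mono {ρ ρ' : ℝ} (h : ρ ≤ ρ') : Wd ρ ⊆ Wd ρ' := fun _ hw => ⟨hw.1.trans_le h, hw.2.trans_le h⟩

lemma Wd_shift {ρ : ℝ} {w : W3} (hw : w ∈ Wd ρ) (s : ℝ) : (w.1, w.2 + (s:ℂ)) ∈ Wd ρ :=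
  ⟨hw.1, by simpa using hw.2⟩

def lW : Filter W3 := comap (fun w : W3 => max ‖w.1‖ |w.2.im|) (𝓝 0)

lemma lW_iff {p : W3 → Prop} : (∀ᶠ w in lW, p w) ↔ ∃ ρ > 0, ∀ w ∈ Wd ρ, p w := by
  unfold lW
  have hb := (Metric.nhds_basis_ball (x := (0:ℝ))).comap (fun w : W3 => max ‖w.1‖ |w.2.im|)
  rw [hb.eventually_iff]
  have : ∀ ρ : ℝ, (fun w : W3 => max ‖w.1‖ |w.2.im|) ⁻¹' ball 0 ρ = Wd ρ := by
    intro ρ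
    ext w
    have h0 : 0 ≤ max ‖w.1‖ |w.2.im| := le_max_of_le_left (norm_nonneg _)
    simp only [mem_preimage, mem_ball_zero_iff, Real.norm_of_nonneg h0, max_lt_iff]
    rfl
  constructor
  · rintro ⟨ρ, hρ, h⟩
    exact ⟨ρ, hρ, fun w hw => h (by rw [this]; exact hw)⟩
  · rintro ⟨ρ, hρ, h⟩
    refine ⟨ρ, hρ, fun w hw => h w (by rw [this] at hw; exact hw)⟩

/-- shrink to a point-free-neighbourhood version -/
lemma lW_ev_nhds {p : W3 → Prop} (h : ∀ᶠ w in lW, p w) : ∀ᶠ w in lW, ∀ᶠ w' in 𝓝 w, p w' := by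
  obtain ⟨ρ, hρ, h⟩ := lW_iff.1 h
  exact lW_iff.2 ⟨ρ, hρ, fun w hw => eventually_of_mem ((Wd_open ρ).mem_nhds hw) h⟩

lemma lW_shift {p : W3 → Prop} (h : ∀ᶠ w in lW, p w) : ∀ᶠ w in lW, ∀ s : ℝ, p (w.1, w.2 + (s:ℂ)) := by
  obtain ⟨ρ, hρ, h⟩ := lW_iff.1 h
  exact lW_iff.2 ⟨ρ, hρ, fun w hw s => h _ (Wd_shift hw s)⟩

lemma lW_scale {p : W3 → Prop} (h : ∀ᶠ w in lW, p w) :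
    ∀ᶠ w in lW, ∀ ζ : ℂ, ‖ζ‖ ≤ 2 → p (ζ • w.1, w.2) := by
  obtain ⟨ρ, hρ, h⟩ := lW_iff.1 h
  refine lW_iff.2 ⟨ρ / 3, by positivity, fun w hw ζ hζ => h _ ⟨?_, ?_⟩⟩
  · simp only [norm_smul]
    have := hw.1
    nlinarith [norm_nonneg w.1, norm_nonneg ζ]
  · have := hw.2
    simp only
    linarith

def wO (f : W3 → V5) (n : ℕ) : Prop := f =O[lW] fun w => ‖w.1‖ ^ n

lemma wO_iff {f : W3 → V5} {n : ℕ} : wO f n ↔ ∃ C > 0, ∃ ρ > 0, ∀ w ∈ Wd ρ, ‖f w‖ ≤ C * ‖w.1‖ ^ n := by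
  unfold wO
  rw [isBigO_iff']
  simp only [lW_iff]
  simp

lemma wO_iff_ev {f : W3 → V5} {n : ℕ} : wO f n ↔ ∃ C > 0, ∀ᶠ w in lW, ‖f w‖ ≤ C * ‖w.1‖ ^ n := by
  rw [wO_iff]; simp only [lW_iff]

lemma small_ev {ε : ℝ} (hε : 0 < ε) : ∀ᶠ w in lW, ‖w.1‖ < ε ∧ |w.2.im| < ε := lW_iff.2 ⟨ε, hε, fun _ h => h⟩

lemma wO.mono {f : W3 → V5} {n m : ℕ} (h : wO f n) (hm : m ≤ n) : wO f m := by
  refine h.trans (IsBigO.of_bound 1 ?_)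
  filter_upwards [small_ev one_pos] with w hw
  simp only [norm_pow, norm_norm, one_mul]
  exact pow_le_pow_of_le_one (norm_nonneg _) hw.1.le hm

lemma wO.add {f g : W3 → V5} {n : ℕ} (h : wO f n) (h' : wO g n) : wO (fun w => f w + g w) n := IsBigO.add h h'
lemma wO.sub {f g : W3 → V5} {n : ℕ} (h : wO f n) (h' : wO g n) : wO (fun w => f w - g w) n := IsBigO.sub h h'
lemma wO.smul {c : W3 → ℂ} {f : W3 → V5} {n m : ℕ} (hc : c =O[lW] fun w => ‖w.1‖ ^ m) (h : wO f n) :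
    wO (fun w => c w • f w) (n + m) := by
  have := IsBigO.smul hc h
  refine this.congr_right ?_
  intro w; simp [pow_add, mul_comm]

lemma wO_a3 : (fun w : W3 => w.1.1 ^ 3) =O[lW] fun w => ‖w.1‖ ^ 3 := by
  refine IsBigO.of_bound 1 (Eventually.of_forall fun w => ?_)
  simp only [norm_pow, norm_norm, one_mul]
  gcongr
  exact norm_fst_le _

lemma wO.congr {f g : W3 → V5} {n : ℕ} (h : wO f n) (he : ∀ᶠ w in lW, f w = g w) : wO g n :=
  IsBigO.congr' h he EventuallyEq.rfl

/-- Euler operator -/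
def Eul (P : W3 → V5) (w : W3) : V5 := fderiv ℂ P w (w.1, 0)

lemma Eul_line {P : W3 → V5} {w : W3} (hP : AnalyticAt ℂ P w) :
    HasDerivAt (fun ζ : ℂ => P (ζ • w.1, w.2)) (Eul P w) 1 := by
  have h1 : HasDerivAt (fun ζ : ℂ => (ζ • w.1, w.2)) (w.1, (0:ℂ)) 1 := by
    have := ((hasDerivAt_id (1:ℂ)).smul_const w.1).prodMk (hasDerivAt_const (1:ℂ) w.2)
    simpa using this
  have h2 : HasFDerivAt P (fderiv ℂ P w) ((fun ζ : ℂ => (ζ • w.1, w.2)) 1) := by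
    simp only [one_smul]
    exact hP.differentiableAt.hasFDerivAt
  exact h2.comp_hasDerivAt 1 h1

lemma Eul_analytic {P : W3 → V5} {w : W3} (hP : AnalyticAt ℂ P w) : AnalyticAt ℂ (Eul P) w := by
  unfold Eul
  have h1 : AnalyticAt ℂ (fun w : W3 => (fderiv ℂ P w, ((w.1, 0) : W3))) w :=
    hP.fderiv.prod (analyticAt_fst.prod analyticAt_const)
  have h2 := (ContinuousLinearMap.analyticAt_bilinear (ContinuousLinearMap.apply ℂ V5 (E := W3)).flip
    ((fderiv ℂ P w, ((w.1, 0) : W3))))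
  exact AnalyticAt.comp (f := fun w : W3 => (fderiv ℂ P w, ((w.1, 0) : W3))) (x := w) h2 h1

lemma Eul_add {P Q : W3 → V5} {w : W3} (hP : AnalyticAt ℂ P w) (hQ : AnalyticAt ℂ Q w) :
    Eul (fun w => P w + Q w) w = Eul P w + Eul Q w := by
  unfold Eul
  rw [fderiv_fun_add hP.differentiableAt hQ.differentiableAt]; rfl

lemma Eul_wO {f : W3 → V5} {n : ℕ} (hf : ∀ᶠ w in lW, AnalyticAt ℂ f w) (h : wO f n) : wO (Eul f) n := by
  obtain ⟨C, hC, h⟩ := wO_iff_ev.1 h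
  rw [wO_iff_ev]
  refine ⟨C * 2 ^ n, by positivity, ?_⟩
  filter_upwards [lW_scale h, lW_scale hf, hf] with w h1 h2 h3
  have hd := (Eul_line h3).deriv
  rw [← hd]
  have := Complex.norm_deriv_le_of_forall_mem_sphere_norm_le (c := 1) (R := 1)
    (C := C * 2 ^ n * ‖w.1‖ ^ n) (f := fun ζ : ℂ => f (ζ • w.1, w.2)) one_pos ?_ ?_
  · simpa using this
  · have hb : ∀ ζ ∈ closedBall (1:ℂ) 1, ‖ζ‖ ≤ 2 := by
      intro ζ hζ
      have := norm_le_norm_add_norm_sub' ζ 1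
      rw [mem_closedBall, dist_eq_norm] at hζ
      simp at this; linarith
    apply DifferentiableOn.diffContOnCl
    rw [closure_ball _ one_ne_zero]
    intro ζ hζ
    have ha := h2 ζ (hb ζ hζ)
    have : AnalyticAt ℂ (fun ζ : ℂ => f (ζ • w.1, w.2)) ζ := by
      refine AnalyticAt.comp (g := f) (f := fun ζ : ℂ => (ζ • w.1, w.2)) ha ?_
      exact (analyticAt_id.smul analyticAt_const).prod analyticAt_const
    exact this.differentiableAt.differentiableWithinAt
  · intro ζ hζ
    have hb : ‖ζ‖ ≤ 2 := by
      have := norm_le_norm_add_norm_sub' ζ 1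
      rw [mem_sphere, dist_eq_norm] at hζ
      simp at this; linarith
    refine (h1 ζ hb).trans ?_
    simp only [norm_smul, mul_pow]
    rw [mul_assoc]
    gcongr

def RealW (w : W3) : Prop := w.1.1.im = 0 ∧ w.1.2.im = 0 ∧ w.2.im = 0
def RealV (v : V5) : Prop := ∀ i, (v i).im = 0

lemma RealV.add {u v : V5} (hu : RealV u) (hv : RealV v) : RealV (u + v) := fun i => by simp [hu i, hv i]
lemma RealV.sub {u v : V5} (hu : RealV u) (hv : RealV v) : RealV (u - v) := fun i => by simp [hu i, hv i]
lemma RealV.smul {c : ℂ} {v : V5} (hc : c.im = 0) (hv : RealV v) : RealV (c • v) := fun i => by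
  simp [hc, hv i]
lemma realV_iff {v : V5} : RealV v ↔ (ContinuousLinearMap.pi fun i =>
    Complex.imCLM.comp ((ContinuousLinearMap.proj (R := ℂ) i).restrictScalars ℝ : V5 →L[ℝ] ℂ)) v = 0 := by
  rw [funext_iff]; rfl

lemma realV_integral {f : ℝ → V5} {μ : Measure ℝ} (hi : Integrable f μ) (h : ∀ s, RealV (f s)) : RealV (∫ s, f s ∂μ) := by
  rw [realV_iff, ← ContinuousLinearMap.integral_comp_comm _ hi]
  have : ∀ s, (ContinuousLinearMap.pi fun i =>
    Complex.imCLM.comp ((ContinuousLinearMap.proj (R := ℂ) i).restrictScalars ℝ : V5 →L[ℝ] ℂ)) (f s) = 0 :=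
    fun s => realV_iff.1 (h s)
  simp only [this, integral_zero]

lemma realV_lim {ι : Type*} {l : Filter ι} [l.NeBot] {f : ι → V5} {v : V5} (h : Tendsto f l (𝓝 v))
    (hf : ∀ᶠ n in l, RealV (f n)) : RealV v := by
  intro i
  have h1 : Tendsto (fun n => (f n i).im) l (𝓝 (v i).im) :=
    (Complex.continuous_im.tendsto _).comp ((continuous_apply i).continuousAt.tendsto.comp h)
  have h2 : Tendsto (fun n => (f n i).im) l (𝓝 0) := by
    refine tendsto_const_nhds.congr' ?_
    filter_upwards [hf] with n hn
    exact (hn i).symm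
  exact tendsto_nhds_unique h1 h2

lemma realV_deriv {f : ℂ → V5} {d : V5} {x : ℝ} (h : HasDerivAt f d x) (hr : ∀ᶠ s : ℝ in 𝓝 x, RealV (f s)) :
    RealV d := by
  have h1 : HasDerivAt (fun s : ℝ => f s) d x := by
    have := h.scomp x (Complex.ofRealCLM.hasDerivAt (x := x))
    simpa [Function.comp_def] using this
  have h2 := h1.tendsto_slope
  refine realV_lim h2 ?_
  have := hr.filter_mono (nhdsWithin_le_nhds (s := {x}ᶜ))
  filter_upwards [this] with s hs
  intro i
  have hx := hr.self_of_nhds i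
  have := hs i
  rw [slope_def_module]
  simp [this, hx]

lemma Eul_real {P : W3 → V5} (hP : ∀ᶠ w in lW, AnalyticAt ℂ P w) (hr : ∀ᶠ w in lW, RealW w → RealV (P w)) :
    ∀ᶠ w in lW, RealW w → RealV (Eul P w) := by
  filter_upwards [hP, lW_ev_nhds hr] with w h1 h2 hw
  have := Eul_line h1
  rw [show (1:ℂ) = ((1:ℝ):ℂ) by simp] at this
  refine realV_deriv this ?_
  have hc : ContinuousAt (fun s : ℝ => ((((s:ℝ):ℂ) • w.1, w.2) : W3)) 1 := by fun_prop
  have h3 : ∀ᶠ w' in 𝓝 (((((1:ℝ):ℝ):ℂ) • w.1, w.2) : W3), RealW w' → RealV (P w') := by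
    simpa using h2
  filter_upwards [hc.eventually h3] with s hs
  exact hs ⟨by simp [hw.1], by simp [hw.2.1], hw.2.2⟩

def tpi : ℂ := ((2 * Real.pi : ℝ) : ℂ)

lemma Eul_per {P : W3 → V5} (hr : ∀ᶠ w in lW, P (w.1, w.2 + tpi) = P w) :
    ∀ᶠ w in lW, Eul P (w.1, w.2 + tpi) = Eul P w := by
  filter_upwards [lW_ev_nhds hr] with w h2
  unfold Eul
  have h3 : (fun w' : W3 => P (w' + (0, tpi))) =ᶠ[𝓝 w] P := by
    filter_upwards [h2] with w' h'
    rw [← h']; congr 1; ext <;> simp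
  rw [← h3.fderiv_eq, fderiv_comp_add_right]
  congr 2; ext <;> simp

end PartPD1

section PartPD2
open MeasureTheory
def meanE (E : W3 → V5) (x : ℂ × ℂ) : V5 :=
  ((1 / (2 * Real.pi) : ℝ) : ℂ) • ∫ s in (0:ℝ)..(2 * Real.pi), E (x, (s:ℂ))

def primE (E : W3 → V5) (w : W3) : V5 :=
  -(((1 / (2 * Real.pi) : ℝ) : ℂ) • ∫ s in (0:ℝ)..(2 * Real.pi), (s:ℂ) • E (w.1, w.2 + (s:ℂ)))

lemma tpi_pos : 0 < 2 * Real.pi := by positivity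

section
variable {E : W3 → V5} {ρ C : ℝ} {k : ℕ}

lemma E_cont (ha : AnalyticOnNhd ℂ E (Wd ρ)) {w : W3} (hw : w ∈ Wd ρ) :
    Continuous (fun s : ℝ => E (w.1, w.2 + (s:ℂ))) := by
  rw [continuous_iff_continuousAt]
  intro s
  have h1 := (ha _ (Wd_shift hw s)).continuousAt
  have h2 : ContinuousAt (fun s : ℝ => ((w.1, w.2 + (s:ℂ)) : W3)) s := by fun_prop
  exact ContinuousAt.comp (f := fun s : ℝ => ((w.1, w.2 + (s:ℂ)) : W3)) h1 h2

lemma wint_analytic (ha : AnalyticOnNhd ℂ E (Wd ρ)) (hb : ∀ w ∈ Wd ρ, ‖E w‖ ≤ C * ‖w.1‖ ^ k) (c : ℝ → ℂ)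
    (hc : Continuous c) :
    AnalyticOnNhd ℂ (fun w : W3 => ∫ s in (0:ℝ)..(2 * Real.pi), c s • E (w.1, w.2 + (s:ℂ))) (Wd ρ) := by
  simp only [intervalIntegral.integral_of_le tpi_pos.le]
  refine int_analytic osg_C3 _ (Wd_open ρ) (fun s w => c s • E (w.1, w.2 + (s:ℂ))) ?_ ?_ ?_
  · intro w hw
    exact (hc.smul (E_cont ha hw)).aestronglyMeasurable
  · refine Eventually.of_forall fun s w hw => ?_
    refine AnalyticAt.fun_const_smul ?_
    refine AnalyticAt.comp (g := E) (f := fun w : W3 => (w.1, w.2 + (s:ℂ))) (ha _ (Wd_shift hw s)) ?_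
    exact analyticAt_fst.prod (analyticAt_snd.add analyticAt_const)
  · intro w₀ hw₀
    refine ⟨fun s => ‖c s‖ * (|C| * (ρ ^ k)), ?_, 1, one_pos, ?_⟩
    · have : Continuous (fun s => ‖c s‖ * (|C| * (ρ ^ k))) := by fun_prop
      exact (this.intervalIntegrable 0 (2 * Real.pi)).1
    · refine Eventually.of_forall fun s w _ hw => ?_
      show ‖c s • E (w.1, w.2 + (s:ℂ))‖ ≤ ‖c s‖ * (|C| * (ρ ^ k))
      rw [norm_smul]
      gcongr
      refine (hb _ (Wd_shift hw s)).trans ?_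
      have := hw.1.le
      gcongr
      exact le_abs_self C

lemma wint_bound (hb : ∀ w ∈ Wd ρ, ‖E w‖ ≤ C * ‖w.1‖ ^ k) (c : ℝ → ℂ) (hc : ∀ s, 0 ≤ s → s ≤ 2 * Real.pi → ‖c s‖ ≤ 2 * Real.pi)
    {w : W3} (hw : w ∈ Wd ρ) :
    ‖∫ s in (0:ℝ)..(2 * Real.pi), c s • E (w.1, w.2 + (s:ℂ))‖ ≤ (2 * Real.pi * (2 * Real.pi) * C) * ‖w.1‖ ^ k := by
  have := intervalIntegral.norm_integral_le_of_norm_le_const (a := (0:ℝ)) (b := 2 * Real.pi)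
    (f := fun s => c s • E (w.1, w.2 + (s:ℂ))) (C := 2 * Real.pi * (C * ‖w.1‖ ^ k)) ?_
  · refine this.trans (le_of_eq ?_)
    rw [sub_zero, abs_of_pos tpi_pos]; ring
  · intro s hs
    rw [uIoc_of_le tpi_pos.le] at hs
    rw [norm_smul]
    have h1 := hb _ (Wd_shift hw s)
    exact mul_le_mul (hc s hs.1.le hs.2) h1 (norm_nonneg _) tpi_pos.le

/-- mean over a shifted period is independent of the shift -/
lemma mean_shift (ha : AnalyticOnNhd ℂ E (Wd ρ)) (hp : ∀ w ∈ Wd ρ, E (w.1, w.2 + tpi) = E w)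
    (hb : ∀ w ∈ Wd ρ, ‖E w‖ ≤ C * ‖w.1‖ ^ k) {w : W3} (hw : w ∈ Wd ρ) :
    ∫ s in (0:ℝ)..(2 * Real.pi), E (w.1, w.2 + (s:ℂ)) = ∫ s in (0:ℝ)..(2 * Real.pi), E (w.1, (s:ℂ)) := by
  have hA := wint_analytic ha hb (fun _ => 1) continuous_const
  simp only [one_smul] at hA
  let U : Set ℂ := {t | |t.im| < ρ}
  have hρ : 0 < ρ := (norm_nonneg _).trans_lt hw.1
  have hUo : IsOpen U := isOpen_lt (by fun_prop) (by fun_prop)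
  have hUc : Convex ℝ U := by
    have : U = Complex.imCLM ⁻¹' (ball 0 ρ) := by ext t; simp [U]
    rw [this]
    exact (convex_ball 0 ρ).linear_preimage Complex.imCLM.toLinearMap
  let g : ℂ → V5 := fun t => ∫ s in (0:ℝ)..(2 * Real.pi), E (w.1, t + (s:ℂ))
  have hg : ∀ t ∈ U, AnalyticAt ℂ g t := by
    intro t ht
    exact AnalyticAt.comp (g := fun w : W3 => ∫ s in (0:ℝ)..(2 * Real.pi), E (w.1, w.2 + (s:ℂ)))
      (f := fun t : ℂ => (w.1, t)) (hA (w.1, t) ⟨hw.1, ht⟩) (analyticAt_const.prod analyticAt_id)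
  have hd : EqOn (deriv g) 0 U := by
    intro t ht
    have hwt : (w.1, t) ∈ Wd ρ := ⟨hw.1, ht⟩
    have hc : Continuous (fun s : ℝ => E (w.1, t + (s:ℂ))) := E_cont ha hwt
    have h1 : HasDerivAt g (deriv g t) (t + ((0:ℝ):ℂ)) := by simpa using (hg t ht).differentiableAt.hasDerivAt
    have hin : HasDerivAt (fun τ : ℝ => t + (τ:ℂ)) 1 0 := by
      simpa using (Complex.ofRealCLM.hasDerivAt (x := (0:ℝ))).const_add t
    have h2 : HasDerivAt (fun τ : ℝ => g (t + (τ:ℂ))) (deriv g t) 0 := by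
      have := HasDerivAt.scomp (h := fun τ : ℝ => t + (τ:ℂ)) (0:ℝ) h1 hin
      simpa [Function.comp_def] using this
    have h3 : ∀ τ : ℝ, g (t + (τ:ℂ)) = ∫ s in τ..(τ + 2 * Real.pi), E (w.1, t + (s:ℂ)) := by
      intro τ
      have := intervalIntegral.integral_comp_add_left (a := 0) (b := 2 * Real.pi) (fun s : ℝ => E (w.1, t + (s:ℂ))) τ
      simp only [add_zero] at this
      rw [← this]
      simp only [g]
      congr 1; ext1 s; congr 2; push_cast; ring
    have h4 : ∀ τ : ℝ, ∫ s in τ..(τ + 2 * Real.pi), E (w.1, t + (s:ℂ)) = ∫ s in (0:ℝ)..(0 + 2 * Real.pi), E (w.1, t + (s:ℂ)) := by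
      intro τ
      apply Function.Periodic.intervalIntegral_add_eq
      intro s
      have := hp _ (Wd_shift hwt s)
      simp only at this ⊢
      rw [← this]
      congr 2; simp only [tpi]; push_cast; ring
    have h5 : (fun τ : ℝ => g (t + (τ:ℂ))) = fun _ => ∫ s in (0:ℝ)..(0 + 2 * Real.pi), E (w.1, t + (s:ℂ)) := by
      ext1 τ; rw [h3, h4]
    rw [h5] at h2
    exact h2.unique (hasDerivAt_const _ _)
  have := hUo.is_const_of_deriv_eq_zero (f := g) hUc.isPreconnected
    (fun t ht => (hg t ht).differentiableAt.differentiableWithinAt) hd hw.2 (show (0:ℂ) ∈ U by simp [U, hρ])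
  simpa [g] using this

lemma prim_deriv (ha : AnalyticOnNhd ℂ E (Wd ρ)) (hp : ∀ w ∈ Wd ρ, E (w.1, w.2 + tpi) = E w)
    (hb : ∀ w ∈ Wd ρ, ‖E w‖ ≤ C * ‖w.1‖ ^ k) {w : W3} (hw : w ∈ Wd ρ) :
    HasDerivAt (fun t => primE E (w.1, t)) (-(E w - meanE E w.1)) w.2 := by
  have hA := wint_analytic ha hb (fun s => (s:ℂ)) Complex.continuous_ofReal
  let g : ℂ → V5 := fun t => ∫ s in (0:ℝ)..(2 * Real.pi), (s:ℂ) • E (w.1, t + (s:ℂ))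
  have hg : AnalyticAt ℂ g w.2 := 
    AnalyticAt.comp (g := fun w : W3 => ∫ s in (0:ℝ)..(2 * Real.pi), (s:ℂ) • E (w.1, w.2 + (s:ℂ)))
      (f := fun t : ℂ => (w.1, t)) (hA (w.1, w.2) hw) (analyticAt_const.prod analyticAt_id)
  have hc : Continuous (fun s : ℝ => E (w.1, w.2 + (s:ℂ))) := E_cont ha hw
  have hc' : Continuous (fun s : ℝ => (s:ℂ) • E (w.1, w.2 + (s:ℂ))) := Complex.continuous_ofReal.smul hc
  have h1 : HasDerivAt g (deriv g w.2) (w.2 + ((0:ℝ):ℂ)) := by simpa using hg.differentiableAt.hasDerivAt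
  have hin : HasDerivAt (fun τ : ℝ => w.2 + (τ:ℂ)) 1 0 := by
    simpa using (Complex.ofRealCLM.hasDerivAt (x := (0:ℝ))).const_add w.2
  have h2 : HasDerivAt (fun τ : ℝ => g (w.2 + (τ:ℂ))) (deriv g w.2) 0 := by
    have := HasDerivAt.scomp (h := fun τ : ℝ => w.2 + (τ:ℂ)) (0:ℝ) h1 hin
    simpa [Function.comp_def] using this
  have hper : Function.Periodic (fun s : ℝ => E (w.1, w.2 + (s:ℂ))) (2 * Real.pi) := by
    intro s
    have := hp _ (Wd_shift hw s)
    simp only at this ⊢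
    rw [← this]
    congr 2; simp only [tpi]; push_cast; ring
  set M := ∫ s in (0:ℝ)..(2 * Real.pi), E (w.1, w.2 + (s:ℂ)) with hM
  have h3 : ∀ τ : ℝ, g (w.2 + (τ:ℂ)) = (∫ s in τ..(τ + 2 * Real.pi), (s:ℂ) • E (w.1, w.2 + (s:ℂ))) - (τ:ℂ) • M := by
    intro τ
    have e1 := intervalIntegral.integral_comp_add_left (a := 0) (b := 2 * Real.pi)
      (fun s : ℝ => ((s:ℂ) - (τ:ℂ)) • E (w.1, w.2 + (s:ℂ))) τ
    simp only [add_zero] at e1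
    have e2 : g (w.2 + (τ:ℂ)) = ∫ s in τ..(τ + 2 * Real.pi), ((s:ℂ) - (τ:ℂ)) • E (w.1, w.2 + (s:ℂ)) := by
      rw [← e1]
      simp only [g]
      congr 1; ext1 s; congr 1
      · push_cast; ring
      · congr 2; push_cast; ring
    rw [e2]
    simp only [sub_smul]
    rw [intervalIntegral.integral_sub (hc'.intervalIntegrable _ _) ((show Continuous fun s : ℝ => (τ:ℂ) • E (w.1, w.2 + (s:ℂ)) from hc.const_smul (τ:ℂ)).intervalIntegrable _ _),
      intervalIntegral.integral_smul, hper.intervalIntegral_add_eq τ 0]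
    simp [hM]
  have h4 : HasDerivAt (fun τ : ℝ => g (w.2 + (τ:ℂ))) (((2 * Real.pi : ℝ):ℂ) • E w - M) 0 := by
    have e1 : HasDerivAt (fun τ : ℝ => ∫ s in (0:ℝ)..τ, (s:ℂ) • E (w.1, w.2 + (s:ℂ)))
      (((0:ℝ):ℂ) • E (w.1, w.2 + ((0:ℝ):ℂ))) 0 := intervalIntegral.integral_hasDerivAt_right (hc'.intervalIntegrable _ _)
        (hc'.stronglyMeasurableAtFilter _ _) hc'.continuousAt
    have e2 : HasDerivAt (fun τ : ℝ => ∫ s in (0:ℝ)..τ, (s:ℂ) • E (w.1, w.2 + (s:ℂ)))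
      (((0 + 2 * Real.pi:ℝ):ℂ) • E (w.1, w.2 + ((0 + 2 * Real.pi:ℝ):ℂ))) (0 + 2 * Real.pi) := intervalIntegral.integral_hasDerivAt_right (hc'.intervalIntegrable _ _)
        (hc'.stronglyMeasurableAtFilter _ _) hc'.continuousAt
    have e3 := (HasDerivAt.comp_add_const (0:ℝ) (2 * Real.pi) e2).sub e1
    have e4 : HasDerivAt (fun τ : ℝ => (τ:ℂ) • M) M 0 := by
      simpa using (Complex.ofRealCLM.hasDerivAt (x := (0:ℝ))).smul_const M
    have e5 := e3.sub e4
    have e6 : E (w.1, w.2 + ((0 + 2 * Real.pi:ℝ):ℂ)) = E w := by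
      have := hper 0
      simpa using this
    rw [e6] at e5
    simp only [zero_add, Complex.ofReal_zero, zero_smul, sub_zero] at e5
    refine e5.congr_of_eventuallyEq (Eventually.of_forall fun τ => ?_)
    simp only [h3, Pi.sub_apply]
    congr 1
    rw [eq_sub_iff_add_eq, add_comm]
    exact intervalIntegral.integral_add_adjacent_intervals (hc'.intervalIntegrable _ _) (hc'.intervalIntegrable _ _)
  have h5 : HasDerivAt g (((2 * Real.pi : ℝ):ℂ) • E w - M) w.2 := by
    have := hg.differentiableAt.hasDerivAt
    rwa [h2.unique h4] at this
  have h6 := (h5.const_smul ((1 / (2 * Real.pi) : ℝ) : ℂ)).neg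
  refine h6.congr_deriv ?_
  rw [hM, mean_shift ha hp hb hw]
  simp only [meanE, smul_sub, smul_smul, ← Complex.ofReal_mul]
  have : 1 / (2 * Real.pi) * (2 * Real.pi) = 1 := by field_simp
  rw [this]; simp
end

lemma mean_split {E : W3 → V5} {k : ℕ} (ha : ∀ᶠ w in lW, AnalyticAt ℂ E w)
    (hp : ∀ᶠ w in lW, E (w.1, w.2 + tpi) = E w) (hr : ∀ᶠ w in lW, RealW w → RealV (E w)) (hb : wO E k) :
    (∀ᶠ w in lW, AnalyticAt ℂ (meanE E) w.1) ∧ (∀ᶠ w in lW, RealW w → RealV (meanE E w.1)) ∧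
    wO (fun w => meanE E w.1) k ∧ (∀ᶠ w in lW, AnalyticAt ℂ (primE E) w) ∧
    (∀ᶠ w in lW, RealW w → RealV (primE E w)) ∧ (∀ᶠ w in lW, primE E (w.1, w.2 + tpi) = primE E w) ∧
    wO (primE E) k ∧ ∀ᶠ w in lW, HasDerivAt (fun t => primE E (w.1, t)) (-(E w - meanE E w.1)) w.2 := by
  obtain ⟨C, hC, hb⟩ := wO_iff_ev.1 hb
  obtain ⟨ρ, hρ, h⟩ := lW_iff.1 (ha.and (hp.and (hr.and hb)))
  have ha : AnalyticOnNhd ℂ E (Wd ρ) := fun w hw => (h w hw).1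
  have hp : ∀ w ∈ Wd ρ, E (w.1, w.2 + tpi) = E w := fun w hw => (h w hw).2.1
  have hr : ∀ w ∈ Wd ρ, RealW w → RealV (E w) := fun w hw => (h w hw).2.2.1
  have hb : ∀ w ∈ Wd ρ, ‖E w‖ ≤ C * ‖w.1‖ ^ k := fun w hw => (h w hw).2.2.2
  have h0 : ∀ w ∈ Wd ρ, (w.1, (0:ℂ)) ∈ Wd ρ := fun w hw => ⟨hw.1, by simpa using hρ⟩
  have hn : ‖((1 / (2 * Real.pi) : ℝ) : ℂ)‖ = 1 / (2 * Real.pi) := by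
    rw [Complex.norm_real, Real.norm_of_nonneg]; positivity
  refine ⟨?_, ?_, ?_, ?_, ?_, ?_, ?_, ?_⟩
  · refine lW_iff.2 ⟨ρ, hρ, fun w hw => ?_⟩
    have h1 := wint_analytic ha hb (fun _ => 1) continuous_const _ (h0 w hw)
    have h2 : AnalyticAt ℂ (fun x : ℂ × ℂ => ∫ s in (0:ℝ)..(2 * Real.pi), (1:ℂ) • E (x, 0 + (s:ℂ))) w.1 :=
      AnalyticAt.comp (g := fun w : W3 => ∫ s in (0:ℝ)..(2 * Real.pi), (1:ℂ) • E (w.1, w.2 + (s:ℂ)))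
        (f := fun x : ℂ × ℂ => (x, (0:ℂ))) h1 (analyticAt_id.prod analyticAt_const)
    simp only [one_smul, zero_add] at h2
    exact AnalyticAt.fun_const_smul h2
  · refine lW_iff.2 ⟨ρ, hρ, fun w hw hw' => ?_⟩
    refine RealV.smul (Complex.ofReal_im _) ?_
    rw [intervalIntegral.integral_of_le tpi_pos.le]
    have hc := E_cont ha (h0 w hw)
    simp only [zero_add] at hc
    refine realV_integral (hc.intervalIntegrable 0 (2 * Real.pi)).1 fun s => ?_
    exact hr _ ⟨hw.1, by simpa using hρ⟩ ⟨hw'.1, hw'.2.1, by simp⟩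
  · refine wO_iff.2 ⟨(1 / (2 * Real.pi)) * (2 * Real.pi * (2 * Real.pi) * C), by positivity, ρ, hρ, fun w hw => ?_⟩
    have := wint_bound hb (fun _ => 1) (by intro s _ _; simp; linarith [Real.pi_gt_three]) (h0 w hw)
    simp only [one_smul, zero_add] at this
    rw [meanE, norm_smul, hn, mul_assoc (1 / (2 * Real.pi))]
    gcongr
  · refine lW_iff.2 ⟨ρ, hρ, fun w hw => ?_⟩
    exact (AnalyticAt.fun_const_smul (wint_analytic ha hb (fun s => (s:ℂ)) Complex.continuous_ofReal w hw)).neg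
  · refine lW_iff.2 ⟨ρ, hρ, fun w hw hw' => ?_⟩
    have : RealV (((1 / (2 * Real.pi) : ℝ) : ℂ) • ∫ s in (0:ℝ)..(2 * Real.pi), (s:ℂ) • E (w.1, w.2 + (s:ℂ))) := by
      refine RealV.smul (Complex.ofReal_im _) ?_
      rw [intervalIntegral.integral_of_le tpi_pos.le]
      have hc := Complex.continuous_ofReal.smul (E_cont ha hw)
      refine realV_integral (hc.intervalIntegrable 0 (2 * Real.pi)).1 fun s => ?_
      exact RealV.smul (Complex.ofReal_im _) (hr _ (Wd_shift hw s) ⟨hw'.1, hw'.2.1, by simp [hw'.2.2]⟩)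
    intro i
    have := this i
    simp only [primE, Pi.neg_apply, Complex.neg_im, this, neg_zero]
  · refine lW_iff.2 ⟨ρ, hρ, fun w hw => ?_⟩
    simp only [primE]
    congr 2
    congr 1; ext1 s
    have := hp _ (Wd_shift hw s)
    simp only at this
    rw [← this]; congr 3; ring
  · refine wO_iff.2 ⟨(1 / (2 * Real.pi)) * (2 * Real.pi * (2 * Real.pi) * C), by positivity, ρ, hρ, fun w hw => ?_⟩
    have := wint_bound hb (fun s => (s:ℂ)) (by intro s h1 h2; simpa [abs_of_nonneg h1] using h2) hw
    rw [primE, norm_neg, norm_smul, hn, mul_assoc (1 / (2 * Real.pi))]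
    gcongr
  · exact lW_iff.2 ⟨ρ, hρ, fun w hw => prim_deriv ha hp hb hw⟩

end PartPD2

section PartPD3
open MeasureTheory
lemma hom_part {m : ℂ × ℂ → V5} (ha : AnalyticAt ℂ m 0) (k : ℕ)
    (hb : m =O[𝓝 0] fun x => ‖x‖ ^ k) :
    ∃ p : ContinuousMultilinearMap ℂ (fun _ : Fin k => ℂ × ℂ) V5,
      (fun x => m x - p fun _ => x) =O[𝓝 0] (fun x => ‖x‖ ^ (k + 1)) ∧
      ((∀ᶠ x : ℂ × ℂ in 𝓝 0, x.1.im = 0 → x.2.im = 0 → RealV (m x)) →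
        ∀ x : ℂ × ℂ, x.1.im = 0 → x.2.im = 0 → RealV (p fun _ => x)) := by
  obtain ⟨p, hp⟩ := ha
  have hv : ∀ j < k, ∀ x, (p j fun _ => x) = 0 := by
    intro j
    induction j using Nat.strong_induction_on with
    | _ j ih =>
      intro hj x
      have h1 := hp.isBigO_sub_partialSum_pow (j + 1)
      simp only [zero_add] at h1
      have h2 : m =O[𝓝 0] fun x => ‖x‖ ^ (j + 1) := by
        refine hb.trans (IsBigO.of_bound 1 ?_)
        filter_upwards [ball_mem_nhds (0:ℂ × ℂ) one_pos] with x hx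
        rw [mem_ball_zero_iff] at hx
        simp only [norm_pow, norm_norm, one_mul]
        exact pow_le_pow_of_le_one (norm_nonneg _) hx.le hj
      have h3 := h2.sub h1
      have h4 : ∀ x, m x - (m x - p.partialSum (j + 1) x) = p j fun _ => x := by
        intro x
        rw [sub_sub_cancel, FormalMultilinearSeries.partialSum, Finset.sum_range_succ,
          Finset.sum_eq_zero, zero_add]
        intro i hi
        have := Finset.mem_range.1 hi
        exact ih i this (this.trans hj) x
      simp only [h4] at h3
      exact h3.continuousMultilinearMap_apply_eq_zero x
  have h1 := hp.isBigO_sub_partialSum_pow (k + 1)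
  simp only [zero_add] at h1
  have h4 : ∀ x, p.partialSum (k + 1) x = p k fun _ => x := by
    intro x
    rw [FormalMultilinearSeries.partialSum, Finset.sum_range_succ,
      Finset.sum_eq_zero, zero_add]
    intro i hi
    have := Finset.mem_range.1 hi
    exact hv i this x
  simp only [h4] at h1
  refine ⟨p k, h1, ?_⟩
  intro hr x hx1 hx2
  have ht : Tendsto (fun τ : ℝ => (τ:ℂ) • x) (𝓝[>] 0) (𝓝 0) := by
    have : Continuous (fun τ : ℝ => (τ:ℂ) • x) := by fun_prop
    have h := this.tendsto 0
    simp only [Complex.ofReal_zero, zero_smul] at h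
    exact h.mono_left nhdsWithin_le_nhds
  obtain ⟨C, hC⟩ := h1.bound
  have hlim : Tendsto (fun τ : ℝ => ((τ:ℂ) ^ k)⁻¹ • m ((τ:ℂ) • x)) (𝓝[>] 0) (𝓝 (p k fun _ => x)) := by
    rw [tendsto_iff_norm_sub_tendsto_zero]
    have hz : Tendsto (fun τ : ℝ => C * (τ * ‖x‖ ^ (k + 1))) (𝓝[>] 0) (𝓝 0) := by
      have : Continuous (fun τ : ℝ => C * (τ * ‖x‖ ^ (k + 1))) := by fun_prop
      have h := this.tendsto 0
      simp only [zero_mul, mul_zero] at h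
      exact h.mono_left nhdsWithin_le_nhds
    refine squeeze_zero' (Eventually.of_forall fun _ => norm_nonneg _) ?_ hz
    filter_upwards [ht.eventually hC, self_mem_nhdsWithin] with τ h hτ
    have hτ : 0 < τ := hτ
    have hτ0 : ((τ:ℂ) ^ k) ≠ 0 := by
      apply pow_ne_zero; exact_mod_cast hτ.ne'
    have e : ((τ:ℂ) ^ k)⁻¹ • m ((τ:ℂ) • x) - (p k fun _ => x) = ((τ:ℂ) ^ k)⁻¹ • (m ((τ:ℂ) • x) - (p k fun _ => (τ:ℂ) • x)) := by
      have := (p k).map_smul_univ (fun _ => (τ:ℂ)) (fun _ => x)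
      rw [this, smul_sub]
      simp [smul_smul, inv_mul_cancel₀ hτ0]
    rw [e, norm_smul]
    have hn : ‖((τ:ℂ) ^ k)⁻¹‖ = (τ ^ k)⁻¹ := by simp [abs_of_pos hτ]
    rw [hn]
    have h' : ‖m ((τ:ℂ) • x) - (p k fun _ => (τ:ℂ) • x)‖ ≤ C * (τ ^ (k + 1) * ‖x‖ ^ (k + 1)) := by
      refine h.trans (le_of_eq ?_)
      rw [norm_pow, norm_norm, norm_smul, Complex.norm_real, Real.norm_of_nonneg hτ.le, mul_pow]
    calc _ ≤ (τ ^ k)⁻¹ * (C * (τ ^ (k + 1) * ‖x‖ ^ (k + 1))) := by gcongr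
      _ = C * (τ * ‖x‖ ^ (k + 1)) := by
        field_simp
        ring
  refine realV_lim hlim ?_
  filter_upwards [ht.eventually hr] with τ h
  refine RealV.smul ?_ (h (by simp [hx1]) (by simp [hx2]))
  rw [← Complex.ofReal_pow, ← Complex.ofReal_inv, Complex.ofReal_im]

end PartPD3

section PartPD4
open MeasureTheory
def Lam : Fin 5 → ℂ := ![-3/4, 1/2, -1/4, 1/4, 1/4]
def LamV (v : V5) : V5 := fun i => Lam i * v i

lemma LamV_norm (v : V5) : ‖LamV v‖ ≤ ‖v‖ := by
  rw [pi_norm_le_iff_of_nonneg (norm_nonneg _)]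
  intro i
  simp only [LamV, norm_mul]
  have h1 : ‖Lam i‖ ≤ 1 := by fin_cases i <;> simp [Lam] <;> norm_num
  have h2 := norm_le_pi_norm v i
  nlinarith [norm_nonneg (v i)]

lemma Lam_im (i : Fin 5) : (Lam i).im = 0 := by
  fin_cases i <;> simp [Lam]

lemma LamV_add (u v : V5) : LamV (u + v) = LamV u + LamV v := by
  ext i; simp [LamV, mul_add]

abbrev FT := (ℂ × ℂ) → V5 → ℂ → V5

structure FH (r C : ℝ) (F : FT) : Prop where
  ana : ∀ x ξ t, ‖x‖ < r → ‖ξ‖ < r → |t.im| < r →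
    AnalyticAt ℂ (fun p : ((ℂ × ℂ) × V5) × ℂ => F p.1.1 p.1.2 p.2) ((x, ξ), t)
  per : ∀ x ξ t, ‖x‖ < r → ‖ξ‖ < r → |t.im| < r → F x ξ (t + tpi) = F x ξ t
  real : ∀ x ξ t, ‖x‖ < r → ‖ξ‖ < r → |t.im| < r → RealW (x, t) → RealV ξ → RealV (F x ξ t)
  zero : ∀ x t, ‖x‖ < r → |t.im| < r → ‖F x 0 t‖ ≤ C * ‖x‖ ^ 2
  lip : ∀ x ξ ξ' t, ‖x‖ < r → ‖ξ‖ < r → ‖ξ'‖ < r → |t.im| < r →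
    ‖F x ξ t - F x ξ' t - LamV (ξ - ξ')‖ ≤ C * (‖x‖ + ‖ξ‖ + ‖ξ'‖) * ‖ξ - ξ'‖

def GH (γ : ℂ × ℂ → ℂ) : Prop :=
  (∃ p : ContinuousMultilinearMap ℂ (fun _ : Fin 3 => ℂ × ℂ) ℂ, ∀ x, γ x = p fun _ => x) ∧
    ∀ x : ℂ × ℂ, x.1.im = 0 → x.2.im = 0 → (γ x).im = 0

section
variable {G : Type*} [NormedAddCommGroup G] [NormedSpace ℂ G]

lemma mul_diag_analytic {k : ℕ} (p : ContinuousMultilinearMap ℂ (fun _ : Fin k => ℂ × ℂ) G) (x : ℂ × ℂ) :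
    AnalyticAt ℂ (fun x => p fun _ => x) x := by
  refine AnalyticAt.comp (g := fun v => p v) (f := fun x : ℂ × ℂ => fun _ : Fin k => x) p.analyticAt ?_
  exact (ContinuousLinearMap.pi fun _ : Fin k => ContinuousLinearMap.id ℂ (ℂ × ℂ)).analyticAt x

lemma mul_diag_bound {k : ℕ} (p : ContinuousMultilinearMap ℂ (fun _ : Fin k => ℂ × ℂ) G) (x : ℂ × ℂ) :
    ‖p fun _ => x‖ ≤ ‖p‖ * ‖x‖ ^ k := by
  have := p.le_opNorm fun _ => x
  simpa using this

lemma mul_diag_hom {k : ℕ} (p : ContinuousMultilinearMap ℂ (fun _ : Fin k => ℂ × ℂ) G) (c : ℂ) (x : ℂ × ℂ) :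
    (p fun _ => c • x) = c ^ k • p fun _ => x := by
  have := p.map_smul_univ (fun _ => c) (fun _ => x)
  simpa using this
end

lemma GH.ana {γ : ℂ × ℂ → ℂ} (h : GH γ) (x : ℂ × ℂ) : AnalyticAt ℂ γ x := by
  obtain ⟨⟨p, hp⟩, -⟩ := h
  rw [show γ = fun x => p fun _ => x from funext hp]
  exact mul_diag_analytic p x

lemma GH.bound {γ : ℂ × ℂ → ℂ} (h : GH γ) : ∃ C > 0, ∀ x, ‖γ x‖ ≤ C * ‖x‖ ^ 3 := by
  obtain ⟨⟨p, hp⟩, -⟩ := h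
  refine ⟨‖p‖ + 1, by positivity, fun x => ?_⟩
  rw [hp]
  refine (mul_diag_bound p x).trans ?_
  gcongr; linarith

lemma GH.hom {γ : ℂ × ℂ → ℂ} (h : GH γ) (c : ℂ) (x : ℂ × ℂ) : γ (c • x) = c ^ 3 * γ x := by
  obtain ⟨⟨p, hp⟩, -⟩ := h
  rw [hp, hp, mul_diag_hom]; rfl

lemma GH.wO {γ : ℂ × ℂ → ℂ} (h : GH γ) : (fun w : W3 => γ w.1) =O[lW] fun w => ‖w.1‖ ^ 3 := by
  obtain ⟨C, hC, hb⟩ := h.bound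
  exact IsBigO.of_bound C (Eventually.of_forall fun w => by simpa using hb w.1)

def Eres (γ : ℂ × ℂ → ℂ) (F : FT) (P S : W3 → V5) (w : W3) : V5 :=
  -((1/4 + γ w.1) • Eul P w) + S w - F w.1 (P w) w.2

structure St (γ : ℂ × ℂ → ℂ) (F : FT) (k : ℕ) (P S : W3 → V5) : Prop where
  Pa : ∀ᶠ w in lW, AnalyticAt ℂ P w
  Sa : ∀ᶠ w in lW, AnalyticAt ℂ S w
  Pp : ∀ᶠ w in lW, P (w.1, w.2 + tpi) = P w
  Sp : ∀ᶠ w in lW, S (w.1, w.2 + tpi) = S w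
  Pr : ∀ᶠ w in lW, RealW w → RealV (P w)
  Sr : ∀ᶠ w in lW, RealW w → RealV (S w)
  Pd : ∀ᶠ w in lW, HasDerivAt (fun t => P (w.1, t)) (w.1.1 ^ 3 • S w) w.2
  Pb : wO P 2
  Eb : wO (Eres γ F P S) k

lemma wO_small {f : W3 → V5} {n : ℕ} (hn : 1 ≤ n) (h : wO f n) {ε : ℝ} (hε : 0 < ε) : ∀ᶠ w in lW, ‖f w‖ < ε := by
  obtain ⟨C, hC, hb⟩ := wO_iff_ev.1 (h.mono hn)
  filter_upwards [hb, small_ev (ε := ε / C) (by positivity)] with w h1 h2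
  refine h1.trans_lt ?_
  rw [pow_one]
  calc C * ‖w.1‖ < C * (ε / C) := by gcongr; exact h2.1
    _ = ε := by field_simp

lemma fst_tendsto : Tendsto (fun w : W3 => w.1) lW (𝓝 0) := by
  rw [Metric.tendsto_nhds]
  intro ε hε
  filter_upwards [small_ev hε] with w hw
  simpa using hw.1

lemma emb_tendsto : Tendsto (fun x : ℂ × ℂ => ((x, 0) : W3)) (𝓝 0) lW := by
  rw [tendsto_def]
  intro s hs
  obtain ⟨ρ, hρ, h⟩ := lW_iff.1 (show ∀ᶠ w in lW, w ∈ s from hs)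
  filter_upwards [ball_mem_nhds (0:ℂ × ℂ) hρ] with x hx
  exact h _ ⟨by simpa using hx, by simpa using hρ⟩

lemma Eres_props {γ : ℂ × ℂ → ℂ} {F : FT} {k : ℕ} {P S : W3 → V5} {r C : ℝ} (hr : 0 < r) (hF : FH r C F)
    (hγ : GH γ) (h : St γ F k P S) :
    (∀ᶠ w in lW, AnalyticAt ℂ (Eres γ F P S) w) ∧
    (∀ᶠ w in lW, Eres γ F P S (w.1, w.2 + tpi) = Eres γ F P S w) ∧
    (∀ᶠ w in lW, RealW w → RealV (Eres γ F P S w)) := by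
  have hs := wO_small one_le_two h.Pb hr
  refine ⟨?_, ?_, ?_⟩
  · filter_upwards [h.Pa, h.Sa, hs, small_ev hr] with w h1 h2 h3 h4
    have hγa : AnalyticAt ℂ (fun w : W3 => (1/4 + γ w.1)) w := 
      analyticAt_const.add (AnalyticAt.comp (g := γ) (f := fun w : W3 => w.1) (hγ.ana _) analyticAt_fst)
    have hFa : AnalyticAt ℂ (fun w : W3 => F w.1 (P w) w.2) w := by
      refine AnalyticAt.comp (g := fun p : ((ℂ × ℂ) × V5) × ℂ => F p.1.1 p.1.2 p.2)
        (f := fun w : W3 => ((w.1, P w), w.2)) (hF.ana _ _ _ h4.1 h3 h4.2) ?_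
      exact (analyticAt_fst.prod h1).prod analyticAt_snd
    exact ((hγa.smul (Eul_analytic h1)).neg.add h2).sub hFa
  · filter_upwards [h.Pp, h.Sp, Eul_per h.Pp, hs, small_ev hr] with w h1 h2 h3 h4 h5
    simp only [Eres, h1, h2, h3, hF.per _ _ _ h5.1 h4 h5.2]
  · filter_upwards [h.Pr, h.Sr, Eul_real h.Pa h.Pr, hs, small_ev hr] with w h1 h2 h3 h4 h5 hw
    refine RealV.sub (RealV.add ?_ (h2 hw)) (hF.real _ _ _ h5.1 h4 h5.2 hw (h1 hw))
    rw [← neg_smul]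
    refine RealV.smul ?_ (h3 hw)
    have := hγ.2 w.1 hw.1 hw.2.1
    simp [this]

lemma wO_diag {k : ℕ} (p : ContinuousMultilinearMap ℂ (fun _ : Fin k => ℂ × ℂ) V5) :
    wO (fun w => p fun _ => w.1) k :=
  IsBigO.of_bound ‖p‖ (Eventually.of_forall fun w => by simpa using mul_diag_bound p w.1)

lemma Eul_diag {k : ℕ} (p : ContinuousMultilinearMap ℂ (fun _ : Fin k => ℂ × ℂ) V5) (w : W3) :
    Eul (fun w => p fun _ => w.1) w = (k:ℂ) • p fun _ => w.1 := by
  have ha : AnalyticAt ℂ (fun w : W3 => p fun _ => w.1) w := 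
    AnalyticAt.comp (g := fun x : ℂ × ℂ => p fun _ => x) (f := fun w : W3 => w.1) (mul_diag_analytic p w.1) analyticAt_fst
  have h1 := Eul_line ha
  simp only [mul_diag_hom] at h1
  have h2 : HasDerivAt (fun ζ : ℂ => ζ ^ k • p fun _ => w.1) ((k:ℂ) • p fun _ => w.1) 1 := by
    simpa using (hasDerivAt_pow k (1:ℂ)).smul_const (p fun _ => w.1)
  exact h1.unique h2

theorem step {γ : ℂ × ℂ → ℂ} {F : FT} {k : ℕ} {P S : W3 → V5} {r C : ℝ} (hr : 0 < r) (hC : 0 ≤ C) (hF : FH r C F)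
    (hγ : GH γ) (h : St γ F k P S) (hk : 2 ≤ k)
    (hres : ∀ i, (k:ℂ) / 4 + Lam i ≠ 0 ∨ (fun x => meanE (Eres γ F P S) x i) =O[𝓝 0] fun x => ‖x‖ ^ (k + 1)) :
    ∃ P' S', St γ F (k + 1) P' S' ∧ wO (fun w => P' w - P w) k := by
  obtain ⟨ea, ep, er⟩ := Eres_props hr hF hγ h
  obtain ⟨ma, mr, mb, Ba, Br, Bp, Bb, Bd⟩ := mean_split ea ep er h.Eb
  set E := Eres γ F P S with hE
  have hm0 : AnalyticAt ℂ (meanE E) 0 := by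
    obtain ⟨ρ, hρ, hh⟩ := lW_iff.1 ma
    exact hh (0, 0) ⟨by simpa using hρ, by simpa using hρ⟩
  have hmb : meanE E =O[𝓝 0] fun x => ‖x‖ ^ k := by
    have := IsBigO.comp_tendsto mb emb_tendsto
    exact this
  obtain ⟨e, he, her⟩ := hom_part hm0 k hmb
  have her := her (by
    have := emb_tendsto.eventually mr
    filter_upwards [this] with x hx h1 h2
    exact hx ⟨h1, h2, by simp⟩)
  let D : V5 →L[ℂ] V5 := ContinuousLinearMap.pi fun i => ((k:ℂ) / 4 + Lam i)⁻¹ • ContinuousLinearMap.proj i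
  let q := D.compContinuousMultilinearMap e
  let Q : W3 → V5 := fun w => q fun _ => w.1
  have hQi : ∀ w i, Q w i = ((k:ℂ) / 4 + Lam i)⁻¹ * (e fun _ => w.1) i := by
    intro w i; simp [Q, q, D]
  have hQa : ∀ w, AnalyticAt ℂ Q w := fun w =>
    AnalyticAt.comp (g := fun x : ℂ × ℂ => q fun _ => x) (f := fun w : W3 => w.1) (mul_diag_analytic q w.1) analyticAt_fst
  have hQb : wO Q k := wO_diag q
  have hQe : ∀ w, Eul Q w = (k:ℂ) • Q w := Eul_diag q
  -- main cancellation
  have hmain : wO (fun w => meanE E w.1 - ((k:ℂ) / 4) • Q w - LamV (Q w)) (k + 1) := by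
    unfold wO
    rw [isBigO_pi]
    intro i
    have he' : (fun w : W3 => meanE E w.1 i - (e fun _ => w.1) i) =O[lW] fun w => ‖w.1‖ ^ (k + 1) := by
      have := IsBigO.comp_tendsto he fst_tendsto
      exact (isBigO_pi.1 this) i
    by_cases hz : (k:ℂ) / 4 + Lam i = 0
    · have h1 := (hres i).resolve_left (by simpa using hz)
      have h2 := IsBigO.comp_tendsto h1 fst_tendsto
      refine h2.congr_left fun w => ?_
      simp [LamV, hQi, hz]
    · refine he'.congr_left fun w => ?_
      simp only [LamV, Pi.sub_apply, Pi.smul_apply, smul_eq_mul, hQi]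
      linear_combination (-(e fun _ => w.1) i) * (mul_inv_cancel₀ hz).symm
  let A : W3 → V5 := fun w => w.1.1 ^ 3 • primE E w
  have hAa : ∀ᶠ w in lW, AnalyticAt ℂ A w := by
    filter_upwards [Ba] with w hw
    exact ((analyticAt_fst.comp analyticAt_fst).pow 3).smul hw
  have hAb : wO A (k + 3) := wO.smul wO_a3 Bb
  have hdb : wO (fun w => Q w + A w) k := hQb.add (hAb.mono (by omega))
  have hP'b : wO (fun w => P w + (Q w + A w)) 2 := h.Pb.add (hdb.mono hk)
  refine ⟨fun w => P w + (Q w + A w), fun w => S w - (E w - meanE E w.1), ?_, ?_⟩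
  swap
  · exact hdb.congr (Eventually.of_forall fun w => by simp)
  have hma : ∀ᶠ w in lW, AnalyticAt ℂ (fun w : W3 => meanE E w.1) w := by
    filter_upwards [ma] with w hw
    exact AnalyticAt.comp (g := meanE E) (f := fun w : W3 => w.1) hw analyticAt_fst
  constructor
  · filter_upwards [h.Pa, hAa] with w h1 h2
    exact h1.add ((hQa w).add h2)
  · filter_upwards [h.Sa, ea, hma] with w h1 h2 h3
    exact h1.sub (h2.sub h3)
  · filter_upwards [h.Pp, Bp] with w h1 h2
    simp only [h1, A, h2, Q]
  · filter_upwards [h.Sp, ep] with w h1 h2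
    simp only [h1, h2]
  · filter_upwards [h.Pr, Br] with w h1 h2 hw
    refine (h1 hw).add (RealV.add ?_ (RealV.smul ?_ (h2 hw)))
    · intro i
      rw [hQi]
      have := her w.1 hw.1 hw.2.1 i
      have h3 : (((k:ℂ) / 4 + Lam i)⁻¹).im = 0 := by
        rw [Complex.inv_im]
        have : ((k:ℂ) / 4 + Lam i).im = 0 := by
          have h4 : (k:ℂ) / 4 = ((k / 4 : ℝ) : ℂ) := by push_cast; rfl
          rw [Complex.add_im, Lam_im, h4, Complex.ofReal_im, add_zero]
        rw [this]; simp
      rw [Complex.mul_im, this, h3]; simp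
    · have : w.1.1 = ((w.1.1.re : ℝ) : ℂ) := by apply Complex.ext <;> simp [hw.1]
      rw [this, ← Complex.ofReal_pow, Complex.ofReal_im]
  · filter_upwards [h.Sr, er, mr] with w h1 h2 h3 hw
    exact (h1 hw).sub ((h2 hw).sub (h3 hw))
  · filter_upwards [h.Pd, Bd] with w h1 h2
    have h3 : HasDerivAt (fun t => Q (w.1, t)) 0 w.2 := hasDerivAt_const w.2 (q fun _ => w.1)
    have h4 := h1.add (h3.add (h2.const_smul (w.1.1 ^ 3)))
    refine h4.congr_deriv ?_
    simp only [smul_sub, smul_neg, zero_add]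
    abel
  · exact hP'b
  · -- the new residual
    have hsP := wO_small one_le_two h.Pb hr
    have hsP' := wO_small one_le_two hP'b hr
    have b1 : wO (fun w => γ w.1 • ((k:ℂ) • Q w)) (k + 1) := by
      have h1 : wO (fun w => (k:ℂ) • Q w) k := IsBigO.const_smul_left hQb (k:ℂ)
      exact (wO.smul hγ.wO h1).mono (by omega)
    have b2 : wO (fun w => (1/4 + γ w.1) • Eul A w) (k + 1) := by
      have h1 : (fun w : W3 => (1/4 + γ w.1)) =O[lW] fun w => ‖w.1‖ ^ 0 := by
        have h2 : (fun w : W3 => (1/4 : ℂ)) =O[lW] fun w => ‖w.1‖ ^ 0 := by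
          simp only [pow_zero]; exact isBigO_const_const _ one_ne_zero _
        refine h2.add (hγ.wO.trans (IsBigO.of_bound 1 ?_))
        filter_upwards [small_ev one_pos] with w hw
        simp only [norm_pow, norm_norm, pow_zero, norm_one, mul_one]
        exact pow_le_one₀ (norm_nonneg _) hw.1.le
      exact (wO.smul h1 (Eul_wO hAa hAb)).mono (by omega)
    have b3 : wO (fun w => LamV (A w)) (k + 1) := by
      have : wO (fun w => LamV (A w)) (k + 3) := by
        refine IsBigO.trans ?_ hAb
        exact IsBigO.of_bound 1 (Eventually.of_forall fun w => by simpa using LamV_norm (A w))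
      exact this.mono (by omega)
    have b4 : wO (fun w => F w.1 (P w + (Q w + A w)) w.2 - F w.1 (P w) w.2 - LamV (Q w + A w)) (k + 1) := by
      have h1 : (fun w : W3 => C * (‖w.1‖ + ‖P w + (Q w + A w)‖ + ‖P w‖)) =O[lW] fun w => ‖w.1‖ ^ 1 := by
        refine IsBigO.const_mul_left ((IsBigO.add ?_ ?_).add ?_) C
        · simp only [pow_one]; exact isBigO_refl _ _
        · exact (hP'b.mono one_le_two).norm_left
        · exact (h.Pb.mono one_le_two).norm_left
      have h2 := h1.mul (IsBigO.norm_left hdb)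
      refine (IsBigO.of_bound 1 ?_).trans (h2.congr_right fun w => by rw [← pow_add, add_comm])
      filter_upwards [hsP, hsP', small_ev hr] with w a1 a2 a3
      have := hF.lip w.1 (P w + (Q w + A w)) (P w) w.2 a3.1 a2 a1 a3.2
      rw [add_sub_cancel_left] at this
      rw [one_mul, Real.norm_of_nonneg (by positivity)]
      exact this
    have key := (((hmain.sub b1).sub b2).sub b3).sub b4
    refine key.congr ?_
    filter_upwards [h.Pa, hAa] with w h1 h2
    have e1 : Eul (fun w => P w + (Q w + A w)) w = Eul P w + ((k:ℂ) • Q w + Eul A w) := by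
      rw [Eul_add h1 (Q := fun w => Q w + A w) ((hQa w).add h2), Eul_add (hQa w) h2, hQe]
    have e2 : E w = -((1/4 + γ w.1) • Eul P w) + S w - F w.1 (P w) w.2 := rfl
    simp only [Eres, e1]
    rw [e2, LamV_add]
    module

end PartPD4

section PartPD5
open MeasureTheory
def Gv (x : ℂ × ℂ) (ξ : V5) : V5 := ![1 + ξ 0, ξ 1, x.2, 0, 0]
def Fg (γ : ℂ × ℂ → ℂ) (F : FT) : FT := fun x ξ t => F x ξ t + γ x • Gv x ξ

lemma Gv_analytic (p : ((ℂ × ℂ) × V5) × ℂ) : AnalyticAt ℂ (fun p : ((ℂ × ℂ) × V5) × ℂ => Gv p.1.1 p.1.2) p := by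
  have hx : AnalyticAt ℂ (fun p : ((ℂ × ℂ) × V5) × ℂ => p.1.1.2) p := by fun_prop
  have hi : ∀ i, AnalyticAt ℂ (fun p : ((ℂ × ℂ) × V5) × ℂ => p.1.2 i) p := by
    intro i
    exact ((ContinuousLinearMap.proj (R := ℂ) (φ := fun _ : Fin 5 => ℂ) i).analyticAt _).comp
      (f := fun p : ((ℂ × ℂ) × V5) × ℂ => p.1.2) (by fun_prop)
  rw [analyticAt_pi_iff]
  intro i
  fin_cases i
  · exact analyticAt_const.add (hi 0)
  · exact hi 1
  · exact hx
  · exact analyticAt_const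
  · exact analyticAt_const

lemma Gv_sub (x : ℂ × ℂ) (ξ ξ' : V5) : ‖Gv x ξ - Gv x ξ'‖ ≤ ‖ξ - ξ'‖ := by
  rw [pi_norm_le_iff_of_nonneg (norm_nonneg _)]
  intro i
  have h0 := norm_le_pi_norm (ξ - ξ') 0
  have h1 := norm_le_pi_norm (ξ - ξ') 1
  have := norm_nonneg (ξ - ξ')
  fin_cases i <;> simp [Gv] at * <;> assumption

lemma Gv_zero (x : ℂ × ℂ) : ‖Gv x 0‖ ≤ 1 + ‖x‖ := by
  rw [pi_norm_le_iff_of_nonneg (by positivity)]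
  intro i
  have := norm_snd_le x
  have := norm_nonneg x
  fin_cases i <;> simp [Gv] <;> linarith

lemma Gv_real {x : ℂ × ℂ} {ξ : V5} (h : x.2.im = 0) (hξ : RealV ξ) : RealV (Gv x ξ) := by
  intro i
  have h0 := hξ 0
  have h1 := hξ 1
  fin_cases i <;> simp [Gv, h, h0, h1]

lemma FH_gam {r C : ℝ} {F : FT} {γ : ℂ × ℂ → ℂ} (hr : 0 < r) (hC : 0 ≤ C) (hF : FH r C F) (hγ : GH γ) :
    ∃ r' > 0, ∃ C' ≥ 0, FH r' C' (Fg γ F) := by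
  obtain ⟨c, hc, hb⟩ := hγ.bound
  refine ⟨min r 1, by positivity, C + 2 * c, by positivity, ?_⟩
  have hr1 : ∀ {a : ℝ}, a < min r 1 → a < r := fun h => h.trans_le (min_le_left _ _)
  have hr2 : ∀ {a : ℝ}, a < min r 1 → a < 1 := fun h => h.trans_le (min_le_right _ _)
  constructor
  · intro x ξ t h1 h2 h3
    have hg : AnalyticAt ℂ (fun p : ((ℂ × ℂ) × V5) × ℂ => γ p.1.1) ((x, ξ), t) :=
      AnalyticAt.comp (g := γ) (f := fun p : ((ℂ × ℂ) × V5) × ℂ => p.1.1) (hγ.ana _) (by fun_prop)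
    exact (hF.ana x ξ t (hr1 h1) (hr1 h2) (hr1 h3)).add (hg.smul (Gv_analytic _))
  · intro x ξ t h1 h2 h3
    simp only [Fg, hF.per x ξ t (hr1 h1) (hr1 h2) (hr1 h3)]
  · intro x ξ t h1 h2 h3 h4 h5
    exact (hF.real x ξ t (hr1 h1) (hr1 h2) (hr1 h3) h4 h5).add
      (RealV.smul (hγ.2 x h4.1 h4.2.1) (Gv_real h4.2.1 h5))
  · intro x t h1 h3
    have a1 := hF.zero x t (hr1 h1) (hr1 h3)
    have a2 := Gv_zero x
    have a3 := hr2 h1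
    have a4 : ‖γ x • Gv x 0‖ ≤ 2 * c * ‖x‖ ^ 2 := by
      rw [norm_smul]
      calc ‖γ x‖ * ‖Gv x 0‖ ≤ (c * ‖x‖ ^ 3) * 2 := by gcongr; exact hb x; linarith
        _ = 2 * c * ‖x‖ ^ 2 * ‖x‖ := by ring
        _ ≤ 2 * c * ‖x‖ ^ 2 * 1 := by gcongr
        _ = _ := by ring
    calc ‖Fg γ F x 0 t‖ ≤ ‖F x 0 t‖ + ‖γ x • Gv x 0‖ := norm_add_le _ _
      _ ≤ C * ‖x‖ ^ 2 + 2 * c * ‖x‖ ^ 2 := add_le_add a1 a4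
      _ = _ := by ring
  · intro x ξ ξ' t h1 h2 h2' h3
    have a1 := hF.lip x ξ ξ' t (hr1 h1) (hr1 h2) (hr1 h2') (hr1 h3)
    have a3 := hr2 h1
    have a4 : ‖γ x • (Gv x ξ - Gv x ξ')‖ ≤ 2 * c * (‖x‖ + ‖ξ‖ + ‖ξ'‖) * ‖ξ - ξ'‖ := by
      rw [norm_smul]
      have : ‖x‖ ^ 3 ≤ ‖x‖ := by
        have := pow_le_pow_of_le_one (norm_nonneg x) a3.le (show 1 ≤ 3 by norm_num)
        simpa using this
      calc ‖γ x‖ * ‖Gv x ξ - Gv x ξ'‖ ≤ (c * ‖x‖ ^ 3) * ‖ξ - ξ'‖ := by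
            gcongr; exact hb x; exact Gv_sub _ _ _
        _ ≤ (c * ‖x‖) * ‖ξ - ξ'‖ := by gcongr
        _ ≤ 2 * c * (‖x‖ + ‖ξ‖ + ‖ξ'‖) * ‖ξ - ξ'‖ := by
          gcongr ?_ * _
          have := norm_nonneg x
          have := norm_nonneg ξ
          have := norm_nonneg ξ'
          nlinarith
    have e : Fg γ F x ξ t - Fg γ F x ξ' t - LamV (ξ - ξ') =
      (F x ξ t - F x ξ' t - LamV (ξ - ξ')) + γ x • (Gv x ξ - Gv x ξ') := by
      simp only [Fg, smul_sub]; abel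
    rw [e]
    refine (norm_add_le _ _).trans ((add_le_add a1 a4).trans (le_of_eq (by ring)))

lemma GH_zero : GH (fun _ => 0) := ⟨⟨0, fun x => by simp⟩, fun _ _ _ => by simp⟩

lemma St_zero {r C : ℝ} {F : FT} (hr : 0 < r) (hF : FH r C F) : St (fun _ => 0) F 2 (fun _ => 0) (fun _ => 0) := by
  constructor
  · exact Eventually.of_forall fun _ => analyticAt_const
  · exact Eventually.of_forall fun _ => analyticAt_const
  · exact Eventually.of_forall fun _ => rfl
  · exact Eventually.of_forall fun _ => rfl
  · exact Eventually.of_forall fun _ _ _ => by simp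
  · exact Eventually.of_forall fun _ _ _ => by simp
  · exact Eventually.of_forall fun w => by simpa using hasDerivAt_const w.2 (0:V5)
  · exact isBigO_zero _ _
  · refine IsBigO.of_bound C ?_
    filter_upwards [small_ev hr] with w hw
    have := hF.zero w.1 w.2 hw.1 hw.2
    simpa [Eres, Eul] using this

lemma Lam_nz {k : ℕ} (hk : 2 ≤ k) (i : Fin 5) : (k:ℂ) / 4 + Lam i ≠ 0 ∨ (k = 3 ∧ i = 0) := by
  by_cases h3 : k = 3
  · subst h3
    fin_cases i
    · right; simp
    all_goals left; simp [Lam]; norm_num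
  · left
    intro h
    have h' : ((k:ℝ):ℂ) / 4 + Lam i = 0 := by push_cast; exact h
    have hk' : (2:ℝ) ≤ k := by exact_mod_cast hk
    have hk3 : (k:ℝ) ≠ 3 := by exact_mod_cast h3
    have hre := congrArg Complex.re h'
    have h4 : ((k:ℝ):ℂ) / 4 = ((k / 4 : ℝ) : ℂ) := by push_cast; rfl
    rw [h4, Complex.add_re, Complex.ofReal_re, Complex.zero_re] at hre
    fin_cases i <;> simp [Lam] at hre
    · apply hk3; linarith
    · linarith
    · linarith
    · linarith
    · linarith

lemma meanE_wO {f : W3 → V5} {k : ℕ} (h : wO f k) : wO (fun w => meanE f w.1) k := by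
  obtain ⟨C, hC, ρ, hρ, hb⟩ := wO_iff.1 h
  refine wO_iff.2 ⟨(1 / (2 * Real.pi)) * (2 * Real.pi * (2 * Real.pi) * C), by positivity, ρ, hρ, fun w hw => ?_⟩
  have hn : ‖((1 / (2 * Real.pi) : ℝ) : ℂ)‖ = 1 / (2 * Real.pi) := by
    rw [Complex.norm_real, Real.norm_of_nonneg]; positivity
  have := wint_bound hb (fun _ => 1) (by intro s _ _; simp; linarith [Real.pi_gt_three])
    (w := (w.1, (0:ℂ))) ⟨hw.1, by simpa using hρ⟩
  simp only [one_smul, zero_add] at this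
  rw [meanE, norm_smul, hn, mul_assoc (1 / (2 * Real.pi))]
  gcongr

lemma ev_cont {f : W3 → V5} (ha : ∀ᶠ w in lW, AnalyticAt ℂ f w) :
    ∀ᶠ w in lW, Continuous (fun s : ℝ => f (w.1, (s:ℂ))) := by
  obtain ⟨ρ, hρ, h⟩ := lW_iff.1 ha
  refine lW_iff.2 ⟨ρ, hρ, fun w hw => ?_⟩
  have := E_cont (ρ := ρ) (fun w hw => h w hw) (w := (w.1, (0:ℂ))) ⟨hw.1, by simpa using hρ⟩
  simpa using this

theorem formal_aux {r C : ℝ} {F : FT} (hr : 0 < r) (hC : 0 ≤ C) (hF : FH r C F) {P1 S1 : W3 → V5}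
    (h1 : St (fun _ => 0) F 3 P1 S1) {E : W3 → V5} (hE : ∀ w, E w = Eres (fun _ => 0) F P1 S1 w)
    (ea : ∀ᶠ w in lW, AnalyticAt ℂ E w) {γ : ℂ × ℂ → ℂ} (hγ : GH γ)
    (he : (fun x => meanE E x 0 - γ x) =O[𝓝 0] fun x => ‖x‖ ^ (3 + 1)) :
    ∃ r' > 0, ∃ C' ≥ 0, FH r' C' (Fg γ F) ∧ St γ (Fg γ F) 3 P1 S1 ∧
      (fun x => meanE (Eres γ (Fg γ F) P1 S1) x 0) =O[𝓝 0] fun x => ‖x‖ ^ (3 + 1) := by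
  obtain ⟨r', hr', C', hC', hF'⟩ := FH_gam hr hC hF hγ
  let H : W3 → V5 := fun w => -(γ w.1 • (Eul P1 w + (Gv w.1 (P1 w) - Gv w.1 0)))
  have hdec : ∀ w, Eres γ (Fg γ F) P1 S1 w = E w - γ w.1 • Gv w.1 0 + H w := by
    intro w
    rw [hE]; simp only [Eres, H, Fg]
    module
  have hHb : wO H 5 := by
    have a1 : wO (fun w => Eul P1 w + (Gv w.1 (P1 w) - Gv w.1 0)) 2 := by
      refine (Eul_wO h1.Pa h1.Pb).add (IsBigO.trans (IsBigO.of_bound 1 (Eventually.of_forall fun w => ?_)) h1.Pb)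
      have := Gv_sub w.1 (P1 w) 0
      simpa using this
    exact (wO.smul hγ.wO a1).neg_left
  have hG0 : (fun w : W3 => Gv w.1 0) =O[lW] fun w => ‖w.1‖ ^ 0 := by
    refine IsBigO.of_bound 2 ?_
    filter_upwards [small_ev one_pos] with w hw
    have := Gv_zero w.1
    have h3 := hw.1
    simp; linarith
  have hSt : St γ (Fg γ F) 3 P1 S1 := by
    refine ⟨h1.Pa, h1.Sa, h1.Pp, h1.Sp, h1.Pr, h1.Sr, h1.Pd, h1.Pb, ?_⟩
    have := (((h1.Eb.congr (Eventually.of_forall fun w => (hE w).symm)).sub (wO.smul hγ.wO hG0)).add (hHb.mono (show 3 ≤ 5 by norm_num)))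
    exact this.congr (Eventually.of_forall fun w => (hdec w).symm)
  obtain ⟨ea', -, -⟩ := Eres_props hr' hF' hγ hSt
  have hHa : ∀ᶠ w in lW, Continuous (fun s : ℝ => H (w.1, (s:ℂ))) := by
    filter_upwards [ev_cont ea, ev_cont ea'] with w c1 c2
    have : (fun s : ℝ => H (w.1, (s:ℂ))) = fun s : ℝ => Eres γ (Fg γ F) P1 S1 (w.1, (s:ℂ)) - E (w.1, (s:ℂ)) + γ w.1 • Gv w.1 0 := by
      ext1 s; rw [hdec]; simp only; abel
    rw [this]
    exact (c2.sub c1).add continuous_const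
  have hmean : ∀ᶠ w in lW, meanE E w.1 - γ w.1 • Gv w.1 0 + meanE H w.1 = meanE (Eres γ (Fg γ F) P1 S1) w.1 := by
    filter_upwards [hHa, ev_cont ea] with w c1 c2
    simp only [meanE, hdec]
    have c3 : Continuous (fun s : ℝ => E (w.1, (s:ℂ)) - γ w.1 • Gv w.1 0) := c2.sub continuous_const
    rw [intervalIntegral.integral_add (c3.intervalIntegrable _ _) (c1.intervalIntegrable _ _),
      intervalIntegral.integral_sub (c2.intervalIntegrable _ _) (continuous_const.intervalIntegrable _ _),
      intervalIntegral.integral_const, smul_add, smul_sub]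
    congr 2
    rw [sub_zero, ← Complex.coe_smul (2 * Real.pi), smul_smul, ← Complex.ofReal_mul]
    have : 1 / (2 * Real.pi) * (2 * Real.pi) = 1 := by field_simp
    rw [this]; simp
  have hres : (fun x => meanE (Eres γ (Fg γ F) P1 S1) x 0) =O[𝓝 0] fun x => ‖x‖ ^ (3 + 1) := by
    have b1 : (fun x => (meanE E x 0 - γ x) + meanE H x 0) =O[𝓝 0] fun x => ‖x‖ ^ (3 + 1) := by
      refine IsBigO.add he ?_
      have : meanE H =O[𝓝 0] fun x => ‖x‖ ^ 4 :=
        IsBigO.comp_tendsto (meanE_wO (hHb.mono (show 4 ≤ 5 by norm_num))) emb_tendsto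
      exact isBigO_pi.1 this 0
    refine b1.congr' ?_ EventuallyEq.rfl
    filter_upwards [emb_tendsto.eventually hmean] with x hx
    rw [← hx]
    simp [Gv]
    try rfl
  exact ⟨r', hr', C', hC', hF', hSt, hres⟩

theorem formal {r C : ℝ} {F : FT} (hr : 0 < r) (hC : 0 ≤ C) (hF : FH r C F) :
    ∃ γ, GH γ ∧ ∀ k ≥ 3, ∃ P S, St γ (Fg γ F) k P S ∧ 
      ∀ k' ≥ k, ∃ P' S', St γ (Fg γ F) k' P' S' ∧ wO (fun w => P' w - P w) k := by
  obtain ⟨P1, S1, h1, -⟩ := step hr hC hF GH_zero (St_zero hr hF) le_rfl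
    (fun i => Or.inl ((Lam_nz le_rfl i).resolve_right (by simp)))
  obtain ⟨ea, ep, er⟩ := Eres_props hr hF GH_zero h1
  obtain ⟨ma, mr, mb, -⟩ := mean_split ea ep er h1.Eb
  obtain ⟨E, hE⟩ : ∃ E, E = Eres (fun _ => 0) F P1 S1 := ⟨_, rfl⟩
  rw [← hE] at ea ma mr mb
  have hm0 : AnalyticAt ℂ (meanE E) 0 := by
    obtain ⟨ρ, hρ, hh⟩ := lW_iff.1 ma
    exact hh (0, 0) ⟨by simpa using hρ, by simpa using hρ⟩
  have hmb : meanE E =O[𝓝 0] fun x => ‖x‖ ^ 3 := IsBigO.comp_tendsto mb emb_tendsto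
  obtain ⟨e, he, her⟩ := hom_part hm0 3 hmb
  have her := her (by
    have := emb_tendsto.eventually mr
    filter_upwards [this] with x hx h1 h2
    exact hx ⟨h1, h2, by simp⟩)
  obtain ⟨γ, hγe⟩ : ∃ γ : ℂ × ℂ → ℂ, γ = fun x => (e fun _ => x) 0 := ⟨_, rfl⟩
  have hγ : GH γ := by
    refine ⟨⟨(ContinuousLinearMap.proj (R := ℂ) (φ := fun _ : Fin 5 => ℂ) 0).compContinuousMultilinearMap e,
      fun x => by rw [hγe]; rfl⟩, fun x h1 h2 => by rw [hγe]; exact her x h1 h2 0⟩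
  obtain ⟨r', hr', C', hC', hF', hSt, hres⟩ := formal_aux hr hC hF h1 (fun w => by rw [hE]) ea hγ (by
    rw [hγe]; exact isBigO_pi.1 he 0)
  have hstep : ∀ k ≥ 3, ∀ P S, St γ (Fg γ F) k P S → (k = 3 → P = P1 ∧ S = S1) →
      ∃ P' S', St γ (Fg γ F) (k + 1) P' S' ∧ wO (fun w => P' w - P w) k := by
    intro k hk P S hS h3
    refine step hr' hC' hF' hγ hS (by omega) fun i => ?_
    rcases Lam_nz (show 2 ≤ k by omega) i with h | ⟨rfl, rfl⟩
    · exact Or.inl h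
    · obtain ⟨rfl, rfl⟩ := h3 rfl
      exact Or.inr hres
  have hstep' : ∀ k ≥ 3, ∀ P S, St γ (Fg γ F) k P S → (k = 3 → P = P1 ∧ S = S1) →
      ∀ k' ≥ k, ∃ P' S', St γ (Fg γ F) k' P' S' ∧ (k' = 3 → P' = P1 ∧ S' = S1) ∧ wO (fun w => P' w - P w) k := by
    intro k hk P S hS h3 k' hk'
    induction k', hk' using Nat.le_induction with
    | base => exact ⟨P, S, hS, h3, by simp only [sub_self]; exact isBigO_zero _ _⟩
    | succ k' hk' ih =>
      obtain ⟨P', S', a, b, c⟩ := ih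
      obtain ⟨P'', S'', a', c'⟩ := hstep k' (by omega) P' S' a b
      refine ⟨P'', S'', a', fun h => by omega, ?_⟩
      exact ((c'.mono hk').add c).congr (Eventually.of_forall fun w => by simp)
  refine ⟨γ, hγ, fun k hk => ?_⟩
  obtain ⟨P, S, a, b, -⟩ := hstep' 3 le_rfl P1 S1 hSt (fun _ => ⟨rfl, rfl⟩) k hk
  refine ⟨P, S, a, fun k' hk' => ?_⟩
  obtain ⟨P', S', a', b', c'⟩ := hstep' k hk P S a b k' hk'
  exact ⟨P', S', a', c'⟩

end PartPD5

section PartPE1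
open MeasureTheory
def yY : ℂ × ℂ → ℂ := Classical.choose exists_y
lemma yY_ana : AnalyticOnNhd ℂ yY Ydom := (Classical.choose_spec exists_y).1
lemma yY_bd : ∀ p ∈ Ydom, ‖yY p - 1 - (3/4) * p.1‖ ≤ 3/16 * ‖p.1‖ := (Classical.choose_spec exists_y).2.1
lemma yY_real : ∀ p ∈ Ydom, p.1.im = 0 → p.2.im = 0 → (yY p).im = 0 := (Classical.choose_spec exists_y).2.2.1
lemma yY_re : ∀ p ∈ Ydom, 1/2 ≤ (yY p).re := (Classical.choose_spec exists_y).2.2.2.1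
lemma yY_d : ∀ p ∈ Ydom, HasDerivAt (fun σ => yY (σ, p.2)) ((3/4) * (1 + 4 * p.2 / yY p)) p.1 :=
  (Classical.choose_spec exists_y).2.2.2.2.1
lemma yY_semi : ∀ σ₁ σ₂ γ y₁ : ℝ, 0 ≤ σ₁ → 0 ≤ σ₂ → |γ| < 1/100 → yY (σ₁, γ) = y₁ →
      yY ((σ₁ + σ₂ : ℝ), γ) = y₁ * yY ((σ₂ / y₁ : ℝ), (γ / y₁ : ℝ)) :=
  (Classical.choose_spec exists_y).2.2.2.2.2

/-- cone condition -/
def Cn (x : ℂ × ℂ) : Prop := |(x.1 ^ 3).im| < (x.1 ^ 3).re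

def fy (γ : ℂ × ℂ → ℂ) (x : ℂ × ℂ) (s : ℝ) : ℂ := yY ((s:ℂ) * x.1 ^ 3, γ x)
def fk (γ : ℂ × ℂ → ℂ) (x : ℂ × ℂ) (s : ℝ) : ℂ := Complex.exp (-(1/3) * Complex.log (fy γ x s))
def fx (γ : ℂ × ℂ → ℂ) (x : ℂ × ℂ) (s : ℝ) : ℂ × ℂ := fk γ x s • x

variable {γ : ℂ × ℂ → ℂ} {x : ℂ × ℂ} {s : ℝ}

lemma fdom (hx : Cn x) (hg : ‖γ x‖ < 1/100) (hs : 0 ≤ s) : ((s:ℂ) * x.1 ^ 3, γ x) ∈ Ydom := by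
  refine ⟨?_, hg⟩
  simp only [Complex.re_ofReal_mul, Complex.im_ofReal_mul, abs_mul, abs_of_nonneg hs]
  have : |(x.1 ^ 3).im| ≤ (x.1 ^ 3).re := le_of_lt hx
  have := mul_le_mul_of_nonneg_left this hs
  linarith

lemma cone_norm {z : ℂ} (h : |z.im| ≤ z.re) : ‖z‖ * (7/10) ≤ z.re := by
  have h0 : 0 ≤ z.re := (abs_nonneg _).trans h
  have h1 : ‖z‖ ^ 2 = z.re ^ 2 + z.im ^ 2 := by rw [← Complex.normSq_eq_norm_sq, Complex.normSq_apply]; ring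
  have h2 : z.im ^ 2 ≤ z.re ^ 2 := by rw [← sq_abs z.im]; gcongr
  refine le_of_sq_le_sq ?_ h0
  nlinarith [sq_nonneg z.re]

lemma fy_re (hx : Cn x) (hg : ‖γ x‖ < 1/100) (hs : 0 ≤ s) : 1 + s * ‖x.1‖ ^ 3 / 4 ≤ (fy γ x s).re := by
  have h1 := yY_bd _ (fdom hx hg hs)
  have h2 := (Complex.abs_re_le_norm _).trans h1
  have h3 : ‖(s:ℂ) * x.1 ^ 3‖ = s * ‖x.1‖ ^ 3 := by simp [abs_of_nonneg hs]
  have h4 := cone_norm (le_of_lt hx)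
  rw [h3] at h2
  rw [abs_le] at h2
  have h5 : (yY ((s:ℂ) * x.1 ^ 3, γ x) - 1 - 3/4 * ((s:ℂ) * x.1 ^ 3)).re = (fy γ x s).re - 1 - 3/4 * (s * (x.1 ^ 3).re) := by
    rw [show (3/4:ℂ) = ((3/4:ℝ):ℂ) by push_cast; rfl, Complex.sub_re, Complex.sub_re, Complex.re_ofReal_mul, Complex.re_ofReal_mul]
    rfl
  simp only [h5] at h2
  rw [norm_pow] at h4
  have := mul_le_mul_of_nonneg_left h4 hs
  have : 0 ≤ s * ‖x.1‖ ^ 3 := by positivity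
  nlinarith [h2.1]

lemma fy_norm (hx : Cn x) (hg : ‖γ x‖ < 1/100) (hs : 0 ≤ s) : 1 + s * ‖x.1‖ ^ 3 / 4 ≤ ‖fy γ x s‖ :=
  (fy_re hx hg hs).trans (Complex.re_le_norm _)

lemma fy_norm1 (hx : Cn x) (hg : ‖γ x‖ < 1/100) (hs : 0 ≤ s) : 1 ≤ ‖fy γ x s‖ := by
  have := fy_norm hx hg hs
  have : 0 ≤ s * ‖x.1‖ ^ 3 / 4 := by positivity
  linarith

lemma fy_ne (hx : Cn x) (hg : ‖γ x‖ < 1/100) (hs : 0 ≤ s) : fy γ x s ≠ 0 := by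
  have := fy_norm1 hx hg hs
  intro h; rw [h] at this; simp at this; linarith

lemma fk_cube (hx : Cn x) (hg : ‖γ x‖ < 1/100) (hs : 0 ≤ s) : fk γ x s ^ 3 = (fy γ x s)⁻¹ := by
  rw [fk, ← Complex.exp_nat_mul]
  have : ((3:ℕ):ℂ) * (-(1/3) * Complex.log (fy γ x s)) = -Complex.log (fy γ x s) := by push_cast; ring
  rw [this, Complex.exp_neg, Complex.exp_log (fy_ne hx hg hs)]

lemma fk_norm (hx : Cn x) (hg : ‖γ x‖ < 1/100) (hs : 0 ≤ s) : ‖fk γ x s‖ ^ 3 ≤ (1 + s * ‖x.1‖ ^ 3 / 4)⁻¹ := by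
  rw [← norm_pow, fk_cube hx hg hs, norm_inv]
  have : 0 ≤ s * ‖x.1‖ ^ 3 / 4 := by positivity
  exact inv_anti₀ (by positivity) (fy_norm hx hg hs)

lemma fk_le (hx : Cn x) (hg : ‖γ x‖ < 1/100) (hs : 0 ≤ s) : ‖fk γ x s‖ ≤ 1 := by
  have h1 := fk_norm hx hg hs
  have h2 : 0 ≤ s * ‖x.1‖ ^ 3 / 4 := by positivity
  have h3 : (1 + s * ‖x.1‖ ^ 3 / 4)⁻¹ ≤ 1 := inv_le_one_of_one_le₀ (by linarith)
  by_contra h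
  push Not at h
  have := one_lt_pow₀ h (n := 3) (by norm_num)
  linarith

lemma fx_norm : ‖fx γ x s‖ = ‖fk γ x s‖ * ‖x‖ := norm_smul _ _

lemma fx_norm_le (hx : Cn x) (hg : ‖γ x‖ < 1/100) (hs : 0 ≤ s) : ‖fx γ x s‖ ≤ ‖x‖ := by
  rw [fx_norm]; exact mul_le_of_le_one_left (norm_nonneg _) (fk_le hx hg hs)

lemma fx_a3 (hx : Cn x) (hg : ‖γ x‖ < 1/100) (hs : 0 ≤ s) : (fx γ x s).1 ^ 3 = x.1 ^ 3 * (fy γ x s)⁻¹ := by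
  simp only [fx, Prod.smul_fst, smul_eq_mul, mul_pow, fk_cube hx hg hs]; ring

lemma fx_gam (hγ : GH γ) (hx : Cn x) (hg : ‖γ x‖ < 1/100) (hs : 0 ≤ s) : γ (fx γ x s) = γ x * (fy γ x s)⁻¹ := by
  simp only [fx, hγ.hom, fk_cube hx hg hs]; ring

lemma fx_gam_lt (hγ : GH γ) (hx : Cn x) (hg : ‖γ x‖ < 1/100) (hs : 0 ≤ s) : ‖γ (fx γ x s)‖ < 1/100 := by
  rw [fx_gam hγ hx hg hs, norm_mul, norm_inv]
  exact (mul_le_of_le_one_right (norm_nonneg _) (inv_le_one_of_one_le₀ (fy_norm1 hx hg hs))).trans_lt hg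

lemma cone_inv {z : ℂ} (h : |z.im| < z.re) : |z⁻¹.im| < z⁻¹.re := by
  have h0 : 0 < z.re := (abs_nonneg _).trans_lt h
  have : 0 < Complex.normSq z := Complex.normSq_pos.2 (by intro h; simp [h] at h0)
  rw [Complex.inv_re, Complex.inv_im, abs_div, abs_neg, abs_of_pos this]
  gcongr

lemma fx_cone (hx : Cn x) (hg : ‖γ x‖ < 1/100) (hs : 0 ≤ s) : Cn (fx γ x s) := by
  have ha0 : x.1 ^ 3 ≠ 0 := by
    intro h; have : |(x.1^3).im| < (x.1^3).re := hx
    simp [h] at this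
  have h1 := cone_inv hx
  have e : (fx γ x s).1 ^ 3 = ((x.1 ^ 3)⁻¹ * fy γ x s)⁻¹ := by
    rw [fx_a3 hx hg hs, mul_inv, inv_inv]
  unfold Cn
  rw [e]
  apply cone_inv
  have h2 := yY_bd _ (fdom hx hg hs)
  set δ := (x.1 ^ 3)⁻¹ * (fy γ x s - 1 - (3/4) * ((s:ℂ) * x.1 ^ 3)) with hδ
  have h3 : ‖δ‖ ≤ 3/16 * s := by
    rw [hδ, norm_mul, norm_inv]
    have h4 : ‖fy γ x s - 1 - (3/4) * ((s:ℂ) * x.1 ^ 3)‖ ≤ 3/16 * (s * ‖x.1 ^ 3‖) := by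
      refine h2.trans (le_of_eq ?_)
      simp [abs_of_nonneg hs]
    have h5 : 0 < ‖x.1 ^ 3‖ := norm_pos_iff.2 ha0
    calc _ ≤ ‖x.1 ^ 3‖⁻¹ * (3/16 * (s * ‖x.1 ^ 3‖)) := by gcongr
      _ = _ := by field_simp
  have h6 : (x.1 ^ 3)⁻¹ * fy γ x s = (x.1 ^ 3)⁻¹ + (((3/4) * s : ℝ) : ℂ) + δ := by
    rw [hδ]; push_cast
    linear_combination ((3/4) * (s:ℂ)) * (inv_mul_cancel₀ ha0)
  rw [h6]
  simp only [Complex.add_re, Complex.add_im, Complex.ofReal_re, Complex.ofReal_im]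
  have h7 := (Complex.abs_re_le_norm δ).trans h3
  have h8 := (Complex.abs_im_le_norm δ).trans h3
  rw [abs_lt] at h1 ⊢
  rw [abs_le] at h7 h8
  constructor <;> linarith [h1.1, h1.2, h7.1, h7.2, h8.1, h8.2]

lemma fx_ana (hγ : GH γ) (hx : Cn x) (hg : ‖γ x‖ < 1/100) (hs : 0 ≤ s) : AnalyticAt ℂ (fun x => fx γ x s) x := by
  have h1 : AnalyticAt ℂ (fun x => fy γ x s) x := by
    refine AnalyticAt.comp (g := yY) (f := fun x : ℂ × ℂ => ((s:ℂ) * x.1 ^ 3, γ x)) (yY_ana _ (fdom hx hg hs)) ?_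
    have : AnalyticAt ℂ (fun x : ℂ × ℂ => (s:ℂ) * x.1 ^ 3) x := by fun_prop
    exact this.prod (hγ.ana _)
  have h2 : AnalyticAt ℂ (fun x => fk γ x s) x := by
    refine (AnalyticAt.mul analyticAt_const (h1.clog ?_)).cexp
    left
    have := yY_re _ (fdom hx hg hs)
    change 1/2 ≤ (fy γ x s).re at this
    linarith
  exact h2.smul analyticAt_id

lemma fx_deriv (hγ : GH γ) (hx : Cn x) (hg : ‖γ x‖ < 1/100) (hs : 0 ≤ s) :
    HasDerivAt (fun s => fx γ x s) (-(((fx γ x s).1 ^ 3 * (1/4 + γ (fx γ x s))) • fx γ x s)) s := by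
  have hy := fy_ne hx hg hs
  have h1 : HasDerivAt (fun s : ℝ => fy γ x s) ((3/4) * (1 + 4 * γ x / fy γ x s) * x.1 ^ 3) s := by
    have h0 := yY_d _ (fdom hx hg hs)
    have h2 : HasDerivAt (fun s : ℝ => (s:ℂ) * x.1 ^ 3) (x.1 ^ 3) s := by
      simpa using (Complex.ofRealCLM.hasDerivAt (x := s)).mul_const (x.1 ^ 3)
    have := HasDerivAt.comp s (h₂ := fun σ => yY (σ, γ x)) (h := fun s : ℝ => (s:ℂ) * x.1 ^ 3) h0 h2
    exact this
  have h2 : HasDerivAt (fun s : ℝ => fk γ x s) (fk γ x s * (-(1/3) * ((3/4) * (1 + 4 * γ x / fy γ x s) * x.1 ^ 3 / fy γ x s))) s := by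
    refine HasDerivAt.cexp (HasDerivAt.const_mul _ (h1.clog_real ?_))
    left
    have := yY_re _ (fdom hx hg hs)
    change 1/2 ≤ (fy γ x s).re at this
    linarith
  refine (h2.smul_const x).congr_deriv ?_
  rw [fx_a3 hx hg hs, fx_gam hγ hx hg hs]
  simp only [fx]
  rw [smul_smul, ← neg_smul]
  congr 1
  field_simp

lemma fx_zero (hg : ‖γ x‖ < 1/100) : fx γ x 0 = x := by
  have h1 := yY_bd (0, γ x) ⟨by simp, hg⟩
  simp at h1
  have h2 : fy γ x 0 = 1 := by
    unfold fy
    simp only [Complex.ofReal_zero, zero_mul]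
    exact sub_eq_zero.1 h1
  simp [fx, fk, h2]

lemma real_eq {z : ℂ} (h : z.im = 0) : z = ((z.re:ℝ):ℂ) := by apply Complex.ext <;> simp [h]

lemma fy_im (hγ : GH γ) (hx : Cn x) (hg : ‖γ x‖ < 1/100) (hs : 0 ≤ s) (h1 : x.1.im = 0) (h2 : x.2.im = 0) :
    (fy γ x s).im = 0 := by
  refine yY_real _ (fdom hx hg hs) ?_ (hγ.2 x h1 h2)
  simp only
  rw [real_eq h1, ← Complex.ofReal_pow, ← Complex.ofReal_mul, Complex.ofReal_im]

lemma fk_re_eq (hγ : GH γ) (hx : Cn x) (hg : ‖γ x‖ < 1/100) (hs : 0 ≤ s) (h1 : x.1.im = 0) (h2 : x.2.im = 0) :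
    fk γ x s = ((Real.exp (-(1/3) * Real.log (fy γ x s).re) : ℝ) : ℂ) := by
  have h3 := fy_im hγ hx hg hs h1 h2
  have h4 := yY_re _ (fdom hx hg hs)
  change 1/2 ≤ (fy γ x s).re at h4
  unfold fk
  rw [real_eq h3, ← Complex.ofReal_log (by linarith)]
  push_cast; rfl

lemma fx_real (hγ : GH γ) (hx : Cn x) (hg : ‖γ x‖ < 1/100) (hs : 0 ≤ s) (h1 : x.1.im = 0) (h2 : x.2.im = 0) :
    (fx γ x s).1.im = 0 ∧ (fx γ x s).2.im = 0 := by
  simp only [fx, fk_re_eq hγ hx hg hs h1 h2]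
  simp only [Prod.smul_fst, Prod.smul_snd, smul_eq_mul]
  constructor
  · rw [Complex.im_ofReal_mul, h1, mul_zero]
  · rw [Complex.im_ofReal_mul, h2, mul_zero]

lemma fx_semi (hγ : GH γ) (hx : Cn x) (hg : ‖γ x‖ < 1/100) {r : ℝ} (hr : 0 ≤ r) (hs : 0 ≤ s) (h1 : x.1.im = 0) (h2 : x.2.im = 0) :
    fx γ (fx γ x r) s = fx γ x (r + s) := by
  have hx' := fx_cone hx hg hr
  have hg' := fx_gam_lt hγ hx hg hr
  obtain ⟨h1', h2'⟩ := fx_real hγ hx hg hr h1 h2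
  have hy1 := fy_im hγ hx hg hr h1 h2
  have hp1 := yY_re _ (fdom hx hg hr)
  have hp2 := yY_re _ (fdom hx' hg' hs)
  change 1/2 ≤ (fy γ x r).re at hp1
  change 1/2 ≤ (fy γ (fx γ x r) s).re at hp2
  set y₁ := (fy γ x r).re with hy₁
  have ey : fy γ x r = (y₁:ℂ) := real_eq hy1
  have eg := real_eq (hγ.2 x h1 h2)
  have ea := real_eq h1
  have hpos : 0 < (x.1 ^ 3).re := (abs_nonneg _).trans_lt hx
  have ea3 : x.1 ^ 3 = (((x.1 ^ 3).re : ℝ) : ℂ) := by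
    apply real_eq; rw [ea, ← Complex.ofReal_pow, Complex.ofReal_im]
  set A := (x.1 ^ 3).re
  set g := (γ x).re
  have hgr : |g| < 1/100 := (Complex.abs_re_le_norm _).trans_lt hg
  have key := yY_semi (r * A) (s * A) g y₁ (by positivity) (by positivity) hgr (by
    rw [← ey]; unfold fy; rw [ea3, eg]; push_cast; rfl)
  have e1 : fy γ x (r + s) = y₁ * fy γ (fx γ x r) s := by
    have l1 : fy γ x (r + s) = yY ((r * A + s * A : ℝ), g) := by
      unfold fy; rw [ea3, eg]; congr 2; push_cast; ring
    have l2 : fy γ (fx γ x r) s = yY ((s * A / y₁ : ℝ), (g / y₁ : ℝ)) := by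
      unfold fy; rw [fx_a3 hx hg hr, fx_gam hγ hx hg hr, ea3, eg, ey]; congr 2 <;> push_cast <;> ring
    rw [l1, l2, key]
  have e2 : fk γ x (r + s) = fk γ (fx γ x r) s * fk γ x r := by
    rw [fk_re_eq hγ hx hg (add_nonneg hr hs) h1 h2, fk_re_eq hγ hx hg hr h1 h2, fk_re_eq hγ hx' hg' hs h1' h2', e1,
      Complex.re_ofReal_mul, ← Complex.ofReal_mul, ← Real.exp_add, Real.log_mul (by linarith) (by linarith)]
    congr 2; ring
  show fk γ (fx γ x r) s • (fk γ x r • x) = fk γ x (r + s) • x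
  rw [smul_smul, e2]

/-- the basic integral -/
lemma base_int {c : ℝ} (hc : 0 < c) {j : ℕ} (hj : 0 < j) :
    IntegrableOn (fun s : ℝ => c * ((1 + s * c)⁻¹) ^ (j + 1)) (Ioi 0) ∧
    ∫ s in Ioi (0:ℝ), c * ((1 + s * c)⁻¹) ^ (j + 1) = 1 / j := by
  have hj' : (j:ℝ) ≠ 0 := by positivity
  have hd : ∀ s ∈ Ici (0:ℝ), HasDerivAt (fun s : ℝ => -(1 / j) * ((1 + s * c)⁻¹) ^ j) (c * ((1 + s * c)⁻¹) ^ (j + 1)) s := by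
    intro s hs
    have hs : (0:ℝ) ≤ s := hs
    have hp : 1 + s * c ≠ 0 := by positivity
    have h1 : HasDerivAt (fun s : ℝ => 1 + s * c) c s := by
      simpa using ((hasDerivAt_id s).mul_const c).const_add 1
    have h2 := ((h1.inv hp).pow j).const_mul (-(1 / j : ℝ))
    refine h2.congr_deriv ?_
    obtain ⟨i, rfl⟩ : ∃ i, j = i + 1 := ⟨j - 1, by omega⟩
    simp only [Nat.add_sub_cancel, Pi.inv_apply]
    field_simp
    simp only [div_pow, one_pow]
    field_simp
    ring
  have hl : Tendsto (fun s : ℝ => -(1 / j) * ((1 + s * c)⁻¹) ^ j) atTop (𝓝 0) := by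
    have h1 : Tendsto (fun s : ℝ => 1 + s * c) atTop atTop :=
      tendsto_atTop_add_const_left _ _ (tendsto_id.atTop_mul_const hc)
    have h2 := ((tendsto_inv_atTop_zero.comp h1).pow j).const_mul (-(1 / j : ℝ))
    simpa [hj.ne'] using h2
  have hn : ∀ s ∈ Ioi (0:ℝ), 0 ≤ c * ((1 + s * c)⁻¹) ^ (j + 1) := by
    intro s hs
    have : (0:ℝ) < s := hs
    positivity
  refine ⟨integrableOn_Ioi_deriv_of_nonneg' hd hn hl, ?_⟩
  rw [integral_Ioi_of_hasDerivAt_of_nonneg' hd hn hl]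
  simp

end PartPE1

section PartPE2
open MeasureTheory
def Ud (ρ : ℝ) : Set W3 := {w | ‖w.1‖ < ρ ∧ Cn w.1 ∧ |w.2.im| < ρ}

lemma Ud_open (ρ : ℝ) : IsOpen (Ud ρ) := by
  have h1 : IsOpen {w : W3 | ‖w.1‖ < ρ} := isOpen_lt (by fun_prop) (by fun_prop)
  have h2 : IsOpen {w : W3 | |(w.1.1 ^ 3).im| < (w.1.1 ^ 3).re} :=
    isOpen_lt ((Complex.continuous_im.comp (by fun_prop : Continuous fun w : W3 => w.1.1 ^ 3)).abs)
      (Complex.continuous_re.comp (by fun_prop : Continuous fun w : W3 => w.1.1 ^ 3))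
  have h3 : IsOpen {w : W3 | |w.2.im| < ρ} :=
    isOpen_lt ((Complex.continuous_im.comp (by fun_prop : Continuous fun w : W3 => w.2)).abs) (by fun_prop)
  exact h1.inter (h2.inter h3)

def orb (γ : ℂ × ℂ → ℂ) (w : W3) (s : ℝ) : W3 := (fx γ w.1 s, w.2 + (s:ℂ))

def GS (γ : ℂ × ℂ → ℂ) (ρ : ℝ) : Prop := GH γ ∧ ∀ x, ‖x‖ < ρ → ‖γ x‖ < 1/100

variable {γ : ℂ × ℂ → ℂ} {ρ : ℝ} {w : W3} {s : ℝ}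

lemma orb_mem (h : GS γ ρ) (hw : w ∈ Ud ρ) (hs : 0 ≤ s) : orb γ w s ∈ Ud ρ := by
  have hg := h.2 _ hw.1
  refine ⟨(fx_norm_le hw.2.1 hg hs).trans_lt hw.1, fx_cone hw.2.1 hg hs, ?_⟩
  simpa [orb] using hw.2.2

lemma orb_ana (h : GS γ ρ) (hw : w ∈ Ud ρ) (hs : 0 ≤ s) : AnalyticAt ℂ (fun w => orb γ w s) w := by
  have h1 : AnalyticAt ℂ (fun w : W3 => fx γ w.1 s) w :=
    AnalyticAt.comp (g := fun x => fx γ x s) (f := fun w : W3 => w.1) (fx_ana h.1 hw.2.1 (h.2 _ hw.1) hs) analyticAt_fst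
  exact h1.prod (analyticAt_snd.add analyticAt_const)

lemma orb_deriv (h : GS γ ρ) (hw : w ∈ Ud ρ) (hs : 0 ≤ s) : HasDerivAt (fun s => orb γ w s)
    (-(((orb γ w s).1.1 ^ 3 * (1/4 + γ (orb γ w s).1)) • (orb γ w s).1), 1) s := by
  have h2 : HasDerivAt (fun s : ℝ => w.2 + (s:ℂ)) 1 s := by
    simpa using (Complex.ofRealCLM.hasDerivAt (x := s)).const_add w.2
  exact (fx_deriv h.1 hw.2.1 (h.2 _ hw.1) hs).prodMk h2

lemma orb_zero (h : GS γ ρ) (hw : w ∈ Ud ρ) : orb γ w 0 = w := by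
  simp [orb, fx_zero (h.2 _ hw.1)]

lemma orb_real (h : GS γ ρ) (hw : w ∈ Ud ρ) (hs : 0 ≤ s) (hr : RealW w) : RealW (orb γ w s) := by
  obtain ⟨h1, h2⟩ := fx_real h.1 hw.2.1 (h.2 _ hw.1) hs hr.1 hr.2.1
  exact ⟨h1, h2, by simp [orb, hr.2.2]⟩

lemma orb_semi (h : GS γ ρ) (hw : w ∈ Ud ρ) {r : ℝ} (hr : 0 ≤ r) (hs : 0 ≤ s) (hre : RealW w) :
    orb γ (orb γ w r) s = orb γ w (r + s) := by
  simp only [orb]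
  rw [fx_semi h.1 hw.2.1 (h.2 _ hw.1) hr hs hre.1 hre.2.1]
  push_cast; rw [add_assoc]

lemma Ud_pos (hw : w ∈ Ud ρ) : 0 < ‖w.1.1‖ ^ 3 / 4 := by
  have h : |(w.1.1 ^ 3).im| < (w.1.1 ^ 3).re := hw.2.1
  have : w.1.1 ≠ 0 := by intro h0; simp [h0] at h
  positivity

lemma orb_bound (h : GS γ ρ) (hw : w ∈ Ud ρ) (hs : 0 ≤ s) (j : ℕ) :
    ‖(orb γ w s).1.1 ^ 3‖ * ‖(orb γ w s).1‖ ^ (3 * j) ≤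
      4 * ‖w.1‖ ^ (3 * j) * ((‖w.1.1‖ ^ 3 / 4) * ((1 + s * (‖w.1.1‖ ^ 3 / 4))⁻¹) ^ (j + 1)) := by
  have hg := h.2 _ hw.1
  have h1 := fk_norm hw.2.1 hg hs
  have h2 := fx_norm (γ := γ) (x := w.1) (s := s)
  have h3 : ‖(fx γ w.1 s).1‖ = ‖fk γ w.1 s‖ * ‖w.1.1‖ := by simp [fx]
  simp only [orb, norm_pow]
  rw [h2, h3]
  have e : (1 + s * (‖w.1.1‖ ^ 3 / 4))⁻¹ = (1 + s * ‖w.1.1‖ ^ 3 / 4)⁻¹ := by rw [mul_div_assoc]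
  rw [e]
  calc (‖fk γ w.1 s‖ * ‖w.1.1‖) ^ 3 * (‖fk γ w.1 s‖ * ‖w.1‖) ^ (3 * j)
      = ‖w.1‖ ^ (3 * j) * ‖w.1.1‖ ^ 3 * (‖fk γ w.1 s‖ ^ 3) ^ (j + 1) := by ring
    _ ≤ ‖w.1‖ ^ (3 * j) * ‖w.1.1‖ ^ 3 * ((1 + s * ‖w.1.1‖ ^ 3 / 4)⁻¹) ^ (j + 1) := by gcongr
    _ = _ := by ring

def Iop (γ : ℂ × ℂ → ℂ) (h : W3 → V5) (w : W3) : V5 := -∫ s in Ioi (0:ℝ), (orb γ w s).1.1 ^ 3 • h (orb γ w s)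

section
variable {h : W3 → V5} {N : ℝ} {j : ℕ}

lemma Iop_integrand_cont (hg : GS γ ρ) (ha : AnalyticOnNhd ℂ h (Ud ρ)) (hw : w ∈ Ud ρ) :
    ContinuousOn (fun s => (orb γ w s).1.1 ^ 3 • h (orb γ w s)) (Ici 0) := by
  intro s hs
  have hs : 0 ≤ s := hs
  have h1 := (orb_deriv hg hw hs).continuousAt
  have h2 : ContinuousAt (fun s => h (orb γ w s)) s :=
    ContinuousAt.comp (g := h) (ha _ (orb_mem hg hw hs)).continuousAt h1
  have h3 : ContinuousAt (fun s => (orb γ w s).1.1 ^ 3) s :=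
    ContinuousAt.comp (g := fun w : W3 => w.1.1 ^ 3) (by fun_prop) h1
  exact (h3.smul h2).continuousWithinAt

lemma Iop_pt (hg : GS γ ρ) (hb : ∀ w ∈ Ud ρ, ‖h w‖ ≤ N * ‖w.1‖ ^ (3 * j)) (hN : 0 ≤ N) (hw : w ∈ Ud ρ) (hs : 0 ≤ s) :
    ‖(orb γ w s).1.1 ^ 3 • h (orb γ w s)‖ ≤
      (4 * N * ‖w.1‖ ^ (3 * j)) * ((‖w.1.1‖ ^ 3 / 4) * ((1 + s * (‖w.1.1‖ ^ 3 / 4))⁻¹) ^ (j + 1)) := by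
  rw [norm_smul]
  have h1 := hb _ (orb_mem hg hw hs)
  have h2 := orb_bound hg hw hs j
  calc _ ≤ ‖(orb γ w s).1.1 ^ 3‖ * (N * ‖(orb γ w s).1‖ ^ (3 * j)) := by gcongr
    _ = N * (‖(orb γ w s).1.1 ^ 3‖ * ‖(orb γ w s).1‖ ^ (3 * j)) := by ring
    _ ≤ N * (4 * ‖w.1‖ ^ (3 * j) * ((‖w.1.1‖ ^ 3 / 4) * ((1 + s * (‖w.1.1‖ ^ 3 / 4))⁻¹) ^ (j + 1))) := by gcongr
    _ = _ := by ring

lemma Iop_int (hg : GS γ ρ) (hj : 0 < j) (ha : AnalyticOnNhd ℂ h (Ud ρ))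
    (hb : ∀ w ∈ Ud ρ, ‖h w‖ ≤ N * ‖w.1‖ ^ (3 * j)) (hN : 0 ≤ N) (hw : w ∈ Ud ρ) :
    IntegrableOn (fun s => (orb γ w s).1.1 ^ 3 • h (orb γ w s)) (Ioi 0) := by
  have h1 := ((base_int (Ud_pos hw) hj).1).const_mul (4 * N * ‖w.1‖ ^ (3 * j))
  refine Integrable.mono' h1 ?_ ?_
  · exact ((Iop_integrand_cont hg ha hw).mono Ioi_subset_Ici_self).aestronglyMeasurable measurableSet_Ioi
  · refine (ae_restrict_iff' measurableSet_Ioi).2 (Eventually.of_forall fun s hs => ?_)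
    exact Iop_pt hg hb hN hw (le_of_lt hs)

lemma Iop_bound (hg : GS γ ρ) (hj : 0 < j)
    (hb : ∀ w ∈ Ud ρ, ‖h w‖ ≤ N * ‖w.1‖ ^ (3 * j)) (hN : 0 ≤ N) (hw : w ∈ Ud ρ) :
    ‖Iop γ h w‖ ≤ 4 / j * N * ‖w.1‖ ^ (3 * j) := by
  obtain ⟨h1, h2⟩ := base_int (Ud_pos hw) hj
  rw [Iop, norm_neg]
  have := norm_integral_le_of_norm_le (h1.const_mul (4 * N * ‖w.1‖ ^ (3 * j)))
    ((ae_restrict_iff' measurableSet_Ioi).2 (Eventually.of_forall fun s hs => Iop_pt hg hb hN hw (le_of_lt hs)))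
  refine this.trans (le_of_eq ?_)
  rw [integral_const_mul, h2]; ring

lemma Iop_ana (hg : GS γ ρ) (hj : 0 < j) (ha : AnalyticOnNhd ℂ h (Ud ρ))
    (hb : ∀ w ∈ Ud ρ, ‖h w‖ ≤ N * ‖w.1‖ ^ (3 * j)) (hN : 0 ≤ N) :
    AnalyticOnNhd ℂ (Iop γ h) (Ud ρ) := by
  have key : AnalyticOnNhd ℂ (fun w => ∫ s in Ioi (0:ℝ), (orb γ w s).1.1 ^ 3 • h (orb γ w s)) (Ud ρ) := by
    refine int_analytic osg_C3 _ (Ud_open ρ) (fun s w => (orb γ w s).1.1 ^ 3 • h (orb γ w s)) ?_ ?_ ?_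
    · intro w hw
      exact (Iop_int hg hj ha hb hN hw).aestronglyMeasurable
    · refine (ae_restrict_iff' measurableSet_Ioi).2 (Eventually.of_forall fun s hs w hw => ?_)
      have hs : 0 ≤ s := le_of_lt hs
      have h1 := orb_ana hg hw hs
      have h2 : AnalyticAt ℂ (fun w => h (orb γ w s)) w :=
        AnalyticAt.comp (g := h) (ha _ (orb_mem hg hw hs)) h1
      have h3 : AnalyticAt ℂ (fun w => (orb γ w s).1.1 ^ 3) w :=
        AnalyticAt.comp (g := fun w : W3 => w.1.1 ^ 3) (by fun_prop) h1
      exact h3.smul h2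
    · intro w₀ hw₀
      set c₀ := ‖w₀.1.1‖ ^ 3 / 4 with hc₀
      have hpos : 0 < c₀ := Ud_pos hw₀
      have hbi := ((base_int (half_pos hpos) hj).1).const_mul (4 * N * ρ ^ (3 * j) * 4)
      have hcont : ContinuousAt (fun w : W3 => ‖w.1.1‖ ^ 3 / 4) w₀ := by fun_prop
      have hev : ∀ᶠ w : W3 in 𝓝 w₀, ‖w.1.1‖ ^ 3 / 4 ∈ Ioo (c₀ / 2) (2 * c₀) :=
        hcont.eventually (Ioo_mem_nhds (by show c₀ / 2 < c₀; linarith) (by show c₀ < 2 * c₀; linarith))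
      obtain ⟨ε, hε, hεb⟩ := Metric.eventually_nhds_iff_ball.1 hev
      refine ⟨_, hbi, ε, hε, ?_⟩
      refine (ae_restrict_iff' measurableSet_Ioi).2 (Eventually.of_forall fun s hs w hwb hw => ?_)
      have hs : 0 ≤ s := le_of_lt hs
      refine (Iop_pt hg hb hN hw hs).trans ?_
      obtain ⟨l1, l2⟩ := hεb w hwb
      have hρ := hw.1.le
      generalize ‖w.1.1‖ ^ 3 / 4 = c at l1 l2
      have hh : c₀ / 2 > 0 := half_pos hpos
      calc (4 * N * ‖w.1‖ ^ (3 * j)) * (c * ((1 + s * c)⁻¹) ^ (j + 1))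
          ≤ (4 * N * ρ ^ (3 * j)) * ((4 * (c₀ / 2)) * ((1 + s * (c₀ / 2))⁻¹) ^ (j + 1)) := by
            have : 0 < c := by linarith
            have hρ0 : 0 ≤ ρ := (norm_nonneg _).trans hρ
            gcongr
            linarith
        _ = _ := by ring
  exact key.neg

lemma Iop_per (hw : w ∈ Ud ρ) (hg : GS γ ρ) (hp : ∀ w ∈ Ud ρ, h (w.1, w.2 + tpi) = h w) :
    Iop γ h (w.1, w.2 + tpi) = Iop γ h w := by
  unfold Iop
  congr 1
  refine setIntegral_congr_fun measurableSet_Ioi fun s hs => ?_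
  have := hp _ (orb_mem hg hw (le_of_lt hs))
  simp only [orb] at *
  rw [add_right_comm, this]

lemma realV_integral' {f : ℝ → V5} {μ : Measure ℝ} (hi : Integrable f μ) (h : ∀ᵐ s ∂μ, RealV (f s)) : RealV (∫ s, f s ∂μ) := by
  rw [realV_iff, ← ContinuousLinearMap.integral_comp_comm _ hi]
  refine integral_eq_zero_of_ae ?_
  filter_upwards [h] with s hs
  exact realV_iff.1 hs

lemma Iop_real (hg : GS γ ρ) (hj : 0 < j) (ha : AnalyticOnNhd ℂ h (Ud ρ))
    (hb : ∀ w ∈ Ud ρ, ‖h w‖ ≤ N * ‖w.1‖ ^ (3 * j)) (hN : 0 ≤ N) (hr : ∀ w ∈ Ud ρ, RealW w → RealV (h w))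
    (hw : w ∈ Ud ρ) (hre : RealW w) : RealV (Iop γ h w) := by
  have : RealV (∫ s in Ioi (0:ℝ), (orb γ w s).1.1 ^ 3 • h (orb γ w s)) := by
    refine realV_integral' (Iop_int hg hj ha hb hN hw) ?_
    refine (ae_restrict_iff' measurableSet_Ioi).2 (Eventually.of_forall fun s hs => ?_)
    have hs : 0 ≤ s := le_of_lt hs
    have h1 := orb_real hg hw hs hre
    refine RealV.smul ?_ (hr _ (orb_mem hg hw hs) h1)
    rw [real_eq h1.1, ← Complex.ofReal_pow, Complex.ofReal_im]
  intro i
  have := this i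
  simp only [Iop, Pi.neg_apply, Complex.neg_im, this, neg_zero]

lemma Iop_sub {h' : W3 → V5} {N' : ℝ} (hg : GS γ ρ) (hj : 0 < j) (ha : AnalyticOnNhd ℂ h (Ud ρ))
    (hb : ∀ w ∈ Ud ρ, ‖h w‖ ≤ N * ‖w.1‖ ^ (3 * j)) (hN : 0 ≤ N) (ha' : AnalyticOnNhd ℂ h' (Ud ρ))
    (hb' : ∀ w ∈ Ud ρ, ‖h' w‖ ≤ N' * ‖w.1‖ ^ (3 * j)) (hN' : 0 ≤ N') (hw : w ∈ Ud ρ) :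
    Iop γ h w - Iop γ h' w = Iop γ (fun w => h w - h' w) w := by
  simp only [Iop, smul_sub]
  rw [integral_sub (Iop_int hg hj ha hb hN hw) (Iop_int hg hj ha' hb' hN' hw)]
  abel

/-- the transport equation at real points -/
lemma Iop_pde {η : W3 → V5} (hg : GS γ ρ) (hj : 0 < j) (ha : AnalyticOnNhd ℂ h (Ud ρ))
    (hb : ∀ w ∈ Ud ρ, ‖h w‖ ≤ N * ‖w.1‖ ^ (3 * j)) (hN : 0 ≤ N) (hη : AnalyticOnNhd ℂ η (Ud ρ))
    (he : ∀ w ∈ Ud ρ, Iop γ h w = η w) (hw : w ∈ Ud ρ) (hre : RealW w) :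
    fderiv ℂ η w (-((w.1.1 ^ 3 * (1/4 + γ w.1)) • w.1), 1) = w.1.1 ^ 3 • h w := by
  set f : ℝ → V5 := fun s => (orb γ w s).1.1 ^ 3 • h (orb γ w s) with hf
  have hIntOn : IntegrableOn f (Ioi 0) := Iop_int hg hj ha hb hN hw
  have hcont : ContinuousOn f (Ici 0) := Iop_integrand_cont hg ha hw
  have hfe : f 0 = w.1.1 ^ 3 • h w := by simp only [hf, orb_zero hg hw]
  have h1 : ∀ r ∈ Ici (0:ℝ), η (orb γ w r) = -(∫ s in Ioi (0:ℝ), f s) + ∫ s in (0:ℝ)..r, f s := by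
    intro r hr
    have hr : 0 ≤ r := hr
    rw [← he _ (orb_mem hg hw hr), Iop]
    have e1 : ∫ s in Ioi (0:ℝ), (orb γ (orb γ w r) s).1.1 ^ 3 • h (orb γ (orb γ w r) s) = ∫ s in Ioi (0:ℝ), f (r + s) := by
      refine setIntegral_congr_fun measurableSet_Ioi fun s hs => ?_
      simp only [hf, orb_semi hg hw hr (le_of_lt hs) hre]
    have e2 : ∫ s in Ioi (0:ℝ), f (r + s) = ∫ s in Ioi r, f s := by
      rw [← (measurePreserving_add_left volume r).setIntegral_preimage_emb (measurableEmbedding_addLeft r) f (Ioi r)]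
      simp
    have e3 := intervalIntegral.integral_interval_add_Ioi hIntOn (hIntOn.mono_set (Ioi_subset_Ioi hr))
    rw [e1, e2, ← e3]; abel
  have h2 : HasDerivWithinAt (fun r => ∫ s in (0:ℝ)..r, f s) (f 0) (Ici 0) 0 := by
    refine intervalIntegral.integral_hasDerivWithinAt_right (t := Ioi 0) (by simp) ?_ ?_
    · exact (hcont.mono Ioi_subset_Ici_self).stronglyMeasurableAtFilter_nhdsWithin measurableSet_Ioi 0
    · exact (hcont 0 self_mem_Ici).mono Ioi_subset_Ici_self
  have h3 : HasDerivWithinAt (fun r => η (orb γ w r)) (f 0) (Ici 0) 0 :=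
    (h2.const_add _).congr h1 (h1 0 self_mem_Ici)
  have h4 : HasDerivAt (fun r => η (orb γ w r)) (fderiv ℂ η w (-((w.1.1 ^ 3 * (1/4 + γ w.1)) • w.1), 1)) 0 := by
    have h5 := orb_deriv hg hw le_rfl
    have h6 : HasFDerivAt η (fderiv ℂ η w) (orb γ w 0) := by
      rw [orb_zero hg hw]; exact (hη w hw).differentiableAt.hasFDerivAt
    have h7 := (h6.restrictScalars ℝ).comp_hasDerivAt (0:ℝ) h5
    rw [orb_zero hg hw] at h7
    exact h7
  rw [← hfe]
  exact (uniqueDiffOn_Ici (0:ℝ) 0 self_mem_Ici).eq_deriv _ h4.hasDerivWithinAt h3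

end

end PartPE2

section PartPE3
open MeasureTheory
structure FG (δ : ℝ) (F : FT) : Prop where
  ana : ∀ x ξ t, ‖x‖ < δ → ‖ξ‖ < δ → |t.im| < δ →
    AnalyticAt ℂ (fun p : ((ℂ × ℂ) × V5) × ℂ => F p.1.1 p.1.2 p.2) ((x, ξ), t)
  per : ∀ x ξ t, ‖x‖ < δ → ‖ξ‖ < δ → |t.im| < δ → F x ξ (t + tpi) = F x ξ t
  real : ∀ x ξ t, ‖x‖ < δ → ‖ξ‖ < δ → |t.im| < δ → RealW (x, t) → RealV ξ → RealV (F x ξ t)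
  lip : ∀ x ξ ξ' t, ‖x‖ < δ → ‖ξ‖ < δ → ‖ξ'‖ < δ → |t.im| < δ →
    ‖F x ξ t - F x ξ' t‖ ≤ 2 * ‖ξ - ξ'‖

lemma FH.fg {r C : ℝ} {F : FT} (hr : 0 < r) (hC : 0 ≤ C) (h : FH r C F) {d : ℝ} (hd : 0 < d) :
    ∃ δ > 0, δ ≤ r ∧ δ ≤ d ∧ FG δ F := by
  have h0 : 0 < 1 / (3 * (C + 1)) := by positivity
  refine ⟨min (min r d) (1 / (3 * (C + 1))), by positivity, (min_le_left _ _).trans (min_le_left _ _),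
    (min_le_left _ _).trans (min_le_right _ _), ?_⟩
  have l1 : min (min r d) (1 / (3 * (C + 1))) ≤ r := (min_le_left _ _).trans (min_le_left _ _)
  have l2 := min_le_right (min r d) (1 / (3 * (C + 1)))
  constructor
  · intro x ξ t h1 h2 h3
    exact h.ana x ξ t (h1.trans_le l1) (h2.trans_le l1) (h3.trans_le l1)
  · intro x ξ t h1 h2 h3
    exact h.per x ξ t (h1.trans_le l1) (h2.trans_le l1) (h3.trans_le l1)
  · intro x ξ t h1 h2 h3
    exact h.real x ξ t (h1.trans_le l1) (h2.trans_le l1) (h3.trans_le l1)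
  · intro x ξ ξ' t h1 h2 h3 h4
    have h5 := h.lip x ξ ξ' t (h1.trans_le l1) (h2.trans_le l1) (h3.trans_le l1) (h4.trans_le l1)
    have h6 : C * (‖x‖ + ‖ξ‖ + ‖ξ'‖) ≤ 1 := by
      have : ‖x‖ + ‖ξ‖ + ‖ξ'‖ ≤ 1 / (C + 1) := by
        have e : 1 / (C + 1) = 3 * (1 / (3 * (C + 1))) := by field_simp
        rw [e]; linarith
      calc C * (‖x‖ + ‖ξ‖ + ‖ξ'‖) ≤ (C + 1) * (1 / (C + 1)) := by gcongr; linarith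
        _ = 1 := by field_simp
    have h7 := LamV_norm (ξ - ξ')
    have h8 : ‖F x ξ t - F x ξ' t‖ ≤ ‖F x ξ t - F x ξ' t - LamV (ξ - ξ')‖ + ‖LamV (ξ - ξ')‖ := by
      simpa using norm_add_le (F x ξ t - F x ξ' t - LamV (ξ - ξ')) (LamV (ξ - ξ'))
    have h9 : C * (‖x‖ + ‖ξ‖ + ‖ξ'‖) * ‖ξ - ξ'‖ ≤ 1 * ‖ξ - ξ'‖ := by gcongr
    linarith

/-- all quantities are fine on `Wd ρ` -/
structure Gd (γ : ℂ × ℂ → ℂ) (F : FT) (δ ρ M : ℝ) (P S : W3 → V5) : Prop where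
  fg : FG δ F
  gs : GS γ ρ
  ρ0 : 0 < ρ
  ρδ : ρ ≤ δ
  M0 : 0 < M
  Pa : ∀ w ∈ Wd ρ, AnalyticAt ℂ P w
  Ea : ∀ w ∈ Wd ρ, AnalyticAt ℂ (Eres γ F P S) w
  Pp : ∀ w ∈ Wd ρ, P (w.1, w.2 + tpi) = P w
  Ep : ∀ w ∈ Wd ρ, Eres γ F P S (w.1, w.2 + tpi) = Eres γ F P S w
  Pr : ∀ w ∈ Wd ρ, RealW w → RealV (P w)
  Er : ∀ w ∈ Wd ρ, RealW w → RealV (Eres γ F P S w)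
  Pd : ∀ w ∈ Wd ρ, HasDerivAt (fun t => P (w.1, t)) (w.1.1 ^ 3 • S w) w.2
  Eb : ∀ w ∈ Wd ρ, ‖Eres γ F P S w‖ ≤ M * ‖w.1‖ ^ (3 * 16)
  sm : ∀ w ∈ Wd ρ, ‖P w‖ + M * ‖w.1‖ ^ (3 * 16) < δ

lemma Ud_Wd {ρ : ℝ} {w : W3} (h : w ∈ Ud ρ) : w ∈ Wd ρ := ⟨h.1, h.2.2⟩

lemma exists_Gd {γ : ℂ × ℂ → ℂ} {F : FT} {δ r C : ℝ} {P S : W3 → V5} (hr : 0 < r) (hF : FH r C F)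
    (hγ : GH γ) (h : St γ F (3 * 16) P S) (hδ : 0 < δ) (hfg : FG δ F) :
    ∃ M, ∃ ρ₀ > 0, ∀ ρ, 0 < ρ → ρ ≤ ρ₀ → Gd γ F δ ρ M P S := by
  obtain ⟨ea, ep, er⟩ := Eres_props hr hF hγ h
  obtain ⟨M, hM, hE⟩ := wO_iff_ev.1 h.Eb
  have hsm : ∀ᶠ w in lW, ‖P w‖ + M * ‖w.1‖ ^ (3 * 16) < δ := by
    have h1 := wO_small one_le_two h.Pb (half_pos hδ)
    have h2 : Tendsto (fun w : W3 => M * ‖w.1‖ ^ (3 * 16)) lW (𝓝 0) := by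
      have := ((fst_tendsto.norm).pow (3 * 16)).const_mul M
      simpa using this
    filter_upwards [h1, h2.eventually (gt_mem_nhds (half_pos hδ))] with w a b
    exact (add_lt_add a b).trans_eq (add_halves δ)
  have hgs : ∀ᶠ w : W3 in lW, ‖γ w.1‖ < 1/100 := by
    have : Tendsto (fun w : W3 => ‖γ w.1‖) lW (𝓝 0) := by
      have h1 := (hγ.ana 0).continuousAt.tendsto
      have h0 : γ 0 = 0 := by simpa using hγ.hom 0 0
      rw [h0] at h1
      simpa using (h1.comp fst_tendsto).norm
    exact this.eventually (gt_mem_nhds (by norm_num))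
  have hall := (((h.Pa.and ea).and (h.Pp.and ep)).and ((h.Pr.and er).and (h.Pd.and hE))).and (hsm.and hgs)
  obtain ⟨ρ₀, hρ₀, hh⟩ := lW_iff.1 hall
  refine ⟨M, min ρ₀ δ, by positivity, fun ρ hρ hle => ?_⟩
  have sub : ∀ w ∈ Wd ρ, w ∈ Wd ρ₀ := fun w hw =>
    ⟨hw.1.trans_le (hle.trans (min_le_left _ _)), hw.2.trans_le (hle.trans (min_le_left _ _))⟩
  constructor
  · exact hfg
  · refine ⟨hγ, fun x hx => ?_⟩
    exact (hh (x, 0) (sub _ ⟨hx, by simpa using hρ⟩)).2.2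
  · exact hρ
  · exact hle.trans (min_le_right _ _)
  · exact hM
  · exact fun w hw => (hh w (sub w hw)).1.1.1.1
  · exact fun w hw => (hh w (sub w hw)).1.1.1.2
  · exact fun w hw => (hh w (sub w hw)).1.1.2.1
  · exact fun w hw => (hh w (sub w hw)).1.1.2.2
  · exact fun w hw => (hh w (sub w hw)).1.2.1.1
  · exact fun w hw => (hh w (sub w hw)).1.2.1.2
  · exact fun w hw => (hh w (sub w hw)).1.2.2.1
  · exact fun w hw => (hh w (sub w hw)).1.2.2.2
  · exact fun w hw => (hh w (sub w hw)).2.1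

def Hop (γ : ℂ × ℂ → ℂ) (F : FT) (P S η : W3 → V5) (w : W3) : V5 :=
  F w.1 (P w + η w) w.2 - F w.1 (P w) w.2 - Eres γ F P S w

def QQ (ρ : ℝ) (η : W3 → V5) : Prop :=
  (∀ w ∈ Ud ρ, η (w.1, w.2 + tpi) = η w) ∧ ∀ w ∈ Ud ρ, RealW w → RealV (η w)

section
variable {γ : ℂ × ℂ → ℂ} {F : FT} {δ ρ M : ℝ} {P S η : W3 → V5}

lemma Gd.sm1 (g : Gd γ F δ ρ M P S) (hη : ∀ w ∈ Ud ρ, ‖η w‖ ≤ M * ‖w.1‖ ^ (3 * 16)) {w : W3} (hw : w ∈ Ud ρ) :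
    ‖P w + η w‖ < δ := (norm_add_le _ _).trans_lt (by linarith [hη w hw, g.sm w (Ud_Wd hw)])

lemma Gd.sm0 (g : Gd γ F δ ρ M P S) {w : W3} (hw : w ∈ Wd ρ) : ‖P w‖ < δ := by
  have := g.sm w hw
  have h2 : 0 ≤ M * ‖w.1‖ ^ (3 * 16) := mul_nonneg g.M0.le (by positivity)
  linarith

lemma Gd.x (g : Gd γ F δ ρ M P S) {w : W3} (hw : w ∈ Wd ρ) : ‖w.1‖ < δ := hw.1.trans_le g.ρδ
lemma Gd.t (g : Gd γ F δ ρ M P S) {w : W3} (hw : w ∈ Wd ρ) : |w.2.im| < δ := hw.2.trans_le g.ρδ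

lemma FG.ana_comp (h : FG δ F) {ξ : W3 → V5} {w : W3} (hξ : AnalyticAt ℂ ξ w) (h1 : ‖w.1‖ < δ) (h2 : ‖ξ w‖ < δ)
    (h3 : |w.2.im| < δ) : AnalyticAt ℂ (fun w : W3 => F w.1 (ξ w) w.2) w := by
  have := h.ana w.1 (ξ w) w.2 h1 h2 h3
  exact AnalyticAt.comp (g := fun p : ((ℂ × ℂ) × V5) × ℂ => F p.1.1 p.1.2 p.2)
    (f := fun w : W3 => ((w.1, ξ w), w.2)) this ((analyticAt_fst.prod hξ).prod analyticAt_snd)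

lemma Hop_ana (g : Gd γ F δ ρ M P S) (ha : AnalyticOnNhd ℂ η (Ud ρ)) (hη : ∀ w ∈ Ud ρ, ‖η w‖ ≤ M * ‖w.1‖ ^ (3 * 16)) :
    AnalyticOnNhd ℂ (Hop γ F P S η) (Ud ρ) := by
  intro w hw
  have hw' := Ud_Wd hw
  have h1 : AnalyticAt ℂ (fun w : W3 => F w.1 (P w + η w) w.2) w :=
    g.fg.ana_comp (ξ := fun w => P w + η w) ((g.Pa w hw').add (ha w hw)) (g.x hw') (g.sm1 hη hw) (g.t hw')
  have h2 : AnalyticAt ℂ (fun w : W3 => F w.1 (P w) w.2) w :=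
    g.fg.ana_comp (ξ := P) (g.Pa w hw') (g.x hw') (g.sm0 hw') (g.t hw')
  exact (h1.sub h2).sub (g.Ea w hw')

lemma Hop_bound (g : Gd γ F δ ρ M P S) (hη : ∀ w ∈ Ud ρ, ‖η w‖ ≤ M * ‖w.1‖ ^ (3 * 16)) :
    ∀ w ∈ Ud ρ, ‖Hop γ F P S η w‖ ≤ (3 * M) * ‖w.1‖ ^ (3 * 16) := by
  intro w hw
  have hw' := Ud_Wd hw
  have h1 := g.fg.lip w.1 (P w + η w) (P w) w.2 (g.x hw') (g.sm1 hη hw) (g.sm0 hw') (g.t hw')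
  have h2 := g.Eb w hw'
  have h3 := hη w hw
  rw [add_sub_cancel_left] at h1
  refine (norm_sub_le _ _).trans ?_
  linarith

lemma Hop_per (g : Gd γ F δ ρ M P S) (hη : ∀ w ∈ Ud ρ, ‖η w‖ ≤ M * ‖w.1‖ ^ (3 * 16)) (hp : QQ ρ η) :
    ∀ w ∈ Ud ρ, Hop γ F P S η (w.1, w.2 + tpi) = Hop γ F P S η w := by
  intro w hw
  have hw' := Ud_Wd hw
  simp only [Hop, g.Ep w hw', g.Pp w hw', hp.1 w hw]
  rw [g.fg.per _ _ _ (g.x hw') (g.sm1 hη hw) (g.t hw'), g.fg.per _ _ _ (g.x hw') (g.sm0 hw') (g.t hw')]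

lemma Hop_real (g : Gd γ F δ ρ M P S) (hη : ∀ w ∈ Ud ρ, ‖η w‖ ≤ M * ‖w.1‖ ^ (3 * 16)) (hp : QQ ρ η) :
    ∀ w ∈ Ud ρ, RealW w → RealV (Hop γ F P S η w) := by
  intro w hw hr
  have hw' := Ud_Wd hw
  exact ((g.fg.real _ _ _ (g.x hw') (g.sm1 hη hw) (g.t hw') hr ((g.Pr w hw' hr).add (hp.2 w hw hr))).sub
    (g.fg.real _ _ _ (g.x hw') (g.sm0 hw') (g.t hw') hr (g.Pr w hw' hr))).sub (g.Er w hw' hr)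

lemma Gd.fix (g : Gd γ F δ ρ M P S) : ∃ η, (AnalyticOnNhd ℂ η (Ud ρ) ∧ (∀ w ∈ Ud ρ, ‖η w‖ ≤ M * ‖w.1‖ ^ (3 * 16)) ∧ QQ ρ η) ∧
    ∀ w ∈ Ud ρ, Iop γ (Hop γ F P S η) w = η w := by
  have h3M : 0 ≤ 3 * M := by linarith [g.M0]
  refine contr_analytic osg_C3 (Ud_open ρ) (fun w => ‖w.1‖ ^ (3 * 16)) ?_ ?_ M (1/2) ?_ ?_ ?_ (QQ ρ) ?_ ?_
    (fun η => Iop γ (Hop γ F P S η)) ?_ ?_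
  · intro w hw; positivity
  · intro w hw
    have : ContinuousAt (fun w : W3 => ‖w.1‖ ^ (3 * 16)) w := by fun_prop
    refine ⟨‖w.1‖ ^ (3 * 16) + 1, ?_⟩
    filter_upwards [this.eventually (gt_mem_nhds (lt_add_one _))] with a ha
    exact ha.le
  · exact g.M0.le
  · norm_num
  · norm_num
  · refine ⟨fun w _ => rfl, fun w _ _ i => by simp⟩
  · intro sq η hq hl
    refine ⟨fun w hw => ?_, fun w hw hr => ?_⟩
    · have hw2 : ((w.1, w.2 + tpi) : W3) ∈ Ud ρ := ⟨hw.1, hw.2.1, by simpa [tpi] using hw.2.2⟩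
      refine tendsto_nhds_unique (hl _ hw2) ?_
      simp only [fun n => (hq n).1 w hw]
      exact hl w hw
    · exact realV_lim (hl w hw) (Eventually.of_forall fun n => (hq n).2 w hw hr)
  · rintro η ⟨a, b, c⟩
    have ha := Hop_ana g a b
    have hb := Hop_bound g b
    refine ⟨Iop_ana g.gs (by norm_num) ha hb h3M, fun w hw => ?_, fun w hw => ?_, fun w hw hr => ?_⟩
    · refine (Iop_bound g.gs (by norm_num) hb h3M hw).trans ?_
      have := g.M0
      gcongr
      push_cast
      linarith
    · exact Iop_per hw g.gs (Hop_per g b c)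
    · exact Iop_real g.gs (by norm_num) ha hb h3M (Hop_real g b c) hw hr
  · rintro η η' c hc ⟨a, b, q⟩ ⟨a', b', q'⟩ hd w hw
    rw [Iop_sub g.gs (j := 16) (by norm_num) (Hop_ana g a b) (Hop_bound g b) h3M (Hop_ana g a' b') (Hop_bound g b') h3M hw]
    refine (Iop_bound (N := 2 * c) g.gs (j := 16) (by norm_num) ?_ (by positivity) hw).trans ?_
    · intro w hw
      have hw' := Ud_Wd hw
      have h1 := g.fg.lip w.1 (P w + η w) (P w + η' w) w.2 (g.x hw') (g.sm1 b hw) (g.sm1 b' hw) (g.t hw')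
      have h2 := hd w hw
      have e : Hop γ F P S η w - Hop γ F P S η' w = F w.1 (P w + η w) w.2 - F w.1 (P w + η' w) w.2 := by
        simp only [Hop]; abel
      rw [e]
      rw [add_sub_add_left_eq_sub] at h1
      linarith
    · apply le_of_eq; push_cast; ring

lemma P_line {P : W3 → V5} {w : W3} {c : ℂ} {S : V5} (ha : AnalyticAt ℂ P w) (hd : HasDerivAt (fun t => P (w.1, t)) S w.2) :
    fderiv ℂ P w (-(c • w.1), 1) = -(c • Eul P w) + S := by
  have h1 : HasDerivAt (fun t => P (w.1, t)) (fderiv ℂ P w (0, 1)) w.2 := by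
    have h2 : HasDerivAt (fun t : ℂ => ((w.1, t) : W3)) (0, 1) w.2 := (hasDerivAt_const _ _).prodMk (hasDerivAt_id _)
    exact HasFDerivAt.comp_hasDerivAt (l := P) (f := fun t : ℂ => ((w.1, t) : W3)) w.2 ha.differentiableAt.hasFDerivAt h2
  rw [hd.unique h1, Eul, ← map_smul, ← map_neg, ← map_add]
  simp

lemma Gd.P_pde (g : Gd γ F δ ρ M P S) {w : W3} (hw : w ∈ Wd ρ) :
    fderiv ℂ P w (-((w.1.1 ^ 3 * (1/4 + γ w.1)) • w.1), 1) = w.1.1 ^ 3 • (F w.1 (P w) w.2 + Eres γ F P S w) := by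
  rw [P_line (g.Pa w hw) (g.Pd w hw), Eres]
  module

lemma Gd.sol (g : Gd γ F δ ρ M P S) : ∃ η, (AnalyticOnNhd ℂ η (Ud ρ) ∧ (∀ w ∈ Ud ρ, ‖η w‖ ≤ M * ‖w.1‖ ^ (3 * 16)) ∧ QQ ρ η) ∧
    ∀ w ∈ Ud ρ, RealW w → fderiv ℂ (fun w => P w + η w) w (-((w.1.1 ^ 3 * (1/4 + γ w.1)) • w.1), 1) =
      w.1.1 ^ 3 • F w.1 (P w + η w) w.2 := by
  obtain ⟨η, ⟨a, b, c⟩, d⟩ := g.fix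
  refine ⟨η, ⟨a, b, c⟩, fun w hw hr => ?_⟩
  have h3M : 0 ≤ 3 * M := by linarith [g.M0]
  have h1 := Iop_pde g.gs (j := 16) (by norm_num) (Hop_ana g a b) (Hop_bound g b) h3M a d hw hr
  have h2 := g.P_pde (Ud_Wd hw)
  rw [fderiv_fun_add (g.Pa w (Ud_Wd hw)).differentiableAt (a w hw).differentiableAt, ContinuousLinearMap.add_apply, h1, h2, Hop]
  module
end

end PartPE3

section PartPE4
open MeasureTheory
section
variable {γ : ℂ × ℂ → ℂ} {F : FT} {δ ρ M : ℝ} {P S η : W3 → V5} {w : W3}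

lemma orb_est (hg : GS γ ρ) (hw : w ∈ Ud ρ) {φ φ' : ℝ → V5} {A B : ℝ} {i j : ℕ} (hi : 0 < i) (hj : 0 < j)
    (hd : ∀ s, 0 ≤ s → HasDerivAt φ (φ' s) s) (h0 : Tendsto φ atTop (𝓝 0)) (hA : 0 ≤ A) (hB : 0 ≤ B)
    (hb : ∀ s, 0 ≤ s → ‖φ' s‖ ≤ ‖(orb γ w s).1.1 ^ 3‖ * (A * ‖(orb γ w s).1‖ ^ (3 * i) + B * ‖(orb γ w s).1‖ ^ (3 * j))) :
    ‖φ 0‖ ≤ 4 / i * A * ‖w.1‖ ^ (3 * i) + 4 / j * B * ‖w.1‖ ^ (3 * j) := by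
  obtain ⟨i1, i2⟩ := base_int (Ud_pos hw) hi
  obtain ⟨j1, j2⟩ := base_int (Ud_pos hw) hj
  have hI := (i1.const_mul (4 * A * ‖w.1‖ ^ (3 * i))).add (j1.const_mul (4 * B * ‖w.1‖ ^ (3 * j)))
  have hle : ∀ s ∈ Ioi (0:ℝ), ‖φ' s‖ ≤ 
      (4 * A * ‖w.1‖ ^ (3 * i)) * ((‖w.1.1‖ ^ 3 / 4) * ((1 + s * (‖w.1.1‖ ^ 3 / 4))⁻¹) ^ (i + 1)) +
      (4 * B * ‖w.1‖ ^ (3 * j)) * ((‖w.1.1‖ ^ 3 / 4) * ((1 + s * (‖w.1.1‖ ^ 3 / 4))⁻¹) ^ (j + 1)) := by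
    intro s hs
    have hs : 0 ≤ s := le_of_lt hs
    have h1 := mul_le_mul_of_nonneg_left (orb_bound hg hw hs i) hA
    have h2 := mul_le_mul_of_nonneg_left (orb_bound hg hw hs j) hB
    refine (hb s hs).trans ?_
    linarith
  have hle' : ∀ᵐ s ∂(volume.restrict (Ioi (0:ℝ))), ‖φ' s‖ ≤ 
      (4 * A * ‖w.1‖ ^ (3 * i)) * ((‖w.1.1‖ ^ 3 / 4) * ((1 + s * (‖w.1.1‖ ^ 3 / 4))⁻¹) ^ (i + 1)) +
      (4 * B * ‖w.1‖ ^ (3 * j)) * ((‖w.1.1‖ ^ 3 / 4) * ((1 + s * (‖w.1.1‖ ^ 3 / 4))⁻¹) ^ (j + 1)) :=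
    (ae_restrict_iff' measurableSet_Ioi).2 (Eventually.of_forall hle)
  have hIntOn : IntegrableOn φ' (Ioi 0) := by
    refine Integrable.mono' hI ?_ hle'
    refine AEStronglyMeasurable.congr (f := deriv φ) (aestronglyMeasurable_deriv φ _) ?_
    refine (ae_restrict_iff' measurableSet_Ioi).2 (Eventually.of_forall fun s hs => ?_)
    exact (hd s (le_of_lt hs)).deriv
  have h1 := integral_Ioi_of_hasDerivAt_of_tendsto (hd 0 le_rfl).continuousAt.continuousWithinAt
    (fun s hs => hd s (le_of_lt hs)) hIntOn h0
  have h2 := norm_integral_le_of_norm_le hI hle'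
  rw [h1] at h2
  simp only [zero_sub, norm_neg] at h2
  refine h2.trans (le_of_eq ?_)
  simp only [Pi.add_apply]
  rw [integral_add (i1.const_mul _) (j1.const_mul _), integral_const_mul (4 * A * ‖w.1‖ ^ (3 * i)),
    integral_const_mul (4 * B * ‖w.1‖ ^ (3 * j)), i2, j2]
  ring

lemma orb_pow_tendsto (hg : GS γ ρ) (hw : w ∈ Ud ρ) : Tendsto (fun s => ‖(orb γ w s).1‖ ^ (3 * 16)) atTop (𝓝 0) := by
  have hc := Ud_pos hw
  have h1 : Tendsto (fun s : ℝ => (1 + s * ‖w.1.1‖ ^ 3 / 4)⁻¹) atTop (𝓝 0) := by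
    refine tendsto_inv_atTop_zero.comp ?_
    refine tendsto_atTop_add_const_left _ _ ?_
    simp only [mul_div_assoc]
    exact tendsto_id.atTop_mul_const hc
  have h2 := (h1.pow 16).mul_const (‖w.1‖ ^ (3 * 16))
  simp only [ne_eq, OfNat.ofNat_ne_zero, not_false_eq_true, zero_pow, zero_mul] at h2
  refine squeeze_zero' (Eventually.of_forall fun s => by positivity) ?_ h2
  filter_upwards [eventually_ge_atTop 0] with s hs
  have h3 := fk_norm hw.2.1 (hg.2 _ hw.1) hs
  simp only [orb]
  rw [fx_norm (γ := γ) (x := w.1) (s := s), mul_pow, pow_mul]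
  gcongr

lemma expand (g : Gd γ F δ ρ M P S) (ha : AnalyticOnNhd ℂ η (Ud ρ)) (hb : ∀ w ∈ Ud ρ, ‖η w‖ ≤ M * ‖w.1‖ ^ (3 * 16))
    (hs : ∀ w ∈ Ud ρ, RealW w → fderiv ℂ (fun w => P w + η w) w (-((w.1.1 ^ 3 * (1/4 + γ w.1)) • w.1), 1) =
      w.1.1 ^ 3 • F w.1 (P w + η w) w.2) {P' S' : W3 → V5} {j : ℕ} (hj : 16 ≤ j)
    (h' : St γ F (3 * j) P' S') (hd : wO (fun w => P' w - P w) (3 * 16)) :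
    ∃ C, ∃ ρ' > 0, ∀ w ∈ Ud ρ', RealW w → ‖P w + η w - P' w‖ ≤ C * ‖w.1‖ ^ (3 * j) := by
  have hδ : 0 < δ := g.ρ0.trans_le g.ρδ
  obtain ⟨N, hN, hE⟩ := wO_iff_ev.1 h'.Eb
  obtain ⟨A, hA, hD⟩ := wO_iff_ev.1 hd
  have hsm := wO_small one_le_two h'.Pb hδ
  obtain ⟨ρ₁, hρ₁, hh⟩ := lW_iff.1 ((hE.and hD).and (hsm.and (h'.Pa.and h'.Pd)))
  set ρ' := min ρ₁ ρ with hρ'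
  have sub1 : ∀ w ∈ Ud ρ', w ∈ Wd ρ₁ := fun w hw =>
    ⟨hw.1.trans_le (min_le_left _ _), hw.2.2.trans_le (min_le_left _ _)⟩
  have sub2 : ∀ w ∈ Ud ρ', w ∈ Ud ρ := fun w hw =>
    ⟨hw.1.trans_le (min_le_right _ _), hw.2.1, hw.2.2.trans_le (min_le_right _ _)⟩
  have hg' : GS γ ρ' := ⟨g.gs.1, fun x hx => g.gs.2 x (hx.trans_le (min_le_right _ _))⟩
  clear_value ρ'
  refine ⟨N, ρ', by rw [hρ']; exact lt_min hρ₁ g.ρ0, ?_⟩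
  obtain ⟨ζ, hζ⟩ : ∃ ζ : W3 → V5, ζ = fun w => P w + η w - P' w := ⟨_, rfl⟩
  have hζw : ∀ w, ζ w = P w + η w - P' w := fun w => by rw [hζ]
  -- derivative of ζ along the orbit
  have hder : ∀ w ∈ Ud ρ', RealW w → ∃ L : W3 →L[ℂ] V5, HasFDerivAt ζ L w ∧
      ‖L (-((w.1.1 ^ 3 * (1/4 + γ w.1)) • w.1), 1)‖ ≤ ‖w.1.1 ^ 3‖ * (2 * ‖ζ w‖ + N * ‖w.1‖ ^ (3 * j)) := by
    intro w hw hr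
    obtain ⟨⟨e1, e2⟩, e3, e4, e5⟩ := hh w (sub1 w hw)
    have hw2 := sub2 w hw
    have hw3 := Ud_Wd hw2
    have a1 : DifferentiableAt ℂ (fun w => P w + η w) w := ((g.Pa w hw3).add (ha w hw2)).differentiableAt
    refine ⟨fderiv ℂ (fun w => P w + η w) w - fderiv ℂ P' w, ?_, ?_⟩
    · rw [hζ]; exact a1.hasFDerivAt.sub e4.differentiableAt.hasFDerivAt
    · have b1 := hs w hw2 hr
      have b2 : fderiv ℂ P' w (-((w.1.1 ^ 3 * (1/4 + γ w.1)) • w.1), 1) =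
          w.1.1 ^ 3 • (F w.1 (P' w) w.2 + Eres γ F P' S' w) := by
        rw [P_line e4 e5, Eres]; module
      rw [sub_apply, b1, b2, ← smul_sub, norm_smul]
      gcongr
      have b3 := g.fg.lip w.1 (P w + η w) (P' w) w.2 (g.x hw3) (g.sm1 hb hw2) e3 (g.t hw3)
      rw [← sub_sub]
      refine (norm_sub_le _ _).trans ?_
      rw [hζw]
      exact add_le_add b3 e1
  have hstep : ∀ A, 0 ≤ A → (∀ w ∈ Ud ρ', RealW w → ‖ζ w‖ ≤ A * ‖w.1‖ ^ (3 * 16) + N * ‖w.1‖ ^ (3 * j)) →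
      (∀ w ∈ Ud ρ', RealW w → ‖ζ w‖ ≤ (A / 2) * ‖w.1‖ ^ (3 * 16) + N * ‖w.1‖ ^ (3 * j)) := by
    intro A hA hb w hw hr
    have hch : ∀ s, 0 ≤ s → ∃ v, HasDerivAt (fun s => ζ (orb γ w s)) v s ∧ ‖v‖ ≤
        ‖(orb γ w s).1.1 ^ 3‖ * (2 * A * ‖(orb γ w s).1‖ ^ (3 * 16) + 3 * N * ‖(orb γ w s).1‖ ^ (3 * j)) := by
      intro s hs
      have ho := orb_mem hg' hw hs
      have hor := orb_real hg' hw hs hr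
      obtain ⟨L, hL, hLb⟩ := hder _ ho hor
      refine ⟨_, (hL.restrictScalars ℝ).comp_hasDerivAt s (orb_deriv hg' hw hs), ?_⟩
      refine hLb.trans ?_
      refine mul_le_mul_of_nonneg_left ?_ (norm_nonneg _)
      have := hb _ ho hor
      generalize ‖(orb γ w s).1‖ ^ (3 * 16) = u at *
      linarith
    choose! φ' h1 h2 using hch
    have htend : Tendsto (fun s => ζ (orb γ w s)) atTop (𝓝 0) := by
      have t1 := orb_pow_tendsto hg' hw
      have t2 : Tendsto (fun s => ‖(orb γ w s).1‖ ^ (3 * 16) * (A + N * ρ' ^ (3 * (j - 16)))) atTop (𝓝 0) := by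
        simpa using t1.mul_const (A + N * ρ' ^ (3 * (j - 16)))
      refine squeeze_zero_norm' ?_ t2
      filter_upwards [eventually_ge_atTop 0] with s hs
      have ho := orb_mem hg' hw hs
      refine (hb _ ho (orb_real hg' hw hs hr)).trans ?_
      have : ‖(orb γ w s).1‖ ^ (3 * j) ≤ ‖(orb γ w s).1‖ ^ (3 * 16) * ρ' ^ (3 * (j - 16)) := by
        rw [show 3 * j = 3 * 16 + 3 * (j - 16) by omega, pow_add]
        have := ho.1.le
        gcongr
      nlinarith
    have key := orb_est hg' hw (by norm_num : 0 < 16) (by omega : 0 < j) h1 htend (by positivity) (by positivity) h2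
    simp only [orb_zero hg' hw] at key
    refine key.trans ?_
    have hj' : (16:ℝ) ≤ j := by exact_mod_cast hj
    have : 4 / (j:ℝ) ≤ 1 / 4 := by
      rw [div_le_div_iff₀ (by linarith) (by norm_num)]; linarith
    have h5 : 4 / (j:ℝ) * (3 * N) ≤ N := by nlinarith
    have h6 : 4 / ((16:ℕ):ℝ) * (2 * A) = A / 2 := by push_cast; ring
    rw [h6]
    gcongr
  have hit : ∀ n : ℕ, ∀ w ∈ Ud ρ', RealW w → ‖ζ w‖ ≤ ((A + M) / 2 ^ n) * ‖w.1‖ ^ (3 * 16) + N * ‖w.1‖ ^ (3 * j) := by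
    have hAM : 0 ≤ A + M := by linarith [g.M0]
    intro n
    induction n with
    | zero =>
      intro w hw hr
      have h1 := (hh w (sub1 w hw)).1.2
      have h2 := hb w (sub2 w hw)
      have e : ζ w = η w - (P' w - P w) := by rw [hζw]; abel
      rw [e]
      have h3 : 0 ≤ N * ‖w.1‖ ^ (3 * j) := by positivity
      refine (norm_sub_le _ _).trans ?_
      rw [pow_zero, div_one, add_mul]
      have := add_le_add h2 h1
      linarith
    | succ n ih =>
      have := hstep _ (by positivity) ih
      simpa [pow_succ, div_div] using this
  intro w hw hr
  have hl : Tendsto (fun n : ℕ => ((A + M) / 2 ^ n) * ‖w.1‖ ^ (3 * 16) + N * ‖w.1‖ ^ (3 * j)) atTop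
      (𝓝 (0 * ‖w.1‖ ^ (3 * 16) + N * ‖w.1‖ ^ (3 * j))) := by
    refine Tendsto.add_const _ (Tendsto.mul_const _ ?_)
    refine Tendsto.const_div_atTop ?_ _
    exact tendsto_pow_atTop_atTop_of_one_lt (by norm_num)
  rw [zero_mul, zero_add] at hl
  rw [← hζw]
  exact ge_of_tendsto' hl fun n => hit n w hw hr
end

/-- summary of the complex existence result -/
theorem complex_main {r C : ℝ} {F0 : FT} (hr : 0 < r) (hC : 0 ≤ C) (hF : FH r C F0) :
    ∃ γ, GH γ ∧ ∃ δ > 0, δ ≤ r ∧ ∃ ρ > 0, ρ ≤ δ ∧ (∀ x, ‖x‖ < ρ → ‖γ x‖ < 1/100) ∧ ∃ ξ : W3 → V5,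
      AnalyticOnNhd ℂ ξ (Ud ρ) ∧ (∀ w ∈ Ud ρ, ‖ξ w‖ < δ) ∧ (∃ B, ∀ w ∈ Ud ρ, ‖ξ w‖ ≤ B * ‖w.1‖ ^ 2) ∧ QQ ρ ξ ∧
      (∀ w ∈ Ud ρ, RealW w → fderiv ℂ ξ w (-((w.1.1 ^ 3 * (1/4 + γ w.1)) • w.1), 1) =
        w.1.1 ^ 3 • Fg γ F0 w.1 (ξ w) w.2) ∧
      ∀ ℓ : ℕ, ∃ P : W3 → V5, (∀ᶠ w in lW, AnalyticAt ℂ P w) ∧ (∀ᶠ w in lW, P (w.1, w.2 + tpi) = P w) ∧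
        (∀ᶠ w in lW, RealW w → RealV (P w)) ∧ wO P 2 ∧
        ∃ B, ∃ ρ' > 0, ∀ w ∈ Ud ρ', RealW w → ‖ξ w - P w‖ ≤ B * ‖w.1‖ ^ (ℓ + 1) := by
  obtain ⟨γ, hγ, hk⟩ := formal hr hC hF
  obtain ⟨r', hr', C', hC', hF'⟩ := FH_gam hr hC hF hγ
  obtain ⟨δ, hδ, -, hδr, hfg⟩ := hF'.fg hr' hC' hr
  obtain ⟨P, S, hS, hexp⟩ := hk (3 * 16) (by norm_num)
  obtain ⟨M, ρ₀, hρ₀, hgd⟩ := exists_Gd hr' hF' hγ hS hδ hfg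
  obtain ⟨B, hB, hBP⟩ := wO_iff_ev.1 hS.Pb
  obtain ⟨ρ₁, hρ₁, hBP⟩ := lW_iff.1 hBP
  have g := hgd (min (min ρ₀ ρ₁) 1) (by positivity) ((min_le_left _ _).trans (min_le_left _ _))
  set ρ := min (min ρ₀ ρ₁) 1 with hρ
  have l1 : ρ ≤ ρ₁ := (min_le_left _ _).trans (min_le_right _ _)
  have l2 : ρ ≤ 1 := min_le_right _ _
  clear_value ρ
  obtain ⟨η, ⟨a, b, c⟩, d⟩ := g.sol
  refine ⟨γ, hγ, δ, hδ, hδr, ρ, g.ρ0, g.ρδ, g.gs.2, fun w => P w + η w, fun w hw => (g.Pa w (Ud_Wd hw)).add (a w hw),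
    fun w hw => g.sm1 b hw, ⟨B + M, fun w hw => ?_⟩, ⟨fun w hw => ?_, fun w hw hr => ?_⟩, d, fun ℓ => ?_⟩
  · have h1 := hBP w ⟨hw.1.trans_le l1, hw.2.2.trans_le l1⟩
    have h2 := b w hw
    have h3 : ‖w.1‖ ^ (3 * 16) ≤ ‖w.1‖ ^ 2 := pow_le_pow_of_le_one (norm_nonneg _) (hw.1.le.trans l2) (by norm_num)
    have h4 := mul_le_mul_of_nonneg_left h3 g.M0.le
    refine (norm_add_le _ _).trans ?_
    rw [add_mul]
    exact add_le_add h1 (h2.trans h4)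
  · simp only [g.Pp w (Ud_Wd hw), c.1 w hw]
  · exact (g.Pr w (Ud_Wd hw) hr).add (c.2 w hw hr)
  · obtain ⟨P', S', h', hd⟩ := hexp (3 * (ℓ + 16)) (by omega)
    obtain ⟨N, ρ', hρ', hh⟩ := expand g a b d (by omega) h' hd
    refine ⟨P', h'.Pa, h'.Pp, h'.Pr, h'.Pb, |N|, min ρ' 1, by positivity, fun w hw hr => ?_⟩
    have hw' : w ∈ Ud ρ' := ⟨hw.1.trans_le (min_le_left _ _), hw.2.1, hw.2.2.trans_le (min_le_left _ _)⟩
    have h3 : ‖w.1‖ ^ (3 * (ℓ + 16)) ≤ ‖w.1‖ ^ (ℓ + 1) :=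
      pow_le_pow_of_le_one (norm_nonneg _) (hw.1.le.trans (min_le_right _ _)) (by omega)
    refine (hh w hw' hr).trans ?_
    exact mul_le_mul (le_abs_self _) h3 (by positivity) (abs_nonneg _)

end PartPE4

section PartPF1
open MeasureTheory
abbrev FS := (ℂ × ℂ) → V5 → ℂ → ℂ

/-- domain of the scalar symbols -/
def Dm (r : ℝ) (x : ℂ × ℂ) (ξ : V5) (t : ℂ) : Prop := ‖x‖ < r ∧ ‖ξ‖ < r ∧ |t.im| < r

structure LC (r C : ℝ) (c : ℂ) (l : ℂ × ℂ →L[ℂ] ℂ) (L : V5 →L[ℂ] ℂ) (f : FS) : Prop where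
  C0 : 0 ≤ C
  ana : ∀ x ξ t, Dm r x ξ t → AnalyticAt ℂ (fun p : ((ℂ × ℂ) × V5) × ℂ => f p.1.1 p.1.2 p.2) ((x, ξ), t)
  per : ∀ x ξ t, Dm r x ξ t → f x ξ (t + tpi) = f x ξ t
  real : ∀ x ξ t, Dm r x ξ t → RealW (x, t) → RealV ξ → (f x ξ t).im = 0
  zero : ∀ x t, ‖x‖ < r → |t.im| < r → ‖f x 0 t - c - l x‖ ≤ C * ‖x‖ ^ 2
  b0 : ∀ x ξ t, Dm r x ξ t → ‖f x ξ t - c‖ ≤ C * (‖x‖ + ‖ξ‖)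
  lip : ∀ x ξ ξ' t, Dm r x ξ t → Dm r x ξ' t →
    ‖f x ξ t - f x ξ' t - L (ξ - ξ')‖ ≤ C * (‖x‖ + ‖ξ‖ + ‖ξ'‖) * ‖ξ - ξ'‖

def LB (r : ℝ) (c : ℂ) (l : ℂ × ℂ →L[ℂ] ℂ) (L : V5 →L[ℂ] ℂ) (f : FS) : Prop := ∃ C, LC r C c l L f

section
variable {r : ℝ} {c c' : ℂ} {l l' : ℂ × ℂ →L[ℂ] ℂ} {L L' : V5 →L[ℂ] ℂ} {f g : FS}

lemma LB.add (hf : LB r c l L f) (hg : LB r c' l' L' g) :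
    LB r (c + c') (l + l') (L + L') (fun x ξ t => f x ξ t + g x ξ t) := by
  obtain ⟨A, hf⟩ := hf
  obtain ⟨B, hg⟩ := hg
  refine ⟨A + B, add_nonneg hf.C0 hg.C0, fun x ξ t h => (hf.ana x ξ t h).add (hg.ana x ξ t h), fun x ξ t h => by
    rw [hf.per x ξ t h, hg.per x ξ t h], fun x ξ t h h1 h2 => by
    rw [Complex.add_im, hf.real x ξ t h h1 h2, hg.real x ξ t h h1 h2, add_zero], fun x t h1 h2 => ?_,
    fun x ξ t h => ?_, fun x ξ ξ' t h h' => ?_⟩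
  · have a := hf.zero x t h1 h2
    have b := hg.zero x t h1 h2
    have := norm_add_le (f x 0 t - c - l x) (g x 0 t - c' - l' x)
    rw [show f x 0 t + g x 0 t - (c + c') - (l + l') x = f x 0 t - c - l x + (g x 0 t - c' - l' x) by
      simp only [add_apply]; ring, add_mul]
    linarith
  · have a := hf.b0 x ξ t h
    have b := hg.b0 x ξ t h
    have := norm_add_le (f x ξ t - c) (g x ξ t - c')
    rw [show f x ξ t + g x ξ t - (c + c') = f x ξ t - c + (g x ξ t - c') by ring, add_mul]
    linarith
  · have a := hf.lip x ξ ξ' t h h'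
    have b := hg.lip x ξ ξ' t h h'
    have := norm_add_le (f x ξ t - f x ξ' t - L (ξ - ξ')) (g x ξ t - g x ξ' t - L' (ξ - ξ'))
    rw [show f x ξ t + g x ξ t - (f x ξ' t + g x ξ' t) - (L + L') (ξ - ξ') =
      f x ξ t - f x ξ' t - L (ξ - ξ') + (g x ξ t - g x ξ' t - L' (ξ - ξ')) by
      simp only [add_apply]; ring, add_mul, add_mul]
    linarith

lemma LB.mul (hr : r ≤ 1) (hf : LB r c l L f) (hg : LB r c' l' L' g) :
    LB r (c * c') (c • l' + c' • l) (c • L' + c' • L) (fun x ξ t => f x ξ t * g x ξ t) := by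
  obtain ⟨A, hf⟩ := hf
  obtain ⟨B, hg⟩ := hg
  have hA := hf.C0
  have hB := hg.C0
  have dm : ∀ x ξ t, Dm r x ξ t → ‖f x ξ t‖ ≤ ‖c‖ + 2 * A ∧ ‖g x ξ t‖ ≤ ‖c'‖ + 2 * B := by
    intro x ξ t h
    have a := hf.b0 x ξ t h
    have b := hg.b0 x ξ t h
    have h1 : ‖x‖ + ‖ξ‖ ≤ 2 := by linarith [h.1, h.2.1]
    have a1 : A * (‖x‖ + ‖ξ‖) ≤ A * 2 := by gcongr
    have b1 : B * (‖x‖ + ‖ξ‖) ≤ B * 2 := by gcongr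
    have a2 := norm_add_le (f x ξ t - c) c
    have b2 := norm_add_le (g x ξ t - c') c'
    rw [sub_add_cancel] at a2 b2
    exact ⟨by linarith, by linarith⟩
  obtain ⟨C, hC⟩ : ∃ C, C = (A * (‖c'‖ + 2 * B) + (‖c‖ + 2 * A) * B + ‖L‖ * B + A * ‖L'‖) + (‖l‖ * (B + ‖l'‖) + ‖c‖ * B + A * ‖c'‖ + A * B + A * ‖l'‖)
      + (‖c‖ * B + A * ‖c'‖ + 2 * A * B) := ⟨_, rfl⟩
  have n1 := norm_nonneg c
  have n2 := norm_nonneg c'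
  refine ⟨C, by rw [hC]; positivity, fun x ξ t h => (hf.ana x ξ t h).mul (hg.ana x ξ t h), fun x ξ t h => by
    rw [hf.per x ξ t h, hg.per x ξ t h], fun x ξ t h h1 h2 => by
    rw [Complex.mul_im, hf.real x ξ t h h1 h2, hg.real x ξ t h h1 h2]; simp, fun x t h1 h2 => ?_,
    fun x ξ t h => ?_, fun x ξ ξ' t h h' => ?_⟩
  · have a := hf.zero x t h1 h2
    have b := hg.zero x t h1 h2
    have n0 := norm_nonneg x
    have x1 : ‖x‖ ≤ 1 := by linarith
    have x2 : ‖x‖ ^ 2 ≤ 1 := by nlinarith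
    have hl := l.le_opNorm x
    have hl' := l'.le_opNorm x
    obtain ⟨u, hu⟩ : ∃ u, u = f x 0 t - c - l x := ⟨_, rfl⟩
    obtain ⟨v, hv⟩ : ∃ v, v = g x 0 t - c' - l' x := ⟨_, rfl⟩
    rw [← hu] at a
    rw [← hv] at b
    have e : f x 0 t * g x 0 t - c * c' - (c • l' + c' • l) x = c * v + u * c' + u * v + u * l' x + l x * v + l x * l' x := by
      rw [hu, hv]; simp only [add_apply, smul_apply, smul_eq_mul]; ring
    rw [e]
    have t1 : ‖c * v‖ ≤ ‖c‖ * (B * ‖x‖ ^ 2) := by rw [norm_mul]; gcongr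
    have t2 : ‖u * c'‖ ≤ (A * ‖x‖ ^ 2) * ‖c'‖ := by rw [norm_mul]; gcongr
    have t3 : ‖u * v‖ ≤ (A * ‖x‖ ^ 2) * (B * 1) := by
      rw [norm_mul]; refine mul_le_mul a (b.trans (by gcongr)) (norm_nonneg _) (by positivity)
    have t4 : ‖u * l' x‖ ≤ (A * ‖x‖ ^ 2) * (‖l'‖ * 1) := by
      rw [norm_mul]; refine mul_le_mul a (hl'.trans (by gcongr)) (norm_nonneg _) (by positivity)
    have t5 : ‖l x * v‖ ≤ (‖l‖ * 1) * (B * ‖x‖ ^ 2) := by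
      rw [norm_mul]; refine mul_le_mul (hl.trans (by gcongr)) b (norm_nonneg _) (by positivity)
    have t6 : ‖l x * l' x‖ ≤ (‖l‖ * ‖x‖) * (‖l'‖ * ‖x‖) := by
      rw [norm_mul]; refine mul_le_mul hl hl' (norm_nonneg _) (by positivity)
    have s1 := norm_add_le (c * v + u * c' + u * v + u * l' x + l x * v) (l x * l' x)
    have s2 := norm_add_le (c * v + u * c' + u * v + u * l' x) (l x * v)
    have s3 := norm_add_le (c * v + u * c' + u * v) (u * l' x)
    have s4 := norm_add_le (c * v + u * c') (u * v)
    have s5 := norm_add_le (c * v) (u * c')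
    have p : 0 ≤ ((A * (‖c'‖ + 2 * B) + (‖c‖ + 2 * A) * B + ‖L‖ * B + A * ‖L'‖)
      + (‖c‖ * B + A * ‖c'‖ + 2 * A * B)) * ‖x‖ ^ 2 := by positivity
    rw [hC]
    linarith
  · have a := hf.b0 x ξ t h
    have b := hg.b0 x ξ t h
    have h1 : ‖x‖ + ‖ξ‖ ≤ 2 := by linarith [h.1, h.2.1]
    have e : f x ξ t * g x ξ t - c * c' = c * (g x ξ t - c') + (f x ξ t - c) * c' + (f x ξ t - c) * (g x ξ t - c') := by ring
    rw [e]
    have n0 : 0 ≤ ‖x‖ + ‖ξ‖ := by positivity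
    generalize ‖x‖ + ‖ξ‖ = n at *
    have t1 : ‖c * (g x ξ t - c')‖ ≤ ‖c‖ * (B * n) := by rw [norm_mul]; gcongr
    have t2 : ‖(f x ξ t - c) * c'‖ ≤ (A * n) * ‖c'‖ := by rw [norm_mul]; gcongr
    have t3 : ‖(f x ξ t - c) * (g x ξ t - c')‖ ≤ (A * n) * (B * 2) := by
      rw [norm_mul]; refine mul_le_mul a (b.trans (by gcongr)) (norm_nonneg _) (by positivity)
    have s1 := norm_add_le (c * (g x ξ t - c') + (f x ξ t - c) * c') ((f x ξ t - c) * (g x ξ t - c'))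
    have s2 := norm_add_le (c * (g x ξ t - c')) ((f x ξ t - c) * c')
    have p : 0 ≤ ((A * (‖c'‖ + 2 * B) + (‖c‖ + 2 * A) * B + ‖L‖ * B + A * ‖L'‖) + 
       (‖l‖ * (B + ‖l'‖) + ‖c‖ * B + A * ‖c'‖ + A * B + A * ‖l'‖)) * n := by positivity
    rw [hC]
    linarith
  · have a := hf.lip x ξ ξ' t h h'
    have b := hg.lip x ξ ξ' t h h'
    have a0 := hf.b0 x ξ' t h'
    have b0 := hg.b0 x ξ t h
    have a1 := (dm x ξ' t h').1
    have b1 := (dm x ξ t h).2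
    have hL := L.le_opNorm (ξ - ξ')
    have hL' := L'.le_opNorm (ξ - ξ')
    have e : f x ξ t * g x ξ t - f x ξ' t * g x ξ' t - (c • L' + c' • L) (ξ - ξ') =
      (f x ξ t - f x ξ' t - L (ξ - ξ')) * g x ξ t + f x ξ' t * (g x ξ t - g x ξ' t - L' (ξ - ξ')) +
        L (ξ - ξ') * (g x ξ t - c') + (f x ξ' t - c) * L' (ξ - ξ') := by
      simp only [add_apply, smul_apply, smul_eq_mul]; ring
    rw [e]
    have m1 : ‖x‖ + ‖ξ‖ ≤ ‖x‖ + ‖ξ‖ + ‖ξ'‖ := by linarith [norm_nonneg ξ']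
    have m2 : ‖x‖ + ‖ξ'‖ ≤ ‖x‖ + ‖ξ‖ + ‖ξ'‖ := by linarith [norm_nonneg ξ]
    have a0 : ‖f x ξ' t - c‖ ≤ A * (‖x‖ + ‖ξ‖ + ‖ξ'‖) := a0.trans (by gcongr)
    have b0 : ‖g x ξ t - c'‖ ≤ B * (‖x‖ + ‖ξ‖ + ‖ξ'‖) := b0.trans (by gcongr)
    have n0 : 0 ≤ ‖x‖ + ‖ξ‖ + ‖ξ'‖ := by positivity
    have d0 := norm_nonneg (ξ - ξ')
    generalize ‖x‖ + ‖ξ‖ + ‖ξ'‖ = n at *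
    generalize ‖ξ - ξ'‖ = d at *
    generalize hLx : L (ξ - ξ') = Lx at *
    generalize hLx' : L' (ξ - ξ') = Lx' at *
    have t1 : ‖(f x ξ t - f x ξ' t - Lx) * g x ξ t‖ ≤ (A * n * d) * (‖c'‖ + 2 * B) := by
      rw [norm_mul]; refine mul_le_mul a b1 (norm_nonneg _) (by positivity)
    have t2 : ‖f x ξ' t * (g x ξ t - g x ξ' t - Lx')‖ ≤ (‖c‖ + 2 * A) * (B * n * d) := by
      rw [norm_mul]; refine mul_le_mul a1 b (norm_nonneg _) (by positivity)
    have t3 : ‖Lx * (g x ξ t - c')‖ ≤ (‖L‖ * d) * (B * n) := by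
      rw [norm_mul]; refine mul_le_mul hL b0 (norm_nonneg _) (by positivity)
    have t4 : ‖(f x ξ' t - c) * Lx'‖ ≤ (A * n) * (‖L'‖ * d) := by
      rw [norm_mul]; refine mul_le_mul a0 hL' (norm_nonneg _) (by positivity)
    have s1 := norm_add_le ((f x ξ t - f x ξ' t - Lx) * g x ξ t + f x ξ' t * (g x ξ t - g x ξ' t - Lx') +
        Lx * (g x ξ t - c')) ((f x ξ' t - c) * Lx')
    have s2 := norm_add_le ((f x ξ t - f x ξ' t - Lx) * g x ξ t + f x ξ' t * (g x ξ t - g x ξ' t - Lx')) (Lx * (g x ξ t - c'))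
    have s3 := norm_add_le ((f x ξ t - f x ξ' t - Lx) * g x ξ t) (f x ξ' t * (g x ξ t - g x ξ' t - Lx'))
    have p : 0 ≤ ((‖l‖ * (B + ‖l'‖) + ‖c‖ * B + A * ‖c'‖ + A * B + A * ‖l'‖)
      + (‖c‖ * B + A * ‖c'‖ + 2 * A * B)) * n * d := by positivity
    rw [hC]
    linarith

lemma LB_const (c : ℂ) (hc : c.im = 0) : LB r c 0 0 (fun _ _ _ => c) := by
  refine ⟨0, le_rfl, fun x ξ t h => analyticAt_const, fun _ _ _ _ => rfl, fun _ _ _ _ _ _ => hc, fun x t _ _ => by simp,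
    fun x ξ t h => by simp, fun x ξ ξ' t h h' => by simp⟩

lemma LB_b : LB r 0 (ContinuousLinearMap.snd ℂ ℂ ℂ) 0 (fun x _ _ => x.2) := by
  refine ⟨1, zero_le_one, fun x ξ t h => by fun_prop, fun _ _ _ _ => rfl, fun _ _ _ _ h _ => h.2.1, fun x t _ _ => by simp,
    fun x ξ t h => ?_, fun x ξ ξ' t h h' => by simp; positivity⟩
  have := norm_snd_le x
  have := norm_nonneg ξ
  rw [sub_zero]; linarith

lemma LB_xi (i : Fin 5) : LB r 0 0 (ContinuousLinearMap.proj i) (fun _ ξ _ => ξ i) := by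
  refine ⟨1, zero_le_one, fun x ξ t h => ?_, fun _ _ _ _ => rfl, fun _ _ _ _ _ h => h i, fun x t _ _ => by simp,
    fun x ξ t h => ?_, fun x ξ ξ' t h h' => by simp; positivity⟩
  · exact ((ContinuousLinearMap.proj (R := ℂ) (φ := fun _ : Fin 5 => ℂ) i).analyticAt _).comp
      (f := fun p : ((ℂ × ℂ) × V5) × ℂ => p.1.2) (by fun_prop)
  · have := norm_le_pi_norm ξ i
    have := norm_nonneg x
    rw [sub_zero]; linarith

end

end PartPF1

section PartPF2
open MeasureTheory
def xi1 (ξ : V5) : ℂ := ξ 0 - (3/5) * ξ 1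
def Zarg (x : ℂ × ℂ) (ξ : V5) (t : ℂ) : Fin 7 → ℂ := ![x.1 * (1 + xi1 ξ), x.2 + ξ 2, x.1 * ξ 1, ξ 3, ξ 4, 0, t]

/-- properties of a complexified remainder -/
structure RH (r C : ℝ) (R : (Fin 7 → ℂ) → ℂ) : Prop where
  ana : AnalyticOnNhd ℂ R (cDom r)
  per : ∀ z ∈ cDom r, R (z + Pi.single 6 tpi) = R z
  real : ∀ z ∈ cDom r, (∀ i, (z i).im = 0) → (R z).im = 0
  bd : ∀ z ∈ cDom r, ‖R z‖ ≤ C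

lemma RH.mono {r r' C C' : ℝ} {R : (Fin 7 → ℂ) → ℂ} (h : RH r C R) (hr : r' ≤ r) (hC : C ≤ C') : RH r' C' R := by
  have sub : ∀ z ∈ cDom r', z ∈ cDom r := fun z hz => ⟨fun i hi => (hz.1 i hi).trans_le hr, hz.2.trans_le hr⟩
  exact ⟨fun z hz => h.ana z (sub z hz), fun z hz => h.per z (sub z hz), fun z hz => h.real z (sub z hz),
    fun z hz => (h.bd z (sub z hz)).trans hC⟩

lemma xi1_norm (ξ : V5) : ‖xi1 ξ‖ ≤ 2 * ‖ξ‖ := by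
  have h0 := norm_le_pi_norm ξ 0
  have h1 := norm_le_pi_norm ξ 1
  have h2 := norm_sub_le (ξ 0) ((3/5) * ξ 1)
  rw [norm_mul] at h2
  have : ‖(3/5 : ℂ)‖ = 3/5 := by norm_num
  rw [this] at h2
  unfold xi1
  linarith [norm_nonneg (ξ 1)]

lemma xi1_sub (ξ ξ' : V5) : xi1 ξ - xi1 ξ' = xi1 (ξ - ξ') := by simp [xi1]; ring

lemma Zarg_mem {r : ℝ} (hr : 0 < r) (hr1 : r ≤ 1) {x : ℂ × ℂ} {ξ : V5} {t : ℂ} (h : Dm r x ξ t) :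
    Zarg x ξ t ∈ cDom (4 * r) := by
  obtain ⟨h1, h2, h3⟩ := h
  have hi : ∀ i, ‖ξ i‖ < r := fun i => (norm_le_pi_norm ξ i).trans_lt h2
  have ha : ‖x.1‖ < r := (norm_fst_le x).trans_lt h1
  have hb : ‖x.2‖ < r := (norm_snd_le x).trans_lt h1
  have hx := xi1_norm ξ
  have e1 : ‖x.1 * (1 + xi1 ξ)‖ < 4 * r := by
    rw [norm_mul]
    have := norm_add_le 1 (xi1 ξ)
    rw [norm_one] at this
    nlinarith [norm_nonneg x.1]
  have e2 : ‖x.2 + ξ 2‖ < 4 * r := (norm_add_le _ _).trans_lt (by linarith [hi 2])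
  have e3 : ‖x.1 * ξ 1‖ < 4 * r := by
    rw [norm_mul]; nlinarith [hi 1, norm_nonneg x.1, norm_nonneg (ξ 1)]
  have h3i := hi 3
  have h4i := hi 4
  refine ⟨fun i hne => ?_, ?_⟩
  · fin_cases i
    · exact e1
    · exact e2
    · exact e3
    · show ‖ξ 3‖ < 4 * r
      linarith
    · show ‖ξ 4‖ < 4 * r
      linarith
    · show ‖(0:ℂ)‖ < 4 * r
      simpa using hr
    · exact absurd rfl hne
  · show |t.im| < 4 * r
    linarith

lemma Zarg_ana (p : ((ℂ × ℂ) × V5) × ℂ) : AnalyticAt ℂ (fun p : ((ℂ × ℂ) × V5) × ℂ => Zarg p.1.1 p.1.2 p.2) p := by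
  have hx : AnalyticAt ℂ (fun p : ((ℂ × ℂ) × V5) × ℂ => p.1.1.2) p := by fun_prop
  have ha : AnalyticAt ℂ (fun p : ((ℂ × ℂ) × V5) × ℂ => p.1.1.1) p := by fun_prop
  have ht : AnalyticAt ℂ (fun p : ((ℂ × ℂ) × V5) × ℂ => p.2) p := by fun_prop
  have hi : ∀ i, AnalyticAt ℂ (fun p : ((ℂ × ℂ) × V5) × ℂ => p.1.2 i) p := by
    intro i
    exact ((ContinuousLinearMap.proj (R := ℂ) (φ := fun _ : Fin 5 => ℂ) i).analyticAt _).comp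
      (f := fun p : ((ℂ × ℂ) × V5) × ℂ => p.1.2) (by fun_prop)
  rw [analyticAt_pi_iff]
  intro i
  fin_cases i
  · exact ha.mul (analyticAt_const.add ((hi 0).sub (analyticAt_const.mul (hi 1))))
  · exact hx.add (hi 2)
  · exact ha.mul (hi 1)
  · exact hi 3
  · exact hi 4
  · exact analyticAt_const
  · exact ht

lemma Zarg_real {x : ℂ × ℂ} {ξ : V5} {t : ℂ} (h : RealW (x, t)) (hξ : RealV ξ) (i : Fin 7) : (Zarg x ξ t i).im = 0 := by
  obtain ⟨h1, h2, h3⟩ := h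
  have hx : (xi1 ξ).im = 0 := by
    have : (3/5 : ℂ) = ((3/5 : ℝ) : ℂ) := by push_cast; rfl
    simp [xi1, this, hξ 0, hξ 1, Complex.mul_im, -Complex.ofReal_div]
  simp only at h1 h2 h3
  fin_cases i
  · show (x.1 * (1 + xi1 ξ)).im = 0
    simp [Complex.mul_im, h1, hx]
  · show (x.2 + ξ 2).im = 0
    simp [h2, hξ 2]
  · show (x.1 * ξ 1).im = 0
    simp [Complex.mul_im, h1, hξ 1]
  · exact hξ 3
  · exact hξ 4
  · rfl
  · exact h3

lemma Zarg_per (x : ℂ × ℂ) (ξ : V5) (t : ℂ) : Zarg x ξ (t + tpi) = Zarg x ξ t + Pi.single 6 tpi := by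
  ext i
  fin_cases i <;> simp [Zarg, Pi.single_apply]
  all_goals rfl

lemma Zarg_sub {x : ℂ × ℂ} (hx : ‖x‖ ≤ 1) (ξ ξ' : V5) (t : ℂ) : ‖Zarg x ξ t - Zarg x ξ' t‖ ≤ 2 * ‖ξ - ξ'‖ := by
  have h0 := norm_nonneg (ξ - ξ')
  have hi : ∀ i, ‖ξ i - ξ' i‖ ≤ ‖ξ - ξ'‖ := fun i => norm_le_pi_norm (ξ - ξ') i
  have ha : ‖x.1‖ ≤ 1 := (norm_fst_le x).trans hx
  rw [pi_norm_le_iff_of_nonneg (by positivity)]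
  intro i
  fin_cases i
  · show ‖x.1 * (1 + xi1 ξ) - x.1 * (1 + xi1 ξ')‖ ≤ _
    rw [← mul_sub, add_sub_add_left_eq_sub, xi1_sub, norm_mul]
    have := xi1_norm (ξ - ξ')
    nlinarith [norm_nonneg x.1]
  · show ‖x.2 + ξ 2 - (x.2 + ξ' 2)‖ ≤ _
    rw [add_sub_add_left_eq_sub]; linarith [hi 2]
  · show ‖x.1 * ξ 1 - x.1 * ξ' 1‖ ≤ _
    rw [← mul_sub, norm_mul]
    nlinarith [norm_nonneg x.1, hi 1]
  · show ‖ξ 3 - ξ' 3‖ ≤ _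
    linarith [hi 3]
  · show ‖ξ 4 - ξ' 4‖ ≤ _
    linarith [hi 4]
  · show ‖(0:ℂ) - 0‖ ≤ _
    simpa using h0
  · show ‖t - t‖ ≤ _
    simpa using h0

lemma RH.lip {r C : ℝ} {R : (Fin 7 → ℂ) → ℂ} (hr : 0 < r) (h : RH (16 * r) C R) (hr1 : r ≤ 1)
    {x : ℂ × ℂ} {ξ ξ' : V5} {t : ℂ} (hd : Dm r x ξ t) (hd' : Dm r x ξ' t) :
    ‖R (Zarg x ξ t) - R (Zarg x ξ' t)‖ ≤ (2 * C / (5 * r)) * (2 * ‖ξ - ξ'‖) := by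
  have z1 := Zarg_mem hr hr1 hd
  have z2 := Zarg_mem hr hr1 hd'
  have hsub := Zarg_sub (hd.1.le.trans hr1) ξ ξ' t
  have hC : 0 ≤ C := (norm_nonneg _).trans (h.bd _ ⟨fun i hi => (z1.1 i hi).trans (by linarith), z1.2.trans (by linarith)⟩)
  have hball : ball (Zarg x ξ' t) (5 * r) ⊆ cDom (16 * r) := by
    intro z hz
    have hz : ‖z - Zarg x ξ' t‖ < 5 * r := by simpa [dist_eq_norm] using hz
    have hz' : ∀ i, ‖z i - Zarg x ξ' t i‖ < 5 * r := fun i => (norm_le_pi_norm (z - Zarg x ξ' t) i).trans_lt hz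
    refine ⟨fun i hi => ?_, ?_⟩
    · have := norm_add_le (z i - Zarg x ξ' t i) (Zarg x ξ' t i)
      rw [sub_add_cancel] at this
      linarith [hz' i, z2.1 i hi]
    · have h1 := (Complex.abs_im_le_norm _).trans_lt (hz' 6)
      rw [Complex.sub_im] at h1
      have h2 := abs_add_le ((z 6).im - (Zarg x ξ' t 6).im) (Zarg x ξ' t 6).im
      rw [sub_add_cancel] at h2
      linarith [z2.2]
  have hz : Zarg x ξ t ∈ ball (Zarg x ξ' t) (5 * r) := by
    rw [mem_ball, dist_eq_norm]
    refine hsub.trans_lt ?_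
    have := norm_sub_le ξ ξ'
    linarith [hd.2.1, hd'.2.1]
  have key := Complex.dist_le_div_mul_dist_of_mapsTo_ball (f := R) (c := Zarg x ξ' t) (R₁ := 5 * r) (R₂ := 2 * C)
    (fun z hz => (h.ana z (hball hz)).differentiableAt.differentiableWithinAt) (fun z hz => by
      rw [mem_closedBall, dist_eq_norm]
      refine (norm_sub_le _ _).trans ?_
      linarith [h.bd z (hball hz), h.bd _ (hball (mem_ball_self (by positivity : 0 < 5 * r)))]) hz
  rw [dist_eq_norm, dist_eq_norm] at key
  refine key.trans ?_
  gcongr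

lemma RH.LB {r C : ℝ} {R : (Fin 7 → ℂ) → ℂ} (hr : 0 < r) (hr1 : r ≤ 1) (h : RH (16 * r) C R) :
    LB r 0 0 0 (fun x ξ t => x.1 ^ 2 * R (Zarg x ξ t)) := by
  have mem : ∀ {x ξ t}, Dm r x ξ t → Zarg x ξ t ∈ cDom (16 * r) := fun {x ξ t} hd =>
    ⟨fun i hi => ((Zarg_mem hr hr1 hd).1 i hi).trans (by linarith), (Zarg_mem hr hr1 hd).2.trans (by linarith)⟩
  have hC : 0 ≤ C := (norm_nonneg _).trans (h.bd _ (mem (x := 0) (ξ := 0) (t := 0) ⟨by simpa using hr, by simpa using hr, by simpa using hr⟩))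
  have hD : 0 ≤ 2 * C / (5 * r) := by positivity
  have bd : ∀ {x ξ t}, Dm r x ξ t → ‖x.1 ^ 2 * R (Zarg x ξ t)‖ ≤ C * ‖x‖ ^ 2 := by
    intro x ξ t hd
    rw [norm_mul, norm_pow, mul_comm]
    have := norm_fst_le x
    have := h.bd _ (mem hd)
    gcongr
  refine ⟨C + 2 * (2 * C / (5 * r)), by positivity, fun x ξ t hd => ?_, fun x ξ t hd => ?_, fun x ξ t hd h1 h2 => ?_,
    fun x t h1 h2 => ?_, fun x ξ t hd => ?_, fun x ξ ξ' t hd hd' => ?_⟩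
  · have h1 : AnalyticAt ℂ (fun p : ((ℂ × ℂ) × V5) × ℂ => R (Zarg p.1.1 p.1.2 p.2)) ((x, ξ), t) :=
      AnalyticAt.comp (g := R) (f := fun p : ((ℂ × ℂ) × V5) × ℂ => Zarg p.1.1 p.1.2 p.2) (h.ana _ (mem hd)) (Zarg_ana _)
    have h2 : AnalyticAt ℂ (fun p : ((ℂ × ℂ) × V5) × ℂ => p.1.1.1 ^ 2) ((x, ξ), t) := by fun_prop
    exact h2.mul h1
  · simp only [Zarg_per, h.per _ (mem hd)]
  · have a := h.real _ (mem hd) (Zarg_real h1 h2)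
    have b : x.1.im = 0 := h1.1
    simp [Complex.mul_im, a, sq, b]
  · have := bd (x := x) (ξ := 0) (t := t) ⟨h1, by simpa using hr, h2⟩
    simp only [sub_zero, zero_apply]
    refine this.trans ?_
    gcongr; linarith
  · have := bd hd
    rw [sub_zero]
    refine this.trans ?_
    have x1 : ‖x‖ ≤ 1 := hd.1.le.trans hr1
    have : ‖x‖ ^ 2 ≤ ‖x‖ + ‖ξ‖ := by nlinarith [norm_nonneg x, norm_nonneg ξ]
    calc C * ‖x‖ ^ 2 ≤ C * (‖x‖ + ‖ξ‖) := by gcongr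
      _ ≤ _ := by gcongr; linarith
  · have l := h.lip hr hr1 hd hd'
    rw [← mul_sub, zero_apply, sub_zero, norm_mul, norm_pow]
    have x1 : ‖x‖ ≤ 1 := hd.1.le.trans hr1
    have x2 : ‖x.1‖ ^ 2 ≤ ‖x‖ + ‖ξ‖ + ‖ξ'‖ := by
      have := norm_fst_le x
      nlinarith [norm_nonneg x, norm_nonneg ξ, norm_nonneg ξ', norm_nonneg x.1]
    calc ‖x.1‖ ^ 2 * ‖R (Zarg x ξ t) - R (Zarg x ξ' t)‖
        ≤ (‖x‖ + ‖ξ‖ + ‖ξ'‖) * ((2 * C / (5 * r)) * (2 * ‖ξ - ξ'‖)) := by gcongr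
      _ = (2 * (2 * C / (5 * r))) * (‖x‖ + ‖ξ‖ + ‖ξ'‖) * ‖ξ - ξ'‖ := by ring
      _ ≤ _ := by gcongr; linarith

def wsum (ξ : V5) : ℂ := 1 + xi1 ξ + ξ 1

def F1s (R : (Fin 7 → ℂ) → ℂ) : FS := fun x ξ t =>
  (1/4) * (1 + xi1 ξ) - (1/4) * wsum ξ ^ 3 * (1 + xi1 ξ) + wsum ξ ^ 6 * (x.1 ^ 2 * R (Zarg x ξ t))
def F2s (R : (Fin 7 → ℂ) → ℂ) : FS := fun x ξ t =>
  (1/4) * ξ 1 + (1/4) * wsum ξ ^ 3 * ξ 1 + wsum ξ ^ 6 * (x.1 ^ 2 * R (Zarg x ξ t))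
def F3s (R : (Fin 7 → ℂ) → ℂ) : FS := fun x ξ t =>
  (1/4) * x.2 - (1/4) * wsum ξ ^ 2 * (1 + xi1 ξ - ξ 1) * (x.2 + ξ 2) - (1/2) * wsum ξ ^ 3 * (x.2 + ξ 2) ^ 2
    + wsum ξ ^ 5 * (x.1 ^ 2 * R (Zarg x ξ t))
def F4s (i : Fin 5) (R : (Fin 7 → ℂ) → ℂ) : FS := fun x ξ t =>
  (1/4) * wsum ξ ^ 2 * (1 + xi1 ξ - ξ 1) * ξ i + wsum ξ ^ 5 * (x.1 ^ 2 * R (Zarg x ξ t))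

def F0c (Ru RT Rv Ra RA : (Fin 7 → ℂ) → ℂ) : FT := fun x ξ t =>
  ![F1s Ru x ξ t + (3/5) * F2s Rv x ξ t, F2s Rv x ξ t, F3s RT x ξ t, F4s 3 Ra x ξ t, F4s 4 RA x ξ t]

section
variable {r : ℝ} {c : ℂ} {l : ℂ × ℂ →L[ℂ] ℂ} {L : V5 →L[ℂ] ℂ} {f : FS}

lemma LB.congr {c' : ℂ} {l' : ℂ × ℂ →L[ℂ] ℂ} {L' : V5 →L[ℂ] ℂ} {f' : FS} (h : LB r c l L f)
    (hc : c = c') (hl : ∀ x, l x = l' x) (hL : ∀ ξ, L ξ = L' ξ) (hf : ∀ x ξ t, f x ξ t = f' x ξ t) : LB r c' l' L' f' := by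
  have e1 : l = l' := ContinuousLinearMap.ext hl
  have e2 : L = L' := ContinuousLinearMap.ext hL
  have e3 : f = f' := by funext x ξ t; exact hf x ξ t
  subst hc e1 e2 e3
  exact h

lemma LB.smul (hr : r ≤ 1) (h : LB r c l L f) (k : ℝ) : LB r ((k:ℂ) * c) ((k:ℂ) • l) ((k:ℂ) • L) (fun x ξ t => (k:ℂ) * f x ξ t) :=
  ((LB_const (k:ℂ) (Complex.ofReal_im k)).mul hr h).congr rfl (by simp) (by simp) (by simp)

lemma LB.pow (hr : r ≤ 1) (h : LB r 1 l L f) (n : ℕ) : LB r 1 ((n:ℂ) • l) ((n:ℂ) • L) (fun x ξ t => f x ξ t ^ n) := by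
  induction n with
  | zero => exact (LB_const 1 rfl).congr rfl (by simp) (by simp) (by simp)
  | succ n ih =>
    refine (ih.mul hr h).congr (by simp) (fun x => ?_) (fun x => ?_) (fun x ξ t => (pow_succ _ _).symm)
    · simp; ring
    · simp; ring

def pr (i : Fin 5) : V5 →L[ℂ] ℂ := ContinuousLinearMap.proj i
lemma pr_apply (i : Fin 5) (v : V5) : pr i v = v i := rfl

lemma LB_u (hr : r ≤ 1) : LB r 1 0 (pr 0 - (3/5:ℂ) • pr 1) (fun _ ξ _ => 1 + xi1 ξ) := by
  refine ((LB_const 1 rfl).add ((LB_xi 0).add ((LB_xi 1).smul hr (-3/5)))).congr (by simp) (by simp) (fun ξ => ?_) fun x ξ t => ?_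
  · simp [pr]; ring
  · simp [xi1]; ring

lemma LB_w (hr : r ≤ 1) : LB r 1 0 (pr 0 + (2/5:ℂ) • pr 1) (fun _ ξ _ => wsum ξ) := by
  refine ((LB_u hr).add (LB_xi 1)).congr (by simp) (by simp) (fun ξ => ?_) fun x ξ t => rfl
  simp [pr]; ring

lemma LB_d (hr : r ≤ 1) : LB r 1 0 (pr 0 - (8/5:ℂ) • pr 1) (fun _ ξ _ => 1 + xi1 ξ - ξ 1) := by
  refine ((LB_u hr).add ((LB_xi 1).smul hr (-1))).congr (by simp) (by simp) (fun ξ => ?_) fun x ξ t => ?_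
  · simp [pr]; ring
  · simp; ring

variable {C : ℝ} {R : (Fin 7 → ℂ) → ℂ}

lemma LB_F1 (hr0 : 0 < r) (hr : r ≤ 1) (h : RH (16 * r) C R) :
    LB r 0 0 (-(3/4 : ℂ) • pr 0 - (3/10 : ℂ) • pr 1) (F1s R) := by
  refine ((((LB_u hr).smul hr (1/4)).add ((((LB_w hr).pow hr 3).mul hr (LB_u hr)).smul hr (-1/4))).add
    (((LB_w hr).pow hr 6).mul hr (h.LB hr0 hr))).congr ?_ ?_ ?_ ?_
  · push_cast; ring
  · intro x; simp
  · intro ξ; simp [pr]; ring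
  · intro x ξ t; simp [F1s]; ring

lemma LB_F2 (hr0 : 0 < r) (hr : r ≤ 1) (h : RH (16 * r) C R) :
    LB r 0 0 ((1/2 : ℂ) • pr 1) (F2s R) := by
  refine ((((LB_xi 1).smul hr (1/4)).add ((((LB_w hr).pow hr 3).mul hr (LB_xi 1)).smul hr (1/4))).add
    (((LB_w hr).pow hr 6).mul hr (h.LB hr0 hr))).congr ?_ ?_ ?_ ?_
  · push_cast; ring
  · intro x; simp
  · intro ξ; simp [pr]; ring
  · intro x ξ t; simp [F2s]; ring

lemma LB_F3 (hr0 : 0 < r) (hr : r ≤ 1) (h : RH (16 * r) C R) :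
    LB r 0 0 (-(1/4 : ℂ) • pr 2) (F3s R) := by
  have hb : LB r 0 (ContinuousLinearMap.snd ℂ ℂ ℂ) (pr 2) (fun x ξ _ => x.2 + ξ 2) :=
    (LB_b.add (LB_xi 2)).congr (by simp) (by simp) (by simp [pr]) (by simp)
  refine ((((LB_b.smul hr (1/4)).add (((((LB_w hr).pow hr 2).mul hr (LB_d hr)).mul hr hb).smul hr (-1/4))).add
    ((((LB_w hr).pow hr 3).mul hr (hb.mul hr hb)).smul hr (-1/2))).add
    (((LB_w hr).pow hr 5).mul hr (h.LB hr0 hr))).congr ?_ ?_ ?_ ?_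
  · push_cast; ring
  · intro x; simp; ring
  · intro ξ; simp [pr]; ring
  · intro x ξ t; simp [F3s]; ring

lemma LB_F4 (i : Fin 5) (hr0 : 0 < r) (hr : r ≤ 1) (h : RH (16 * r) C R) :
    LB r 0 0 ((1/4 : ℂ) • pr i) (F4s i R) := by
  refine (((((((LB_w hr).pow hr 2).mul hr (LB_d hr)).mul hr (LB_xi i)).smul hr (1/4))).add
    (((LB_w hr).pow hr 5).mul hr (h.LB hr0 hr))).congr ?_ ?_ ?_ ?_
  · push_cast; ring
  · intro x; simp
  · intro ξ; simp [pr]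
  · intro x ξ t; simp [F4s]; ring

/-- assembling scalar symbols into `FH` -/
lemma FH_of_LB (hr : 0 < r) {F : FT} (h : ∀ i, LB r 0 0 (Lam i • pr i) (fun x ξ t => F x ξ t i)) :
    ∃ C ≥ 0, FH r C F := by
  choose C h using h
  have hle : ∀ i, C i ≤ ∑ j, C j := fun i => Finset.single_le_sum (fun j _ => (h j).C0) (Finset.mem_univ i)
  have h0 : 0 ≤ ∑ j, C j := Finset.sum_nonneg fun j _ => (h j).C0
  refine ⟨∑ j, C j, h0, ?_, ?_, ?_, ?_, ?_⟩
  · intro x ξ t h1 h2 h3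
    rw [analyticAt_pi_iff]
    exact fun i => (h i).ana x ξ t ⟨h1, h2, h3⟩
  · intro x ξ t h1 h2 h3
    funext i
    exact (h i).per x ξ t ⟨h1, h2, h3⟩
  · intro x ξ t h1 h2 h3 hr hv i
    exact (h i).real x ξ t ⟨h1, h2, h3⟩ hr hv
  · intro x t h1 h2
    rw [pi_norm_le_iff_of_nonneg (by positivity)]
    intro i
    have := (h i).zero x t h1 h2
    simp only [sub_zero, zero_apply] at this
    refine this.trans ?_
    gcongr
    exact hle i
  · intro x ξ ξ' t h1 h2 h3 h4
    rw [pi_norm_le_iff_of_nonneg (by positivity)]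
    intro i
    have := (h i).lip x ξ ξ' t ⟨h1, h2, h4⟩ ⟨h1, h3, h4⟩
    refine le_trans (le_of_eq ?_) (this.trans ?_)
    · rfl
    · gcongr
      exact hle i

lemma FH_F0c {Ru RT Rv Ra RA : (Fin 7 → ℂ) → ℂ} (hr0 : 0 < r) (hr : r ≤ 1) (h1 : RH (16 * r) C Ru) (h2 : RH (16 * r) C RT)
    (h3 : RH (16 * r) C Rv) (h4 : RH (16 * r) C Ra) (h5 : RH (16 * r) C RA) :
    ∃ C ≥ 0, FH r C (F0c Ru RT Rv Ra RA) := by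
  refine FH_of_LB hr0 fun i => ?_
  fin_cases i
  · refine ((LB_F1 hr0 hr h1).add ((LB_F2 hr0 hr h3).smul hr (3/5))).congr (by simp) (by simp) (fun ξ => ?_) (fun x ξ t => ?_)
    · simp [Lam, pr]; ring
    · simp [F0c]
  · exact (LB_F2 hr0 hr h3).congr rfl (by simp) (fun ξ => by simp [Lam]) (fun x ξ t => by simp [F0c])
  · exact (LB_F3 hr0 hr h2).congr rfl (by simp) (fun ξ => by simp [Lam, neg_div]) (fun x ξ t => by simp [F0c])
  · exact (LB_F4 3 hr0 hr h4).congr rfl (by simp) (fun ξ => by simp [Lam]) (fun x ξ t => by simp [F0c])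
  · exact (LB_F4 4 hr0 hr h5).congr rfl (by simp) (fun ξ => by simp [Lam]) (fun x ξ t => by simp [F0c])
end

end PartPF2

section PartPG1
open MeasureTheory
lemma diag_bound_lim {m : ℂ × ℂ → V5} {k : ℕ} {C ρ : ℝ} (hρ : 0 < ρ) (hb : ∀ x, ‖x‖ < ρ → ‖m x‖ ≤ C * ‖x‖ ^ k)
    (p : ContinuousMultilinearMap ℂ (fun _ : Fin k => ℂ × ℂ) V5)
    (hp : (fun x => m x - p fun _ => x) =O[𝓝 0] (fun x => ‖x‖ ^ (k + 1))) (x : ℂ × ℂ) :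
    ‖p fun _ => x‖ ≤ C * ‖x‖ ^ k := by
  obtain ⟨A, hA, hh⟩ := hp.exists_pos
  rw [IsBigOWith] at hh
  have h2 : Tendsto (fun s : ℝ => (s : ℂ) • x) (𝓝[>] 0) (𝓝 0) := by
    have : Continuous fun s : ℝ => (s : ℂ) • x := by fun_prop
    have h := this.tendsto 0
    simp only [Complex.ofReal_zero, zero_smul] at h
    exact h.mono_left nhdsWithin_le_nhds
  have h3 : Tendsto (fun s : ℝ => C * ‖x‖ ^ k + A * s * ‖x‖ ^ (k + 1)) (𝓝[>] 0) (𝓝 (C * ‖x‖ ^ k)) := by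
    have : Continuous fun s : ℝ => C * ‖x‖ ^ k + A * s * ‖x‖ ^ (k + 1) := by fun_prop
    have h := this.tendsto 0
    simp only [mul_zero, zero_mul, add_zero] at h
    exact h.mono_left nhdsWithin_le_nhds
  refine ge_of_tendsto h3 ?_
  filter_upwards [h2.eventually hh, h2.eventually (ball_mem_nhds 0 hρ), self_mem_nhdsWithin] with s h4 h5 hs
  have hs : 0 < s := hs
  rw [dist_zero_right] at h5
  have h6 := hb _ h5
  have hn : ‖(s:ℂ) • x‖ = s * ‖x‖ := by rw [norm_smul]; simp [abs_of_pos hs]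
  have hpp : ‖p fun _ => (s:ℂ) • x‖ = s ^ k * ‖p fun _ => x‖ := by
    rw [mul_diag_hom, norm_smul]; simp [abs_of_pos hs]
  have h7 : ‖p fun _ => (s:ℂ) • x‖ ≤ ‖m ((s:ℂ) • x)‖ + ‖m ((s:ℂ) • x) - p fun _ => (s:ℂ) • x‖ := by
    have := norm_sub_le (m ((s:ℂ) • x)) (m ((s:ℂ) • x) - p fun _ => (s:ℂ) • x)
    rwa [sub_sub_cancel] at this
  rw [Real.norm_of_nonneg (by positivity)] at h4
  rw [hn] at h4 h6
  rw [hpp] at h7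
  have hsk : 0 < s ^ k := by positivity
  have : s ^ k * ‖p fun _ => x‖ ≤ s ^ k * (C * ‖x‖ ^ k + A * s * ‖x‖ ^ (k + 1)) := by
    refine (h7.trans (add_le_add h6 h4)).trans (le_of_eq ?_)
    ring
  exact le_of_mul_le_mul_left this hsk

lemma taylor_step {f : ℂ × ℂ → V5} {k : ℕ} {C ρ : ℝ} (hρ : 0 < ρ) (hC : 0 ≤ C) (ha : ∀ x, ‖x‖ < ρ → AnalyticAt ℂ f x)
    (hb : ∀ x, ‖x‖ < ρ → ‖f x‖ ≤ C * ‖x‖ ^ k) :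
    ∃ p : ContinuousMultilinearMap ℂ (fun _ : Fin k => ℂ × ℂ) V5, (∀ x, ‖p fun _ => x‖ ≤ C * ‖x‖ ^ k) ∧
      ∀ x, ‖x‖ < ρ → ‖f x - p fun _ => x‖ ≤ (4 * C / ρ) * ‖x‖ ^ (k + 1) := by
  have hO : f =O[𝓝 0] fun x => ‖x‖ ^ k := by
    refine IsBigO.of_bound C ?_
    filter_upwards [ball_mem_nhds (0 : ℂ × ℂ) hρ] with x hx
    rw [mem_ball_zero_iff] at hx
    simpa using hb x hx
  obtain ⟨p, hp, -⟩ := hom_part (ha 0 (by simpa using hρ)) k hO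
  have hpb := diag_bound_lim hρ hb p hp
  refine ⟨p, hpb, fun x hx => ?_⟩
  have g0 : f 0 - (p fun _ => (0 : ℂ × ℂ)) = 0 := by
    have h1 := hp.bound
    obtain ⟨A, hA⟩ := h1
    have := hA.self_of_nhds
    simpa using this
  have key := Complex.dist_le_mul_div_pow_of_mapsTo_ball_of_isLittleO (f := fun x => f x - p fun _ => x) (c := 0) (z := x)
    (R₁ := ρ) (R₂ := 2 * C * ρ ^ k) (n := k) ?_ ?_ ?_ (by simpa using hx)
  · simp only [g0, dist_zero_right] at key
    refine key.trans ?_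
    rw [div_pow, pow_succ ρ]
    have : 2 * C * ρ ^ k * (‖x‖ ^ (k + 1) / (ρ ^ k * ρ)) = (2 * C / ρ) * ‖x‖ ^ (k + 1) := by
      field_simp
    rw [this]
    gcongr
    norm_num
  · intro y hy
    rw [mem_ball_zero_iff] at hy
    exact ((ha y hy).sub (mul_diag_analytic p y)).differentiableAt.differentiableWithinAt
  · intro y hy
    rw [mem_ball_zero_iff] at hy
    simp only [g0, mem_closedBall, dist_zero_right]
    refine (norm_sub_le _ _).trans ?_
    have h1 := hb y hy
    have h2 := hpb y
    have h3 : ‖y‖ ^ k ≤ ρ ^ k := pow_le_pow_left₀ (norm_nonneg _) hy.le k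
    have := mul_le_mul_of_nonneg_left h3 hC
    linarith
  · simp only [g0, sub_zero]
    refine hp.trans_isLittleO ?_
    have h1 : Tendsto (fun x : ℂ × ℂ => ‖x‖) (𝓝 0) (𝓝 0) := by simpa using (continuous_norm (E := ℂ × ℂ)).tendsto 0
    have := (isLittleO_pow_pow (𝕜 := ℝ) (Nat.lt_succ_self k)).comp_tendsto h1
    exact this

/-- uniform Taylor expansion of a family. -/
lemma taylor_unif {f : ℝ → ℂ × ℂ → V5} {ρ C : ℝ} (hρ : 0 < ρ) (hC : 0 ≤ C)
    (ha : ∀ t x, ‖x‖ < ρ → AnalyticAt ℂ (f t) x) (hb : ∀ t x, ‖x‖ < ρ → ‖f t x‖ ≤ C * ‖x‖ ^ 2) (ℓ : ℕ) :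
    ∃ p : ∀ (j : ℕ) (_ : ℝ), ContinuousMultilinearMap ℂ (fun _ : Fin j => ℂ × ℂ) V5, ∃ A, 0 ≤ A ∧
      (∀ j t x, ‖p j t fun _ => x‖ ≤ A * ‖x‖ ^ j) ∧
      ∀ t x, ‖x‖ < ρ → ‖f t x - ∑ j ∈ Finset.Ico 2 (ℓ + 2), p j t fun _ => x‖ ≤ A * ‖x‖ ^ (ℓ + 2) := by
  induction ℓ with
  | zero => exact ⟨fun _ _ => 0, C, hC, fun j t x => by simp; positivity, fun t x hx => by simpa using hb t x hx⟩
  | succ ℓ ih =>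
    obtain ⟨p, A, hA, hpb, hr⟩ := ih
    have hex : ∀ t, ∃ q : ContinuousMultilinearMap ℂ (fun _ : Fin (ℓ + 2) => ℂ × ℂ) V5, 
        (∀ x, ‖q fun _ => x‖ ≤ A * ‖x‖ ^ (ℓ + 2)) ∧
      ∀ x, ‖x‖ < ρ → ‖(f t x - ∑ j ∈ Finset.Ico 2 (ℓ + 2), p j t fun _ => x) - q fun _ => x‖ ≤ (4 * A / ρ) * ‖x‖ ^ (ℓ + 2 + 1) := by
      intro t
      refine taylor_step hρ hA (fun x hx => (ha t x hx).sub ?_) (hr t)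
      exact Finset.analyticAt_fun_sum _ fun j _ => mul_diag_analytic _ x
    choose q hq1 hq2 using hex
    classical
    refine ⟨fun j t => if h : j = ℓ + 2 then h ▸ q t else p j t, max A (4 * A / ρ), le_max_of_le_left hA, ?_, ?_⟩
    · intro j t x
      by_cases h : j = ℓ + 2
      · subst h
        simp only [dite_true]
        refine (hq1 t x).trans ?_
        gcongr
        exact le_max_left _ _
      · simp only [h, dite_false]
        refine (hpb j t x).trans ?_
        gcongr
        exact le_max_left _ _
    · intro t x hx
      rw [show ℓ + 1 + 2 = (ℓ + 2) + 1 by ring, Finset.sum_Ico_succ_top (by omega)]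
      simp only [dite_true]
      rw [Finset.sum_congr rfl (g := fun j => p j t fun _ => x)]
      · rw [← sub_sub]
        refine (hq2 t x hx).trans ?_
        gcongr
        exact le_max_right _ _
      · intro j hj
        have : j ≠ ℓ + 2 := by have := (Finset.mem_Ico.1 hj).2; omega
        simp only [this, dite_false]

end PartPG1

section PartPG2
open MeasureTheory
/-- the tail of the parametrization -/
def Qm (x : ℂ × ℂ) (v : V5) : V5 := ![x.1 * xi1 v, v 2, x.1 * v 1, v 3, v 4]
def Kf (ξ : W3 → V5) (w : W3) : V5 := ![w.1.1, w.1.2, 0, 0, 0] + Qm w.1 (ξ w)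
def Xc (k : V5) (a b c d e : ℂ) : V5 :=
  ![-(1/4) * (k 0 + k 2) ^ 3 * k 0 + (k 0 + k 2) ^ 6 * a,
    -(1/4) * (k 0 + k 2) ^ 2 * (k 0 - k 2) * k 1 - (1/2) * (k 0 + k 2) ^ 3 * k 1 ^ 2 + (k 0 + k 2) ^ 5 * b,
    (1/4) * (k 0 + k 2) ^ 3 * k 2 + (k 0 + k 2) ^ 6 * c,
    (1/4) * (k 0 + k 2) ^ 2 * (k 0 - k 2) * k 3 + (k 0 + k 2) ^ 5 * d,
    (1/4) * (k 0 + k 2) ^ 2 * (k 0 - k 2) * k 4 + (k 0 + k 2) ^ 5 * e]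

lemma Qm_norm {x : ℂ × ℂ} (hx : ‖x‖ ≤ 1) (v : V5) : ‖Qm x v‖ ≤ 2 * ‖v‖ := by
  have h0 := norm_nonneg v
  have hi : ∀ i, ‖v i‖ ≤ 2 * ‖v‖ := fun i => (norm_le_pi_norm v i).trans (by linarith)
  have ha : ‖x.1‖ ≤ 1 := (norm_fst_le x).trans hx
  rw [pi_norm_le_iff_of_nonneg (by positivity)]
  intro i
  fin_cases i
  · show ‖x.1 * xi1 v‖ ≤ _
    rw [norm_mul]
    nlinarith [xi1_norm v, norm_nonneg x.1, norm_nonneg (xi1 v)]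
  · exact hi 2
  · show ‖x.1 * v 1‖ ≤ _
    rw [norm_mul]
    nlinarith [hi 1, norm_nonneg x.1, norm_nonneg (v 1)]
  · exact hi 3
  · exact hi 4

lemma Qm_sub (x : ℂ × ℂ) (v v' : V5) : Qm x v - Qm x v' = Qm x (v - v') := by
  ext i
  fin_cases i <;> simp [Qm, xi1] <;> ring

lemma ana_coord {E : Type*} [NormedAddCommGroup E] [NormedSpace ℂ E] {f : E → V5} {w : E} (h : AnalyticAt ℂ f w) (i : Fin 5) :
    AnalyticAt ℂ (fun w => f w i) w := analyticAt_pi_iff.1 h i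

lemma Qm_ana {ξ : W3 → V5} {w : W3} (h : AnalyticAt ℂ ξ w) : AnalyticAt ℂ (fun w : W3 => Qm w.1 (ξ w)) w := by
  have ha : AnalyticAt ℂ (fun w : W3 => w.1.1) w := by fun_prop
  have hi := fun i => ana_coord h i
  rw [analyticAt_pi_iff]
  intro i
  fin_cases i
  · exact ha.mul ((hi 0).sub (analyticAt_const.mul (hi 1)))
  · exact hi 2
  · exact ha.mul (hi 1)
  · exact hi 3
  · exact hi 4

lemma Kf_ana {ξ : W3 → V5} {w : W3} (h : AnalyticAt ℂ ξ w) : AnalyticAt ℂ (Kf ξ) w := by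
  refine AnalyticAt.add ?_ (Qm_ana h)
  have ha : AnalyticAt ℂ (fun w : W3 => w.1.1) w := by fun_prop
  have hb : AnalyticAt ℂ (fun w : W3 => w.1.2) w := by fun_prop
  rw [analyticAt_pi_iff]
  intro i
  fin_cases i
  · exact ha
  · exact hb
  · exact analyticAt_const
  · exact analyticAt_const
  · exact analyticAt_const

lemma xi1_real {v : V5} (hξ : RealV v) : (xi1 v).im = 0 := by
  have : (3/5 : ℂ) = ((3/5 : ℝ) : ℂ) := by push_cast; rfl
  simp [xi1, this, hξ 0, hξ 1, Complex.mul_im, -Complex.ofReal_div]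

lemma Qm_real {x : ℂ × ℂ} {v : V5} (h : x.1.im = 0) (hv : RealV v) : RealV (Qm x v) := by
  intro i
  have hx := xi1_real hv
  fin_cases i
  · show (x.1 * xi1 v).im = 0
    simp [Complex.mul_im, h, hx]
  · exact hv 2
  · show (x.1 * v 1).im = 0
    simp [Complex.mul_im, h, hv 1]
  · exact hv 3
  · exact hv 4

lemma Kf_real {ξ : W3 → V5} {w : W3} (h : RealW w) (hv : RealV (ξ w)) : RealV (Kf ξ w) := by
  refine RealV.add ?_ (Qm_real h.1 hv)
  intro i
  fin_cases i
  · exact h.1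
  · exact h.2.1
  all_goals rfl

lemma Zarg_Kf (ξ : W3 → V5) (w : W3) : Zarg w.1 (ξ w) w.2 =
    ![Kf ξ w 0, Kf ξ w 1, Kf ξ w 2, Kf ξ w 3, Kf ξ w 4, 0, w.2] := by
  ext i
  fin_cases i <;> simp [Zarg, Kf, Qm]
  ring

lemma Kf_pde {ξ : W3 → V5} {w : W3} (h : AnalyticAt ℂ ξ w) {γ : ℂ × ℂ → ℂ} {Ru RT Rv Ra RA : (Fin 7 → ℂ) → ℂ}
    (hp : fderiv ℂ ξ w (-((w.1.1 ^ 3 * (1/4 + γ w.1)) • w.1), 1) = w.1.1 ^ 3 • Fg γ (F0c Ru RT Rv Ra RA) w.1 (ξ w) w.2) :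
    fderiv ℂ (Kf ξ) w (-((w.1.1 ^ 3 * (1/4 + γ w.1)) • w.1), 1) =
      Xc (Kf ξ w) (Ru (Zarg w.1 (ξ w) w.2)) (RT (Zarg w.1 (ξ w) w.2)) (Rv (Zarg w.1 (ξ w) w.2))
        (Ra (Zarg w.1 (ξ w) w.2)) (RA (Zarg w.1 (ξ w) w.2)) := by
  obtain ⟨d, hd⟩ : ∃ d : W3, d = (-((w.1.1 ^ 3 * (1/4 + γ w.1)) • w.1), 1) := ⟨_, rfl⟩
  rw [← hd] at hp ⊢
  have hc : HasDerivAt (fun s : ℂ => w + s • d) d 0 := by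
    simpa using ((hasDerivAt_id (0:ℂ)).smul_const d).const_add w
  have hc0 : w + (0:ℂ) • d = w := by simp
  have h1 : HasDerivAt (fun s : ℂ => ξ (w + s • d)) (fderiv ℂ ξ w d) 0 := by
    have : HasFDerivAt ξ (fderiv ℂ ξ w) (w + (0:ℂ) • d) := by rw [hc0]; exact h.differentiableAt.hasFDerivAt
    exact this.comp_hasDerivAt (l := ξ) (f := fun s : ℂ => w + s • d) 0 hc
  have h2 : HasDerivAt (fun s : ℂ => Kf ξ (w + s • d)) (fderiv ℂ (Kf ξ) w d) 0 := by
    have : HasFDerivAt (Kf ξ) (fderiv ℂ (Kf ξ) w) (w + (0:ℂ) • d) := by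
      rw [hc0]; exact (Kf_ana h).differentiableAt.hasFDerivAt
    exact this.comp_hasDerivAt (l := Kf ξ) (f := fun s : ℂ => w + s • d) 0 hc
  have hi := hasDerivAt_pi.1 h1
  have hk := hasDerivAt_pi.1 h2
  have ha : HasDerivAt (fun s : ℂ => (w + s • d).1.1) d.1.1 0 := by
    simpa using ((hasDerivAt_id (0:ℂ)).mul_const d.1.1).const_add w.1.1
  have hb : HasDerivAt (fun s : ℂ => (w + s • d).1.2) d.1.2 0 := by
    simpa using ((hasDerivAt_id (0:ℂ)).mul_const d.1.2).const_add w.1.2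
  rw [hp] at hi
  have d1 : d.1.1 = -((w.1.1 ^ 3 * (1/4 + γ w.1)) * w.1.1) := by rw [hd]; rfl
  have d2 : d.1.2 = -((w.1.1 ^ 3 * (1/4 + γ w.1)) * w.1.2) := by rw [hd]; rfl
  rw [d1] at ha
  rw [d2] at hb
  have e0 := ha.add (ha.mul ((hi 0).sub ((hi 1).const_mul (3/5 : ℂ))))
  have e1 := hb.add (hi 2)
  have e2 := ha.mul (hi 1)
  ext i
  fin_cases i
  · refine (hk 0).unique (HasDerivAt.congr_deriv (e0.congr_of_eventuallyEq (Eventually.of_forall fun s => ?_)) ?_)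
    · simp [Kf, Qm, xi1]
    · simp only [hc0]
      simp [Fg, F0c, F1s, F2s, Gv, Xc, Kf, Qm, wsum, xi1]
      ring
  · refine (hk 1).unique (HasDerivAt.congr_deriv (e1.congr_of_eventuallyEq (Eventually.of_forall fun s => ?_)) ?_)
    · simp [Kf, Qm]
    · simp [Fg, F0c, F3s, Gv, Xc, Kf, Qm, wsum, xi1]
      ring
  · refine (hk 2).unique (HasDerivAt.congr_deriv (e2.congr_of_eventuallyEq (Eventually.of_forall fun s => ?_)) ?_)
    · simp [Kf, Qm]
    · simp only [hc0]
      simp [Fg, F0c, F2s, Gv, Xc, Kf, Qm, wsum, xi1]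
      ring
  · refine (hk 3).unique (HasDerivAt.congr_deriv ((hi 3).congr_of_eventuallyEq (Eventually.of_forall fun s => ?_)) ?_)
    · simp [Kf, Qm]
    · simp [Fg, F0c, F4s, Gv, Xc, Kf, Qm, wsum, xi1]
      ring
  · refine (hk 4).unique (HasDerivAt.congr_deriv ((hi 4).congr_of_eventuallyEq (Eventually.of_forall fun s => ?_)) ?_)
    · simp [Kf, Qm]
    · simp [Fg, F0c, F4s, Gv, Xc, Kf, Qm, wsum, xi1]
      ring

end PartPG2

section PartPG3
open MeasureTheory
abbrev E6 := (ℝ × ℝ) × (ℝ × ℝ × ℝ × ℝ)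

def asm (v : Fin 7 → ℝ) : E6 × ℝ := (((v 0, v 1), (v 2, v 3, v 4, v 5)), v 6)

lemma asm_ana (v : Fin 7 → ℝ) : AnalyticAt ℝ asm v := by
  have hi : ∀ i : Fin 7, AnalyticAt ℝ (fun v : Fin 7 → ℝ => v i) v := fun i =>
    (ContinuousLinearMap.proj (R := ℝ) (φ := fun _ : Fin 7 => ℝ) i).analyticAt _
  exact (((hi 0).prod (hi 1)).prod ((hi 2).prod ((hi 3).prod ((hi 4).prod (hi 5))))).prod (hi 6)

lemma rem_c {Rr : E6 → ℝ → ℝ}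
    (h : (∃ ε > (0 : ℝ), AnalyticOnNhd ℝ (fun w : E6 × ℝ => Rr w.1 w.2) (ball 0 ε ×ˢ (univ : Set ℝ))) ∧
      ∀ z t, Rr z (t + 2 * Real.pi) = Rr z t) :
    ∃ r > 0, ∃ C, ∃ g, RH r C g ∧ ∀ v : Fin 7 → ℝ, (∀ i, i ≠ 6 → |v i| < r) → g (toC v) = Rr (asm v).1 (asm v).2 := by
  obtain ⟨⟨ε, hε, ha⟩, hp⟩ := h
  obtain ⟨r, hr, g, h1, h2, h3, C, h4⟩ := complexify (fun v => Rr (asm v).1 (asm v).2) ε hε (by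
    intro v hv
    refine AnalyticAt.comp (g := fun w : E6 × ℝ => Rr w.1 w.2) (f := asm) (ha _ ⟨?_, mem_univ _⟩) (asm_ana v)
    have hv : ∀ i, i ≠ 6 → |v i| < ε := hv
    rw [mem_ball_zero_iff]
    simp only [asm, Prod.norm_def, Real.norm_eq_abs, max_lt_iff]
    exact ⟨⟨hv 0 (by decide), hv 1 (by decide)⟩, hv 2 (by decide), hv 3 (by decide), hv 4 (by decide), hv 5 (by decide)⟩) (by
    intro v
    have e1 : (asm (v + Pi.single 6 (2 * Real.pi))) = ((asm v).1, (asm v).2 + 2 * Real.pi) := by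
      simp [asm, Pi.single_apply]
    simp only [e1, hp])
  refine ⟨r, hr, C, g, ⟨h1, h3, ?_, h4⟩, h2⟩
  intro z hz hzr
  have e : z = toC (reV z) := by
    ext i
    exact Complex.ext (by simp [toC, reV]) (by simp [toC, hzr i])
  rw [e, h2]
  · simp
  · intro i hi
    exact (Complex.abs_re_le_norm _).trans_lt (hz.1 i hi)

def rp (i : Fin 5) : V5 →L[ℝ] ℝ := Complex.reCLM.comp ((ContinuousLinearMap.proj (R := ℂ) (φ := fun _ : Fin 5 => ℂ) i).restrictScalars ℝ)

lemma rp_apply (i : Fin 5) (v : V5) : rp i v = (v i).re := rfl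

def Lr : V5 →L[ℝ] E6 :=
  ((rp 0).prod (rp 1)).prod ((rp 2).prod ((rp 3).prod ((rp 4).prod 0)))

lemma Lr_apply (v : V5) : Lr v = (((v 0).re, (v 1).re), ((v 2).re, (v 3).re, (v 4).re, 0)) := rfl

lemma Lr_norm (v : V5) : ‖Lr v‖ ≤ ‖v‖ := by
  have hi : ∀ i, |(v i).re| ≤ ‖v‖ := fun i => (Complex.abs_re_le_norm _).trans (norm_le_pi_norm v i)
  rw [Lr_apply]
  simp only [Prod.norm_def, Real.norm_eq_abs, max_le_iff, abs_zero]
  exact ⟨⟨hi 0, hi 1⟩, hi 2, hi 3, hi 4, norm_nonneg v⟩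

def emx : ℝ × ℝ →L[ℝ] ℂ × ℂ := (Complex.ofRealCLM.comp (ContinuousLinearMap.fst ℝ ℝ ℝ)).prod
  (Complex.ofRealCLM.comp (ContinuousLinearMap.snd ℝ ℝ ℝ))

lemma emx_apply (x : ℝ × ℝ) : emx x = ((x.1 : ℂ), (x.2 : ℂ)) := rfl

lemma emx_norm (x : ℝ × ℝ) : ‖emx x‖ = ‖x‖ := by
  simp [emx_apply, Prod.norm_def]

def emw : (ℝ × ℝ) × ℝ →L[ℝ] W3 := (emx.comp (ContinuousLinearMap.fst ℝ (ℝ × ℝ) ℝ)).prod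
  (Complex.ofRealCLM.comp (ContinuousLinearMap.snd ℝ (ℝ × ℝ) ℝ))

lemma emw_apply (w : (ℝ × ℝ) × ℝ) : emw w = (emx w.1, (w.2 : ℂ)) := rfl

lemma emw_real (w : (ℝ × ℝ) × ℝ) : RealW (emw w) := ⟨by simp [emw_apply, emx_apply], by simp [emw_apply, emx_apply], by simp [emw_apply]⟩

lemma emw_Ud {ρ : ℝ} (hρ : 0 < ρ) {x : ℝ × ℝ} (h1 : 0 < x.1) (hx : ‖x‖ < ρ) (t : ℝ) : emw (x, t) ∈ Ud ρ := by
  refine ⟨by rw [emw_apply, emx_norm]; exact hx, ?_, by simpa [emw_apply] using hρ⟩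
  have : ((x.1 : ℂ)) ^ 3 = ((x.1 ^ 3 : ℝ) : ℂ) := by push_cast; rfl
  simp only [Cn, emw_apply, emx_apply, this]
  simp only [Complex.ofReal_im, abs_zero, Complex.ofReal_re]
  positivity

/-- the real parametrization -/
def Kr (ξ : W3 → V5) (x : ℝ × ℝ) (t : ℝ) : E6 := (x, 0) + Lr (Qm (emx x) (ξ (emw (x, t))))

lemma Kr_Kf (ξ : W3 → V5) (x : ℝ × ℝ) (t : ℝ) : Kr ξ x t = Lr (Kf ξ (emw (x, t))) := by
  simp only [Kr, Kf, map_add]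
  congr 1

lemma Kr_ana {ξ : W3 → V5} {w : (ℝ × ℝ) × ℝ} (h : AnalyticAt ℂ ξ (emw w)) :
    AnalyticAt ℝ (fun w : (ℝ × ℝ) × ℝ => Kr ξ w.1 w.2) w := by
  have h1 : AnalyticAt ℝ (Kf ξ) (emw w) := (Kf_ana h).restrictScalars
  have h2 : AnalyticAt ℝ (fun w => Kf ξ (emw w)) w := AnalyticAt.comp (g := Kf ξ) (f := emw) h1 (emw.analyticAt _)
  have h3 := (Lr.analyticAt (Kf ξ (emw w))).comp (f := fun w => Kf ξ (emw w)) h2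
  refine h3.congr (Eventually.of_forall fun w => ?_)
  simp only [Function.comp]
  rw [Kr_Kf]

lemma Kr_deriv {ξ : W3 → V5} {x : ℝ × ℝ} {t : ℝ} (h : AnalyticAt ℂ ξ (emw (x, t))) (y : ℝ × ℝ) :
    fderiv ℝ (fun x' => Kr ξ x' t) x y + deriv (fun s => Kr ξ x s) t = Lr (fderiv ℂ (Kf ξ) (emw (x, t)) (emx y, 1)) := by
  have h1 : HasFDerivAt (Kf ξ) ((fderiv ℂ (Kf ξ) (emw (x, t))).restrictScalars ℝ) (emw (x, t)) :=
    (Kf_ana h).differentiableAt.hasFDerivAt.restrictScalars ℝ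
  have h2 := Lr.hasFDerivAt.comp (x, t) (h1.comp (x, t) emw.hasFDerivAt)
  obtain ⟨A, hA⟩ : ∃ A : (ℝ × ℝ) × ℝ →L[ℝ] E6, A = Lr.comp (((fderiv ℂ (Kf ξ) (emw (x, t))).restrictScalars ℝ).comp emw) := ⟨_, rfl⟩
  have h3 : HasFDerivAt (fun w : (ℝ × ℝ) × ℝ => Kr ξ w.1 w.2) A (x, t) := by
    rw [hA]
    refine h2.congr_of_eventuallyEq (Eventually.of_forall fun w => ?_)
    exact Kr_Kf ξ w.1 w.2
  have h4 : HasFDerivAt (fun x' => Kr ξ x' t) (A.comp (ContinuousLinearMap.inl ℝ (ℝ × ℝ) ℝ)) x := by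
    have hc : HasFDerivAt (fun x' : ℝ × ℝ => (x', t)) (ContinuousLinearMap.inl ℝ (ℝ × ℝ) ℝ) x := hasFDerivAt_prodMk_left x t
    exact HasFDerivAt.comp (g := fun w : (ℝ × ℝ) × ℝ => Kr ξ w.1 w.2) x h3 hc
  have h5 : HasDerivAt (fun s => Kr ξ x s) (A (0, 1)) t := by
    have hc : HasDerivAt (fun s : ℝ => (x, s)) ((0 : ℝ × ℝ), (1:ℝ)) t := (hasDerivAt_const t x).prodMk (hasDerivAt_id t)
    exact HasFDerivAt.comp_hasDerivAt (l := fun w : (ℝ × ℝ) × ℝ => Kr ξ w.1 w.2) t h3 hc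
  rw [h4.fderiv, h5.deriv]
  have : (A.comp (ContinuousLinearMap.inl ℝ (ℝ × ℝ) ℝ)) y + A (0, 1) = A (y, 1) := by
    rw [ContinuousLinearMap.comp_apply, ← map_add]
    simp
  rw [this, hA]
  simp only [ContinuousLinearMap.comp_apply, emw_apply]
  simp

lemma Lr_Xc {k : V5} (hk : RealV k) {a b c d e : ℝ} :
    Lr (Xc k a b c d e) =
      ((-(1/4) * ((k 0).re + (k 2).re) ^ 3 * (k 0).re + ((k 0).re + (k 2).re) ^ 6 * a,
        -(1/4) * ((k 0).re + (k 2).re) ^ 2 * ((k 0).re - (k 2).re) * (k 1).re - (1/2) * ((k 0).re + (k 2).re) ^ 3 * (k 1).re ^ 2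
          + ((k 0).re + (k 2).re) ^ 5 * b),
       ((1/4) * ((k 0).re + (k 2).re) ^ 3 * (k 2).re + ((k 0).re + (k 2).re) ^ 6 * c,
        (1/4) * ((k 0).re + (k 2).re) ^ 2 * ((k 0).re - (k 2).re) * (k 3).re + ((k 0).re + (k 2).re) ^ 5 * d,
        (1/4) * ((k 0).re + (k 2).re) ^ 2 * ((k 0).re - (k 2).re) * (k 4).re + ((k 0).re + (k 2).re) ^ 5 * e, 0)) := by
  have hi : ∀ i, k i = (((k i).re : ℝ) : ℂ) := fun i => Complex.ext (by simp) (by simp [hk i])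
  rw [Lr_apply]
  obtain ⟨κ, hκ⟩ : ∃ κ : Fin 5 → ℝ, κ = fun i => (k i).re := ⟨_, rfl⟩
  have hi' : k = fun i => (κ i : ℂ) := by ext i; rw [hκ]; exact hi i
  clear hκ hi hk
  subst hi'
  simp only [Complex.ofReal_re, Prod.mk.injEq, and_true]
  refine ⟨⟨?_, ?_⟩, ?_, ?_, ?_⟩
  all_goals
    rw [← Complex.ofReal_re (_ + _)]
    congr 1
    simp [Xc]

end PartPG3

section PartPG4
open MeasureTheory
def gamr (γ : ℂ × ℂ → ℂ) (x : ℝ × ℝ) : ℝ := (γ (emx x)).re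
def Yr (γ : ℂ × ℂ → ℂ) (x : ℝ × ℝ) : ℝ × ℝ := -((x.1 ^ 3 * (1/4 + gamr γ x)) • x)

lemma gamr_coe {γ : ℂ × ℂ → ℂ} (h : GH γ) (x : ℝ × ℝ) : γ (emx x) = (gamr γ x : ℂ) :=
  Complex.ext (by simp [gamr]) (by rw [h.2 _ (by simp [emx_apply]) (by simp [emx_apply])]; simp)

lemma gamr_hom {γ : ℂ × ℂ → ℂ} (h : GH γ) (c : ℝ) (x : ℝ × ℝ) : gamr γ (c • x) = c ^ 3 * gamr γ x := by
  have h1 : emx (c • x) = (c : ℂ) • emx x := by simp [emx_apply]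
  have h2 := h.hom (c : ℂ) (emx x)
  rw [← h1, gamr_coe h, gamr_coe h] at h2
  exact_mod_cast h2

lemma gamr_cont {γ : ℂ × ℂ → ℂ} (h : GH γ) : Continuous (gamr γ) := by
  have : Continuous γ := continuous_iff_continuousAt.2 fun x => (h.ana x).continuousAt
  exact Complex.continuous_re.comp (this.comp emx.continuous)

lemma Yr_coe {γ : ℂ × ℂ → ℂ} (h : GH γ) (x : ℝ × ℝ) :
    emx (Yr γ x) = -(((emx x).1 ^ 3 * (1/4 + γ (emx x))) • emx x) := by
  rw [gamr_coe h]
  simp [Yr, emx_apply]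

lemma invariance {X : E6 → ℝ → E6} {Ru RΘ Rv Rα RA : E6 → ℝ → ℝ}
    (hX : ∀ z : (ℝ × ℝ) × (ℝ × ℝ × ℝ × ℝ), ∀ t : ℝ,
      X z t =
        ((-(1/4) * (z.1.1 + z.2.1) ^ 3 * z.1.1 + (z.1.1 + z.2.1) ^ 6 * Ru z t,
          -(1/4) * (z.1.1 + z.2.1) ^ 2 * (z.1.1 - z.2.1) * z.1.2
            - (1/2) * (z.1.1 + z.2.1) ^ 3 * z.1.2 ^ 2 + (z.1.1 + z.2.1) ^ 5 * RΘ z t),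
         ((1/4) * (z.1.1 + z.2.1) ^ 3 * z.2.1 + (z.1.1 + z.2.1) ^ 6 * Rv z t,
          ((1/4) * (z.1.1 + z.2.1) ^ 2 * (z.1.1 - z.2.1) * z.2.2.1
              + (z.1.1 + z.2.1) ^ 5 * Rα z t,
           ((1/4) * (z.1.1 + z.2.1) ^ 2 * (z.1.1 - z.2.1) * z.2.2.2.1
              + (z.1.1 + z.2.1) ^ 5 * RA z t,
            (1/4) * (z.1.1 + z.2.1) ^ 2 * (z.1.1 - z.2.1) * z.2.2.2.2
              + (1/2) * (z.1.1 + z.2.1) ^ 3 * z.2.2.2.2 * z.1.2)))))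
    {r : ℝ} {g1 g2 g3 g4 g5 : (Fin 7 → ℂ) → ℂ} (hr : 0 < r) (hr1 : r ≤ 1)
    (h1 : ∀ v : Fin 7 → ℝ, (∀ i, i ≠ 6 → |v i| < 4 * r) → g1 (toC v) = Ru (asm v).1 (asm v).2)
    (h2 : ∀ v : Fin 7 → ℝ, (∀ i, i ≠ 6 → |v i| < 4 * r) → g2 (toC v) = RΘ (asm v).1 (asm v).2)
    (h3 : ∀ v : Fin 7 → ℝ, (∀ i, i ≠ 6 → |v i| < 4 * r) → g3 (toC v) = Rv (asm v).1 (asm v).2)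
    (h4 : ∀ v : Fin 7 → ℝ, (∀ i, i ≠ 6 → |v i| < 4 * r) → g4 (toC v) = Rα (asm v).1 (asm v).2)
    (h5 : ∀ v : Fin 7 → ℝ, (∀ i, i ≠ 6 → |v i| < 4 * r) → g5 (toC v) = RA (asm v).1 (asm v).2)
    {γ : ℂ × ℂ → ℂ} (hγ : GH γ) {ξ : W3 → V5} {x : ℝ × ℝ} {t : ℝ} (hξ : AnalyticAt ℂ ξ (emw (x, t)))
    (hx : ‖x‖ < r) (hξr : ‖ξ (emw (x, t))‖ < r) (hre : RealV (ξ (emw (x, t))))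
    (hp : fderiv ℂ ξ (emw (x, t)) (-(((emw (x, t)).1.1 ^ 3 * (1/4 + γ (emw (x, t)).1)) • (emw (x, t)).1), 1) =
      (emw (x, t)).1.1 ^ 3 • Fg γ (F0c g1 g2 g3 g4 g5) (emw (x, t)).1 (ξ (emw (x, t))) (emw (x, t)).2) :
    X (Kr ξ x t) t = fderiv ℝ (fun x' => Kr ξ x' t) x (Yr γ x) + deriv (fun s => Kr ξ x s) t := by
  rw [Kr_deriv hξ, Yr_coe hγ]
  have hk := Kf_pde hξ hp
  have e0 : (emw (x, t)).1 = emx x := rfl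
  have e1 := Zarg_Kf ξ (emw (x, t))
  have hkr := Kf_real (emw_real (x, t)) hre
  have hm : Zarg (emw (x, t)).1 (ξ (emw (x, t))) (emw (x, t)).2 ∈ cDom (4 * r) :=
    Zarg_mem hr hr1 ⟨by rw [e0, emx_norm]; exact hx, hξr, by simpa [emw_apply] using hr⟩
  have hKr := Kr_Kf ξ x t
  obtain ⟨k, hke⟩ : ∃ k, k = Kf ξ (emw (x, t)) := ⟨_, rfl⟩
  obtain ⟨Z, hZ⟩ : ∃ Z, Z = Zarg (emw (x, t)).1 (ξ (emw (x, t))) (emw (x, t)).2 := ⟨_, rfl⟩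
  rw [← hke] at hk e1 hkr hKr
  rw [← hZ] at hk e1 hm
  have e2 : (emw (x, t)).2 = (t : ℂ) := rfl
  rw [e2] at e1
  rw [← e0, hk]
  obtain ⟨v, hv⟩ : ∃ v : Fin 7 → ℝ, v = ![(k 0).re, (k 1).re, (k 2).re, (k 3).re, (k 4).re, 0, t] := ⟨_, rfl⟩
  have hi : ∀ i, k i = (((k i).re : ℝ) : ℂ) := fun i => Complex.ext (by simp) (by simp [hkr i])
  have hZv : Z = toC v := by
    rw [e1, hv]
    ext i
    fin_cases i
    · exact hi 0
    · exact hi 1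
    · exact hi 2
    · exact hi 3
    · exact hi 4
    · simp [toC]
    · simp [toC]
  have hvm : ∀ i, i ≠ 6 → |v i| < 4 * r := by
    intro i hi
    have := hm.1 i hi
    rw [hZv] at this
    simpa [toC] using this
  have ha : asm v = (Kr ξ x t, t) := by
    rw [hKr, Lr_apply, hv]
    rfl
  rw [hZv, h1 v hvm, h2 v hvm, h3 v hvm, h4 v hvm, h5 v hvm, Lr_Xc hkr, hX, ha]
  simp only
  obtain ⟨q, hq⟩ : ∃ q, q = Kr ξ x t := ⟨_, rfl⟩
  rw [← hq] at hKr ⊢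
  have q1 : q.1.1 = (k 0).re := by rw [hKr]; rfl
  have q2 : q.1.2 = (k 1).re := by rw [hKr]; rfl
  have q3 : q.2.1 = (k 2).re := by rw [hKr]; rfl
  have q4 : q.2.2.1 = (k 3).re := by rw [hKr]; rfl
  have q5 : q.2.2.2.1 = (k 4).re := by rw [hKr]; rfl
  have q6 : q.2.2.2.2 = 0 := by rw [hKr]; rfl
  rw [q1, q2, q3, q4, q5, q6]
  simp

end PartPG4

section PartPG5
open MeasureTheory
/-- forward solutions of the reduced field decay to the origin -/
lemma stab {γ : ℂ × ℂ → ℂ} (hγ : GH γ) {ρ : ℝ} (hg : ∀ x, ‖x‖ < ρ → ‖γ x‖ < 1/100) {x : ℝ × ℝ}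
    (hx : x ∈ {x : ℝ × ℝ | 0 < x.1 ∧ 0 < x.2} ∩ ball 0 ρ) {ψ : ℝ → ℝ × ℝ} (h0 : ψ 0 = x)
    (hd : ∀ u : ℝ, 0 ≤ u → HasDerivAt ψ (Yr γ (ψ u)) u) :
    (∀ u : ℝ, 0 ≤ u → ψ u ∈ {x : ℝ × ℝ | 0 < x.1 ∧ 0 < x.2} ∩ ball 0 ρ) ∧ Tendsto ψ atTop (𝓝 0) := by
  obtain ⟨⟨hx1, hx2⟩, hxρ⟩ := hx
  rw [mem_ball_zero_iff] at hxρ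
  obtain ⟨g, hgd⟩ : ∃ g : ℝ × ℝ → ℝ, g = fun x => x.1 ^ 3 * (1/4 + gamr γ x) := ⟨_, rfl⟩
  have hgc : Continuous g := by
    rw [hgd]
    have := gamr_cont hγ
    fun_prop
  have hψc : Continuous fun s : ℝ => g (ψ (max s 0)) := by
    refine hgc.comp (continuous_iff_continuousAt.2 fun s => ?_)
    exact ContinuousAt.comp (g := ψ) (f := fun s : ℝ => max s 0) (hd _ (le_max_right _ _)).continuousAt (by fun_prop)
  obtain ⟨G, hG⟩ : ∃ G : ℝ → ℝ, G = fun u => ∫ s in (0:ℝ)..u, g (ψ (max s 0)) := ⟨_, rfl⟩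
  have hG0 : G 0 = 0 := by rw [hG]; simp
  have hGd : ∀ u, 0 ≤ u → HasDerivAt G (g (ψ u)) u := by
    intro u hu
    rw [hG]
    have := hψc.integral_hasStrictDerivAt 0 u
    simpa [max_eq_left hu] using this.hasDerivAt
  have hE : ∀ u, 0 ≤ u → HasDerivAt (fun u => Real.exp (G u) • ψ u) 0 u := by
    intro u hu
    have h1 := (hGd u hu).exp.smul (hd u hu)
    refine h1.congr_deriv ?_
    rw [Yr, hgd]
    module
  have hψ : ∀ u, 0 ≤ u → ψ u = Real.exp (-G u) • x := by
    intro u hu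
    have h1 := constant_of_has_deriv_right_zero (f := fun u => Real.exp (G u) • ψ u) (a := 0) (b := u)
      (fun s hs => (hE s hs.1).continuousAt.continuousWithinAt) (fun s hs => (hE s hs.1).hasDerivWithinAt) u ⟨hu, le_rfl⟩
    simp only [hG0, Real.exp_zero, one_smul, h0] at h1
    rw [← h1, smul_smul, ← Real.exp_add]
    simp
  obtain ⟨κ, hκ⟩ : ∃ κ : ℝ → ℝ, κ = fun u => Real.exp (-G u) := ⟨_, rfl⟩
  have hκp : ∀ u, 0 < κ u := fun u => by rw [hκ]; exact Real.exp_pos _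
  have hψκ : ∀ u, 0 ≤ u → ψ u = κ u • x := fun u hu => by rw [hψ u hu, hκ]
  have hκd : ∀ u, 0 ≤ u → HasDerivAt κ (-(κ u * g (ψ u))) u := by
    intro u hu
    rw [hκ]
    refine (hGd u hu).neg.exp.congr_deriv ?_
    simp only [Pi.neg_apply]
    ring
  have hγx : |gamr γ x| < 1/100 := by
    refine lt_of_le_of_lt (Complex.abs_re_le_norm _) (hg _ ?_)
    rwa [emx_norm]
  have hgx : ∀ u, 0 ≤ u → g (ψ u) = κ u ^ 3 * x.1 ^ 3 * (1/4 + κ u ^ 3 * gamr γ x) := by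
    intro u hu
    rw [hψκ u hu, hgd]
    simp only [gamr_hom hγ, Prod.smul_fst, smul_eq_mul]
    ring
  have hx3 : 0 < x.1 ^ 3 := by positivity
  have hκ1 : ∀ u, 0 ≤ u → κ u ≤ 1 := by
    intro u hu
    have := image_le_of_deriv_right_lt_deriv_boundary' (f := κ) (f' := fun u => -(κ u * g (ψ u))) (a := 0) (b := u)
      (fun s hs => (hκd s hs.1).continuousAt.continuousWithinAt) (fun s hs => (hκd s hs.1).hasDerivWithinAt)
      (B := fun _ => 1) (B' := fun _ => 0) (by rw [hκ]; simp [hG0]) continuousOn_const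
      (fun s _ => hasDerivWithinAt_const _ _ _) (by
        intro s hs h1
        rw [hgx s hs.1, h1]
        have := (abs_lt.1 hγx).1
        have : 0 < x.1 ^ 3 * (1/4 + gamr γ x) := mul_pos hx3 (by linarith)
        simp only [one_pow, one_mul]
        linarith)
    exact this ⟨hu, le_rfl⟩
  refine ⟨fun u hu => ?_, ?_⟩
  · have hk := hκp u
    rw [hψκ u hu]
    refine ⟨⟨?_, ?_⟩, ?_⟩
    · simp only [Prod.smul_fst, smul_eq_mul]; positivity
    · simp only [Prod.smul_snd, smul_eq_mul]; positivity
    · rw [mem_ball_zero_iff, norm_smul, Real.norm_of_nonneg hk.le]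
      nlinarith [hκ1 u hu, norm_nonneg x]
  · have hH : ∀ u, 0 ≤ u → HasDerivAt (fun u => Real.exp (3 * G u)) (Real.exp (3 * G u) * (3 * g (ψ u))) u := fun u hu =>
      ((hGd u hu).const_mul 3).exp
    have hHd : ∀ u, 0 ≤ u → x.1 ^ 3 / 2 ≤ Real.exp (3 * G u) * (3 * g (ψ u)) := by
      intro u hu
      have e : Real.exp (3 * G u) * κ u ^ 3 = 1 := by
        rw [hκ]
        simp only
        rw [← Real.exp_nat_mul, ← Real.exp_add]
        norm_num
      rw [hgx u hu]
      have : Real.exp (3 * G u) * (3 * (κ u ^ 3 * x.1 ^ 3 * (1/4 + κ u ^ 3 * gamr γ x))) =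
        (Real.exp (3 * G u) * κ u ^ 3) * (3 * (x.1 ^ 3 * (1/4 + κ u ^ 3 * gamr γ x))) := by ring
      rw [this, e, one_mul]
      have hk3 : κ u ^ 3 ≤ 1 := pow_le_one₀ (hκp u).le (hκ1 u hu)
      have hk3' : 0 < κ u ^ 3 := pow_pos (hκp u) 3
      have h2 : -(1/100) ≤ κ u ^ 3 * gamr γ x := by nlinarith [(abs_lt.1 hγx).1]
      nlinarith
    have hge : ∀ u, 0 ≤ u → x.1 ^ 3 / 2 * u ≤ Real.exp (3 * G u) := by
      intro u hu
      have := Convex.mul_sub_le_image_sub_of_le_deriv (convex_Ici (0:ℝ)) (f := fun u => Real.exp (3 * G u))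
        (fun s hs => (hH s hs).continuousAt.continuousWithinAt)
        (fun s hs => (hH s (interior_subset hs)).differentiableAt.differentiableWithinAt)
        (C := x.1 ^ 3 / 2) (fun s hs => by rw [(hH s (interior_subset hs)).deriv]; exact hHd s (interior_subset hs))
        0 self_mem_Ici u hu hu
      simp only [hG0] at this
      norm_num at this
      linarith
    have ht : Tendsto (fun u => Real.exp (3 * G u)) atTop atTop := by
      refine tendsto_atTop_mono' atTop ?_ (tendsto_id.const_mul_atTop (show 0 < x.1 ^ 3 / 2 by positivity))
      filter_upwards [eventually_ge_atTop 0] with u hu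
      exact hge u hu
    rw [Real.tendsto_exp_comp_atTop] at ht
    have ht2 : Tendsto G atTop atTop := by
      have := ht.const_mul_atTop (show (0:ℝ) < 1/3 by norm_num)
      refine this.congr fun u => by ring
    have ht3 : Tendsto (fun u => Real.exp (-G u)) atTop (𝓝 0) := Real.tendsto_exp_neg_atTop_nhds_zero.comp ht2
    have ht4 := ht3.smul_const x
    rw [zero_smul] at ht4
    refine ht4.congr' ?_
    filter_upwards [eventually_ge_atTop 0] with u hu
    exact (hψ u hu).symm

end PartPG5

section PartPG6
open MeasureTheory
lemma hp_smul {E G : Type*} [NormedAddCommGroup E] [NormedSpace ℝ E] [NormedAddCommGroup G] [NormedSpace ℝ G] {N : ℕ}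
    {f : E → ℝ} (hf : IsHomogPoly N f) (l : E →L[ℝ] G) : IsHomogPoly (N + 1) fun x => f x • l x := by
  obtain ⟨P, hP⟩ := hf
  refine ⟨(P.smulRight l).uncurryRight, fun x => ?_⟩
  show f x • l x = _
  rw [ContinuousMultilinearMap.uncurryRight_apply, hP]
  rfl

lemma hp_a3 {N : ℕ} {f : ℝ × ℝ → ℝ} (hf : IsHomogPoly N f) : IsHomogPoly (N + 4) fun x : ℝ × ℝ => -((x.1 ^ 3 * f x) • x) := by
  have h := hp_smul (hp_smul (hp_smul (hp_smul hf (ContinuousLinearMap.fst ℝ ℝ ℝ)) (ContinuousLinearMap.fst ℝ ℝ ℝ))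
    (ContinuousLinearMap.fst ℝ ℝ ℝ)) (-ContinuousLinearMap.id ℝ (ℝ × ℝ))
  obtain ⟨P, hP⟩ := h
  refine ⟨P, fun x => ?_⟩
  rw [← hP]
  simp only [ContinuousLinearMap.coe_fst', smul_eq_mul, neg_apply, ContinuousLinearMap.id_apply, smul_neg]
  congr 2
  ring

lemma hp_gamr {γ : ℂ × ℂ → ℂ} (h : GH γ) : IsHomogPoly 3 (gamr γ) := by
  obtain ⟨⟨p, hp⟩, -⟩ := h
  refine ⟨(Complex.reCLM.compContinuousMultilinearMap (p.restrictScalars ℝ)).compContinuousLinearMap (fun _ => emx), fun x => ?_⟩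
  simp [gamr, hp]

lemma hp_Lr {j : ℕ} (p : ContinuousMultilinearMap ℂ (fun _ : Fin j => ℂ × ℂ) V5) :
    IsHomogPoly j fun x : ℝ × ℝ => Lr (p fun _ => emx x) :=
  ⟨(Lr.compContinuousMultilinearMap (p.restrictScalars ℝ)).compContinuousLinearMap (fun _ => emx), fun x => rfl⟩

lemma hp_zero {E G : Type*} [NormedAddCommGroup E] [NormedSpace ℝ E] [NormedAddCommGroup G] [NormedSpace ℝ G] (N : ℕ) :
    IsHomogPoly N (fun _ : E => (0 : G)) := ⟨0, fun x => rfl⟩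

lemma Yr_poly {γ : ℂ × ℂ → ℂ} (h : GH γ) : ∃ Yj : ℕ → ℝ × ℝ → ℝ × ℝ, (∀ j, IsHomogPoly j (Yj j)) ∧
    ∀ x, Yr γ x = ∑ j ∈ Finset.range 8, Yj j x := by
  refine ⟨fun j x => if j = 4 then -((x.1 ^ 3 * (1/4)) • x) else if j = 7 then -((x.1 ^ 3 * gamr γ x) • x) else 0, fun j => ?_, fun x => ?_⟩
  · by_cases h4 : j = 4
    · subst h4
      simp only [if_true]
      have h0 : IsHomogPoly 0 (fun _ : ℝ × ℝ => (1/4 : ℝ)) := 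
        ⟨ContinuousMultilinearMap.constOfIsEmpty ℝ (fun _ : Fin 0 => ℝ × ℝ) (1/4), fun x => rfl⟩
      exact hp_a3 h0
    · by_cases h7 : j = 7
      · subst h7
        exact hp_a3 (hp_gamr h)
      · simp only [h4, h7, if_false]
        exact hp_zero j
  · simp only [Finset.sum_range_succ, Finset.sum_range_zero, Yr]
    norm_num
    module

lemma Yr_bound {γ : ℂ × ℂ → ℂ} (h : GH γ) : ∃ C : ℝ, ∀ x : ℝ × ℝ, ‖x‖ ≤ 1 →
    ‖Yr γ x - (-(1/4) * x.1 ^ 3 * x.1, -(1/4) * x.1 ^ 2 * x.1 * x.2)‖ ≤ C * ‖x‖ ^ 5 := by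
  obtain ⟨C, hC, hb⟩ := h.bound
  refine ⟨C, fun x hx => ?_⟩
  have e : Yr γ x - (-(1/4) * x.1 ^ 3 * x.1, -(1/4) * x.1 ^ 2 * x.1 * x.2) = -((x.1 ^ 3 * gamr γ x) • x) := by
    ext
    · simp [Yr]; ring
    · simp [Yr]; ring
  rw [e, norm_neg, norm_smul, norm_mul, norm_pow]
  have h1 : ‖x.1‖ ≤ ‖x‖ := norm_fst_le x
  have h2 : ‖gamr γ x‖ ≤ C * ‖x‖ ^ 3 := by
    have := hb (emx x)
    rw [emx_norm] at this
    exact (Complex.abs_re_le_norm _).trans this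
  have h3 : ‖x‖ ^ 7 ≤ ‖x‖ ^ 5 := pow_le_pow_of_le_one (norm_nonneg _) hx (by norm_num)
  calc ‖x.1‖ ^ 3 * ‖gamr γ x‖ * ‖x‖ ≤ ‖x‖ ^ 3 * (C * ‖x‖ ^ 3) * ‖x‖ := by gcongr
    _ = C * ‖x‖ ^ 7 := by ring
    _ ≤ C * ‖x‖ ^ 5 := by gcongr

lemma Kr_bound {ξ : W3 → V5} {B : ℝ} {x : ℝ × ℝ} {t : ℝ} (hx : ‖x‖ ≤ 1) (hb : ‖ξ (emw (x, t))‖ ≤ B * ‖x‖ ^ 2) :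
    ‖Kr ξ x t - (x, 0)‖ ≤ 2 * B * ‖x‖ ^ 2 := by
  have : Kr ξ x t - (x, 0) = Lr (Qm (emx x) (ξ (emw (x, t)))) := by simp [Kr]
  rw [this]
  refine (Lr_norm _).trans ((Qm_norm (by rwa [emx_norm]) _).trans ?_)
  linarith

lemma expansion {ξ P : W3 → V5} {ρ B B0 : ℝ} {ℓ : ℕ} (hℓ : 7 ≤ ℓ) (hρ1 : ρ ≤ 1)
    (hB0 : ∀ x : ℝ × ℝ, 0 < x.1 → ‖x‖ < ρ → ∀ t : ℝ, ‖ξ (emw (x, t))‖ ≤ B0 * ‖x‖ ^ 2)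
    (h1 : ∀ᶠ w in lW, AnalyticAt ℂ P w) (h2 : ∀ᶠ w in lW, P (w.1, w.2 + tpi) = P w) (h4 : wO P 2)
    {ρ' : ℝ} (hρ' : 0 < ρ') (h5 : ∀ w ∈ Ud ρ', RealW w → ‖ξ w - P w‖ ≤ B * ‖w.1‖ ^ (ℓ + 1)) :
    ∃ Kb : ℕ → ℝ × ℝ → ℝ → E6, (∀ j t, IsHomogPoly j fun x => Kb j x t) ∧
      (∀ j x t, Kb j x (t + 2 * Real.pi) = Kb j x t) ∧
      ∃ C : ℝ, ∀ x : ℝ × ℝ, 0 < x.1 → ‖x‖ < ρ → ∀ t : ℝ,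
        ‖Kr ξ x t - (x, 0) - ∑ j ∈ Finset.Icc 2 ℓ, Kb j x t‖ ≤ C * ‖x‖ ^ (ℓ + 1) := by
  obtain ⟨A, hA, h4⟩ := wO_iff_ev.1 h4
  obtain ⟨ρ₁, hρ₁, hh⟩ := lW_iff.1 (h1.and (h2.and h4))
  obtain ⟨s, hs, hs1, hs2, hs3⟩ : ∃ s > 0, s ≤ ρ₁ ∧ s ≤ ρ' ∧ s ≤ 1 := 
    ⟨min (min ρ₁ ρ') 1, by positivity, (min_le_left _ _).trans (min_le_left _ _), (min_le_left _ _).trans (min_le_right _ _), min_le_right _ _⟩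
  have hmem : ∀ (x : ℂ × ℂ) (t : ℝ), ‖x‖ < s → ((x, (t:ℂ)) : W3) ∈ Wd ρ₁ := fun x t hx =>
    ⟨hx.trans_le hs1, by simpa using hρ₁⟩
  have hpi := Real.two_pi_pos
  obtain ⟨m, rfl⟩ : ∃ m, ℓ = m + 1 := ⟨ℓ - 1, by omega⟩
  obtain ⟨p, D, hD, hp1, hp2⟩ := taylor_unif (f := fun t x => Qm x (P (x, ((toIcoMod hpi 0 t : ℝ) : ℂ)))) hs
    (show 0 ≤ 2 * A by positivity) (by
      intro t x hx
      have := (hh _ (hmem x (toIcoMod hpi 0 t) hx)).1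
      refine AnalyticAt.comp (g := fun w : W3 => Qm w.1 (P w)) (f := fun x : ℂ × ℂ => ((x, ((toIcoMod hpi 0 t : ℝ) : ℂ)) : W3)) 
        (Qm_ana this) (by fun_prop)) (by
      intro t x hx
      have := (hh _ (hmem x (toIcoMod hpi 0 t) hx)).2.2
      refine (Qm_norm (hx.le.trans hs3) _).trans ?_
      simp only at this
      linarith) m
  have hper : ∀ (x : ℂ × ℂ) (t : ℝ), ‖x‖ < s → P (x, ((toIcoMod hpi 0 t : ℝ) : ℂ)) = P (x, (t:ℂ)) := by
    intro x t hx
    have hP : Function.Periodic (fun t : ℝ => P (x, (t:ℂ))) (2 * Real.pi) := by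
      intro t
      have := (hh _ (hmem x t hx)).2.1
      simpa [tpi] using this
    have h := hP.sub_zsmul_eq (x := t) (toIcoDiv hpi 0 t)
    exact h
  refine ⟨fun j x t => Lr (p j (toIcoMod hpi 0 t) fun _ => emx x), fun j t => hp_Lr _, fun j x t => ?_, ?_⟩
  · simp only [toIcoMod_add_right]
  have hid : ∀ t : ℝ, toIcoMod hpi 0 (toIcoMod hpi 0 t) = toIcoMod hpi 0 t := fun t => by simp
  obtain ⟨M, hM⟩ : ∃ M, M = 2 * |B0| + (Finset.Icc 2 (m + 1)).card * D := ⟨_, rfl⟩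
  have hM0 : 0 ≤ M := by rw [hM]; positivity
  refine ⟨max (2 * B + D) (M / s ^ (m + 1 + 1)), fun x hx0 hx t => ?_⟩
  have eK : Kr ξ x t - (x, 0) = Lr (Qm (emx x) (ξ (emw (x, t)))) := by simp [Kr]
  by_cases hxs : ‖x‖ < s
  · have hxs' : ‖emx x‖ < s := by rwa [emx_norm]
    have a1 := hp2 (toIcoMod hpi 0 t) (emx x) hxs'
    simp only [hid] at a1
    rw [hper _ _ hxs'] at a1
    have a2 := h5 (emw (x, t)) (emw_Ud hρ' hx0 (hxs.trans_le hs2) t) (emw_real _)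
    have a3 := Qm_norm (x := emx x) (hxs'.le.trans hs3) (ξ (emw (x, t)) - P (emw (x, t)))
    rw [← Qm_sub] at a3
    have e1 : (emw (x, t)).1 = emx x := rfl
    rw [e1] at a2
    rw [emx_norm] at a1 a2
    have e2 : emw (x, t) = (emx x, (t:ℂ)) := rfl
    rw [eK, ← map_sum, ← map_sub]
    refine (Lr_norm _).trans ?_
    have hIcc : Finset.Icc 2 (m + 1) = Finset.Ico 2 (m + 2) := by
      ext i; simp only [Finset.mem_Icc, Finset.mem_Ico]; omega
    rw [hIcc]
    have e3 : Qm (emx x) (ξ (emw (x, t))) - ∑ j ∈ Finset.Ico 2 (m + 2), (p j (toIcoMod hpi 0 t) fun _ => emx x) =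
      (Qm (emx x) (ξ (emw (x, t))) - Qm (emx x) (P (emw (x, t)))) + 
      (Qm (emx x) (P (emx x, (t:ℂ))) - ∑ j ∈ Finset.Ico 2 (m + 2), (p j (toIcoMod hpi 0 t) fun _ => emx x)) := by
      rw [e2]; abel
    rw [e3]
    refine (norm_add_le _ _).trans ?_
    have : 2 * B + D ≤ max (2 * B + D) (M / s ^ (m + 1 + 1)) := le_max_left _ _
    have h6 := mul_le_mul_of_nonneg_right this (pow_nonneg (norm_nonneg x) (m + 1 + 1))
    refine le_trans ?_ h6
    have : m + 1 + 1 = m + 2 := rfl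
    rw [this] at a2 ⊢
    linarith
  · push Not at hxs
    have hx1 : ‖x‖ ≤ 1 := hx.le.trans hρ1
    have b1 := Kr_bound hx1 ((hB0 x hx0 hx t).trans (mul_le_mul_of_nonneg_right (le_abs_self B0) (by positivity)))
    have b2 : ‖x‖ ^ 2 ≤ 1 := pow_le_one₀ (norm_nonneg _) hx1
    have b3 : ‖∑ j ∈ Finset.Icc 2 (m + 1), Lr (p j (toIcoMod hpi 0 t) fun _ => emx x)‖ ≤ (Finset.Icc 2 (m + 1)).card * D := by
      refine (norm_sum_le_of_le _ (f := fun j => Lr (p j (toIcoMod hpi 0 t) fun _ => emx x)) (n := fun _ => D) fun j _ => ?_).trans ?_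
      · refine (Lr_norm _).trans ((hp1 j _ _).trans ?_)
        rw [emx_norm]
        exact mul_le_of_le_one_right hD (pow_le_one₀ (norm_nonneg _) hx1)
      · simp
    have b4 : ‖Kr ξ x t - (x, 0) - ∑ j ∈ Finset.Icc 2 (m + 1), Lr (p j (toIcoMod hpi 0 t) fun _ => emx x)‖ ≤ M := by
      refine (norm_sub_le _ _).trans ?_
      rw [hM]
      refine add_le_add (b1.trans ?_) b3
      nlinarith [abs_nonneg B0]
    refine b4.trans ?_
    have hsp : 0 < s ^ (m + 1 + 1) := by positivity
    calc M = M / s ^ (m + 1 + 1) * s ^ (m + 1 + 1) := by field_simp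
      _ ≤ max (2 * B + D) (M / s ^ (m + 1 + 1)) * ‖x‖ ^ (m + 1 + 1) := by
        refine mul_le_mul (le_max_right _ _) (pow_le_pow_left₀ hs.le hxs _) hsp.le ?_
        exact le_max_of_le_right (by positivity)

end PartPG6

open Real in
/-- Theorem 5.1: the parabolic infinity of (perturbations of) the elliptic
spatial restricted three body problem, in McGehee-type coordinates, has an analytic stable
invariant two-dimensional manifold admitting polynomial approximation at the origin up to
any order.  Coordinates: `z = ((u, Θ̂), (v, α̂, Â, θ̂))`. -/
theorem restricted_three_body_parabolic_infinity_stable_manifold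
    (X : (ℝ × ℝ) × (ℝ × ℝ × ℝ × ℝ) → ℝ → (ℝ × ℝ) × (ℝ × ℝ × ℝ × ℝ))
    (Ru RΘ Rv Rα RA : (ℝ × ℝ) × (ℝ × ℝ × ℝ × ℝ) → ℝ → ℝ)
    -- each `O₀` is analytic near the origin, and 2π-periodic and analytic in `t`
    (hO : ∀ Rr ∈ ({Ru, RΘ, Rv, Rα, RA} :
        Set ((ℝ × ℝ) × (ℝ × ℝ × ℝ × ℝ) → ℝ → ℝ)),
      (∃ ε > (0 : ℝ), AnalyticOnNhd ℝ
        (fun w : ((ℝ × ℝ) × (ℝ × ℝ × ℝ × ℝ)) × ℝ => Rr w.1 w.2)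
        (ball 0 ε ×ˢ (univ : Set ℝ))) ∧
      ∀ z t, Rr z (t + 2 * π) = Rr z t)
    -- the vector field has the stated form
    (hX : ∀ z : (ℝ × ℝ) × (ℝ × ℝ × ℝ × ℝ), ∀ t : ℝ,
      X z t =
        ((-(1/4) * (z.1.1 + z.2.1) ^ 3 * z.1.1 + (z.1.1 + z.2.1) ^ 6 * Ru z t,
          -(1/4) * (z.1.1 + z.2.1) ^ 2 * (z.1.1 - z.2.1) * z.1.2
            - (1/2) * (z.1.1 + z.2.1) ^ 3 * z.1.2 ^ 2 + (z.1.1 + z.2.1) ^ 5 * RΘ z t),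
         ((1/4) * (z.1.1 + z.2.1) ^ 3 * z.2.1 + (z.1.1 + z.2.1) ^ 6 * Rv z t,
          ((1/4) * (z.1.1 + z.2.1) ^ 2 * (z.1.1 - z.2.1) * z.2.2.1
              + (z.1.1 + z.2.1) ^ 5 * Rα z t,
           ((1/4) * (z.1.1 + z.2.1) ^ 2 * (z.1.1 - z.2.1) * z.2.2.2.1
              + (z.1.1 + z.2.1) ^ 5 * RA z t,
            (1/4) * (z.1.1 + z.2.1) ^ 2 * (z.1.1 - z.2.1) * z.2.2.2.2
              + (1/2) * (z.1.1 + z.2.1) ^ 3 * z.2.2.2.2 * z.1.2))))) :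
    -- the origin is a parabolic fixed point: X(0,t) = 0 (and the linear part vanishes)
    (∀ t, X 0 t = 0) ∧
    -- stable manifold over the region {u > 0, Θ̂ > 0}
    ∃ ρ > (0 : ℝ),
      ∀ D : Set (ℝ × ℝ), D = {x : ℝ × ℝ | 0 < x.1 ∧ 0 < x.2} ∩ ball 0 ρ →
      ∃ K : ℝ × ℝ → ℝ → (ℝ × ℝ) × (ℝ × ℝ × ℝ × ℝ), ∃ Y : ℝ × ℝ → ℝ × ℝ,
        -- K(x,t) = (x,0) + K̃(x,t) with K̃ = O(‖x‖²), 2π-periodic in t, analytic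
        (∃ C : ℝ, ∀ x ∈ D, ∀ t : ℝ, ‖K x t - (x, 0)‖ ≤ C * ‖x‖ ^ 2) ∧
        (∀ x t, K x (t + 2 * π) = K x t) ∧
        AnalyticOnNhd ℝ (fun w : (ℝ × ℝ) × ℝ => K w.1 w.2) (D ×ˢ (univ : Set ℝ)) ∧
        -- the invariance equation X(K(x,t),t) = DK(x,t)·Y(x) + ∂ₜK(x,t)
        (∀ x ∈ D, ∀ t : ℝ,
          X (K x t) t =
            fderiv ℝ (fun x' => K x' t) x (Y x) + deriv (fun s => K x s) t) ∧
        -- Y is a polynomial of degree 7 with Y(x) = p(x,0) + O(‖x‖⁵)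
        (∃ Yj : ℕ → ℝ × ℝ → ℝ × ℝ, (∀ j, IsHomogPoly j (Yj j)) ∧
          ∀ x, Y x = ∑ j ∈ Finset.range 8, Yj j x) ∧
        (∃ C : ℝ, ∀ x ∈ D,
          ‖Y x - (-(1/4) * x.1 ^ 3 * x.1, -(1/4) * x.1 ^ 2 * x.1 * x.2)‖ ≤ C * ‖x‖ ^ 5) ∧
        -- stability: forward solutions of ẋ = Y(x) starting in D stay in D and tend to 0
        (∀ x ∈ D, ∀ ψ : ℝ → ℝ × ℝ, ψ 0 = x →
          (∀ u : ℝ, 0 ≤ u → HasDerivAt ψ (Y (ψ u)) u) →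
          (∀ u : ℝ, 0 ≤ u → ψ u ∈ D) ∧ Tendsto ψ atTop (𝓝 0)) ∧
        -- polynomial approximation of the manifold at the origin up to any order
        (∀ ℓ : ℕ, 7 ≤ ℓ →
          ∃ Kb : ℕ → ℝ × ℝ → ℝ → (ℝ × ℝ) × (ℝ × ℝ × ℝ × ℝ),
            (∀ j t, IsHomogPoly j fun x => Kb j x t) ∧
            (∀ j x t, Kb j x (t + 2 * π) = Kb j x t) ∧
            ∃ C : ℝ, ∀ x ∈ D, ∀ t : ℝ,
              ‖K x t - (x, 0) - ∑ j ∈ Finset.Icc 2 ℓ, Kb j x t‖ ≤ C * ‖x‖ ^ (ℓ + 1)) := by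
  classical
  refine ⟨fun t => by rw [hX]; simp, ?_⟩
  obtain ⟨r1, hr1, C1, g1, G1, E1⟩ := rem_c (hO Ru (by simp))
  obtain ⟨r2, hr2, C2, g2, G2, E2⟩ := rem_c (hO RΘ (by simp))
  obtain ⟨r3, hr3, C3, g3, G3, E3⟩ := rem_c (hO Rv (by simp))
  obtain ⟨r4, hr4, C4, g4, G4, E4⟩ := rem_c (hO Rα (by simp))
  obtain ⟨r5, hr5, C5, g5, G5, E5⟩ := rem_c (hO RA (by simp))
  obtain ⟨r, hr, hr1', k1, k2, k3, k4, k5⟩ : ∃ r : ℝ, 0 < r ∧ r ≤ 1 ∧ 16 * r ≤ r1 ∧ 16 * r ≤ r2 ∧ 16 * r ≤ r3 ∧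
      16 * r ≤ r4 ∧ 16 * r ≤ r5 := by
    obtain ⟨m, hm⟩ : ∃ m, m = min 1 (min r1 (min r2 (min r3 (min r4 r5)))) := ⟨_, rfl⟩
    have hm0 : 0 < m := by rw [hm]; positivity
    have hle := hm.le
    simp only [le_min_iff] at hle
    obtain ⟨a0, a1, a2, a3, a4, a5⟩ := hle
    exact ⟨m / 16, by positivity, by linarith, by linarith, by linarith, by linarith, by linarith, by linarith⟩
  obtain ⟨C, c1, c2, c3, c4, c5⟩ : ∃ C, C1 ≤ C ∧ C2 ≤ C ∧ C3 ≤ C ∧ C4 ≤ C ∧ C5 ≤ C := by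
    obtain ⟨m, hm⟩ : ∃ m, m = max C1 (max C2 (max C3 (max C4 C5))) := ⟨_, rfl⟩
    have hle := hm.ge
    simp only [max_le_iff] at hle
    exact ⟨m, hle⟩
  obtain ⟨C', hC', hF⟩ := FH_F0c hr hr1' (G1.mono k1 c1) (G2.mono k2 c2) (G3.mono k3 c3) (G4.mono k4 c4) (G5.mono k5 c5)
  obtain ⟨γ, hγ, δ, hδ, hδr, ρ, hρ, hρδ, hsm, ξ, hξa, hξδ, ⟨B, hB⟩, hQ, hpde, hexp⟩ := complex_main hr hC' hF
  have hρ1 : ρ ≤ 1 := hρδ.trans (hδr.trans hr1')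
  refine ⟨ρ, hρ, fun D hD => ?_⟩
  have hDo : IsOpen D := by
    rw [hD]
    exact ((isOpen_lt continuous_const continuous_fst).inter (isOpen_lt continuous_const continuous_snd)).inter isOpen_ball
  have hD1 : ∀ x ∈ D, 0 < x.1 ∧ ‖x‖ < ρ := by
    intro x hx
    rw [hD] at hx
    exact ⟨hx.1.1, mem_ball_zero_iff.1 hx.2⟩
  have hDU : ∀ x ∈ D, ∀ t : ℝ, emw (x, t) ∈ Ud ρ := fun x hx t => emw_Ud hρ (hD1 x hx).1 (hD1 x hx).2 t
  have hB0 : ∀ x : ℝ × ℝ, 0 < x.1 → ‖x‖ < ρ → ∀ t : ℝ, ‖ξ (emw (x, t))‖ ≤ B * ‖x‖ ^ 2 := by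
    intro x h1 h2 t
    have := hB _ (emw_Ud hρ h1 h2 t)
    rwa [emw_apply, emx_norm] at this
  have hK : ∀ x ∈ D, ∀ t, (if x ∈ D then Kr ξ x t else (x, 0)) = Kr ξ x t := fun x hx t => if_pos hx
  refine ⟨fun x t => if x ∈ D then Kr ξ x t else (x, 0), Yr γ, ?_, ?_, ?_, ?_, Yr_poly hγ, ?_, ?_, ?_⟩
  · refine ⟨2 * B, fun x hx t => ?_⟩
    simp only [hK x hx t]
    exact Kr_bound ((hD1 x hx).2.le.trans hρ1) (hB0 x (hD1 x hx).1 (hD1 x hx).2 t)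
  · intro x t
    by_cases hx : x ∈ D
    · simp only [if_pos hx]
      have e : emw (x, t + 2 * π) = ((emw (x, t)).1, (emw (x, t)).2 + tpi) := by
        simp [emw_apply, tpi]
      simp only [Kr, e, hQ.1 _ (hDU x hx t)]
    · simp only [if_neg hx]
  · rintro ⟨x, t⟩ ⟨hx, -⟩
    refine (Kr_ana (hξa _ (hDU x hx t))).congr ?_
    have : ∀ᶠ w : (ℝ × ℝ) × ℝ in 𝓝 (x, t), w.1 ∈ D := continuous_fst.continuousAt.eventually (hDo.mem_nhds hx)
    filter_upwards [this] with w hw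
    exact (hK w.1 hw w.2).symm
  · intro x hx t
    have e1 : (fun x' => if x' ∈ D then Kr ξ x' t else (x', 0)) =ᶠ[𝓝 x] fun x' => Kr ξ x' t := by
      filter_upwards [hDo.mem_nhds hx] with y hy
      exact hK y hy t
    rw [e1.fderiv_eq]
    simp only [if_pos hx]
    have b : ∀ {a s : ℝ}, 16 * r ≤ s → a < 4 * r → a < s := fun h1 h2 => by linarith
    exact invariance hX hr hr1' (fun v hv => E1 v fun i hi => b k1 (hv i hi)) (fun v hv => E2 v fun i hi => b k2 (hv i hi))
      (fun v hv => E3 v fun i hi => b k3 (hv i hi)) (fun v hv => E4 v fun i hi => b k4 (hv i hi))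
      (fun v hv => E5 v fun i hi => b k5 (hv i hi)) hγ (hξa _ (hDU x hx t)) ((hD1 x hx).2.trans_le (hρδ.trans hδr))
      ((hξδ _ (hDU x hx t)).trans_le hδr) (hQ.2 _ (hDU x hx t) (emw_real _)) (hpde _ (hDU x hx t) (emw_real _))
  · obtain ⟨C, hC⟩ := Yr_bound hγ
    exact ⟨C, fun x hx => hC x ((hD1 x hx).2.le.trans hρ1)⟩
  · intro x hx ψ h0 hd
    rw [hD] at hx ⊢
    exact stab hγ hsm hx h0 hd
  · intro ℓ hℓ
    obtain ⟨P, p1, p2, -, p4, B', ρ', hρ', p5⟩ := hexp ℓ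
    obtain ⟨Kb, q1, q2, C, q3⟩ := expansion hℓ hρ1 hB0 p1 p2 p4 hρ' p5
    refine ⟨Kb, q1, q2, C, fun x hx t => ?_⟩
    simp only [hK x hx t]
    exact q3 x (hD1 x hx).1 (hD1 x hx).2 t
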